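/- For all M, A, P > 0 there exist T', C₁, C₂ > 0, depending only on M, A and P, with the following property. Let T > 0 and let a : ℝ × ℝ × ℝ × [0,T] → ℝ be positive and locally Hölder continuous (there is α ∈ (0,1) such that for every bounded subset K of its domain there is C_K > 0 with |a(z) − a(z')| ≤ C_K·|z − z'|^α on K), such that a(p,q,x,t)·p² ≥ A whenever |p| ≥ P. Then, setting T'' = min(T,T'), there exists u : ℝ × (0,T''] → ℝ with continuous partial derivatives u_t, u_x, u_{xx}, satisfying u_t = a(u_x,u,x,t)·u_{xx} everywhere, |u(x,t)| ≤ M everywhere, |u_x(x,t)| ≤ C₁·√t·(1+t)·exp(C₂/t) for all (x,t), and such that for every x ≠ 0, u(x,t) → M·sign(x) as t → 0⁺ (an entire solution with the step function M·σ as initial data). -/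

import Mathlib

namespace DiscreteParabolic

/-- The second difference of a lattice function. -/
def lap (f : ℤ → ℝ) (i : ℤ) : ℝ := f (i + 1) - 2 * f i + f (i - 1)

/-- The backward parabolic lattice cylinder of radius `R` with vertex `(n₀, i₀)`. -/
def Cyl (μ R : ℝ) (n₀ : ℕ) (i₀ : ℤ) (n : ℕ) (i : ℤ) : Prop :=
  n ≤ n₀ ∧ μ * ((n₀ : ℝ) - n) ≤ R ^ 2 ∧ |(i : ℝ) - i₀| ≤ R

/-- The explicit scheme holds at the interior nodes of a cylinder. -/
def Solves (μ : ℝ) (b u : ℕ → ℤ → ℝ) (R : ℝ) (n₀ : ℕ) (i₀ : ℤ) : Prop :=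
  ∀ (n : ℕ) (i : ℤ), n < n₀ → μ * ((n₀ : ℝ) - n) ≤ R ^ 2 → |(i : ℝ) - i₀| + 1 ≤ R →
    u (n + 1) i = u n i + μ * b n i * lap (u n) i

/-- Lower bound for the coefficient together with the stability condition. -/
def Elliptic (μ lam : ℝ) (b : ℕ → ℤ → ℝ) (R : ℝ) (n₀ : ℕ) (i₀ : ℤ) : Prop :=
  ∀ n i, Cyl μ R n₀ i₀ n i → lam ≤ b n i ∧ μ * b n i ≤ 1 / 8

lemma cyl_induction {μ R : ℝ} {n₀ : ℕ} (hn : R ^ 2 ≤ μ * n₀) {P : ℕ → Prop}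
    (base : ∀ n ≤ n₀, μ * ((n₀ : ℝ) - n) ≤ R ^ 2 → R ^ 2 - μ ≤ μ * ((n₀ : ℝ) - n) → P n)
    (step : ∀ n < n₀, μ * ((n₀ : ℝ) - n) ≤ R ^ 2 → P n → P (n + 1)) (hμ : 0 < μ) :
    ∀ n ≤ n₀, μ * ((n₀ : ℝ) - n) ≤ R ^ 2 → P n := by
  intro n
  induction n with
  | zero =>
    intro h1 h2
    refine base 0 h1 h2 ?_
    simp
    linarith
  | succ n ih =>
    intro h1 h2
    by_cases h : μ * ((n₀ : ℝ) - n) ≤ R ^ 2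
    · exact step n (by omega) h (ih (by omega) h)
    · refine base (n + 1) h1 h2 ?_
      push_cast
      push Not at h
      linarith

lemma pair_le {p q a a₁ a₂ c c₁ c₂ φ φ₁ φ₂ φ₃ φ₄ : ℝ} (hp : 0 ≤ p) (hq : 0 ≤ q)
    (hpq : p + q ≤ 1 / 2) (h0 : a - c ≤ φ) (h1 : a₁ - c ≤ φ₁) (h2 : a₂ - c ≤ φ₂)
    (h3 : a - c₁ ≤ φ₃) (h4 : a - c₂ ≤ φ₄) :
    (a + p * (a₁ - 2 * a + a₂)) - (c + q * (c₁ - 2 * c + c₂)) ≤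
      φ + p * (φ₁ - 2 * φ + φ₂) + q * (φ₃ - 2 * φ + φ₄) := by
  have e1 := mul_nonneg hp (sub_nonneg.2 h1)
  have e2 := mul_nonneg hp (sub_nonneg.2 h2)
  have e3 := mul_nonneg hq (sub_nonneg.2 h3)
  have e4 := mul_nonneg hq (sub_nonneg.2 h4)
  have e0 := mul_nonneg (by linarith : 0 ≤ 1 - 2 * (p + q)) (sub_nonneg.2 h0)
  linarith

/-- Interior gradient estimate for schemes with merely bounded-below coefficients. -/
lemma gradient_estimate {μ lam R S : ℝ} {b u : ℕ → ℤ → ℝ} {n₀ : ℕ} {i₀ : ℤ}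
    (hμ : 0 < μ) (hμ1 : μ ≤ 1) (hlam : 0 < lam) (hR : 2 ≤ R) (hn : R ^ 2 ≤ μ * n₀)
    (hb : Elliptic μ lam b R n₀ i₀) (hs : Solves μ b u R n₀ i₀)
    (hu : ∀ n i, Cyl μ R n₀ i₀ n i → |u n i| ≤ S) :
    u n₀ (i₀ + 1) - u n₀ i₀ ≤ (24 + 4 / lam) * S / R := by
  have hR0 : 0 < R := by linarith
  have hS : 0 ≤ S := (abs_nonneg _).trans (hu n₀ i₀ ⟨le_rfl, by simp; positivity, by simp; linarith⟩)
  obtain ⟨N, hN⟩ : ∃ N, N = 8 + 2 / lam := ⟨_, rfl⟩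
  have hNl : (N - 8) * lam = 2 := by rw [hN]; field_simp; ring
  have hN8 : 8 ≤ N := by rw [hN]; have : 0 < 2 / lam := by positivity
                         linarith
  obtain ⟨e, he⟩ : ∃ e, e = 1 / R := ⟨_, rfl⟩
  have he0 : 0 < e := by rw [he]; positivity
  have he2 : e ≤ 1 / 2 := by rw [he]; apply one_div_le_one_div_of_le <;> linarith
  have heR : e * R = 1 := by rw [he]; field_simp
  obtain ⟨φ, hφ⟩ : ∃ φ : ℕ → ℤ → ℤ → ℝ, ∀ n i j, φ n i j =
      S * (N * (2 * ((j - i) * e) - ((j - i) * e) ^ 2) +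
      8 * (((i - i₀) * e) ^ 2 + ((j - i₀) * e) ^ 2) + 8 * (μ * ((n₀ : ℝ) - n) * e ^ 2)) :=
    ⟨_, fun _ _ _ => rfl⟩
  have key : ∀ n ≤ n₀, μ * ((n₀ : ℝ) - n) ≤ R ^ 2 → ∀ i j : ℤ, i ≤ j → |(i : ℝ) - i₀| ≤ R →
      |(j : ℝ) - i₀| ≤ R → (j : ℝ) - i ≤ R → u n j - u n i ≤ φ n i j := by
    have bd : ∀ n ≤ n₀, μ * ((n₀ : ℝ) - n) ≤ R ^ 2 → ∀ i j : ℤ, i ≤ j → |(i : ℝ) - i₀| ≤ R →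
      |(j : ℝ) - i₀| ≤ R → (j : ℝ) - i ≤ R →
      (R - 1 < |(i : ℝ) - i₀| ∨ R - 1 < |(j : ℝ) - i₀| ∨ R - 1 < (j : ℝ) - i ∨
        R ^ 2 - μ ≤ μ * ((n₀ : ℝ) - n)) → u n j - u n i ≤ φ n i j := by
      intro n hn1 hn2 i j hij hi hj hd hcase
      have h1 := abs_le.1 (hu n i ⟨hn1, hn2, hi⟩)
      have h2 := abs_le.1 (hu n j ⟨hn1, hn2, hj⟩)
      have hs0 : 0 ≤ ((j : ℝ) - i) * e := mul_nonneg (by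
        have : (i : ℝ) ≤ j := by exact_mod_cast hij
        linarith) he0.le
      have hs1 : ((j : ℝ) - i) * e ≤ 1 := heR ▸ (mul_comm R e) ▸ mul_le_mul_of_nonneg_right hd he0.le
      have hn3 : (0 : ℝ) ≤ μ * ((n₀ : ℝ) - n) * e ^ 2 := by
        have : (n : ℝ) ≤ n₀ := by exact_mod_cast hn1
        exact mul_nonneg (mul_nonneg hμ.le (by linarith)) (by positivity)
      have t1 : 0 ≤ N * (2 * (((j : ℝ) - i) * e) - (((j : ℝ) - i) * e) ^ 2) :=
        mul_nonneg (by linarith) (by linarith [mul_nonneg hs0 (sub_nonneg.2 hs1)])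
      have sqb : ∀ x : ℝ, R - 1 < |x| → 1 / 4 ≤ (x * e) ^ 2 := by
        intro x hx
        have h5 := mul_le_mul_of_nonneg_right hx.le he0.le
        have h6 : 1 / 2 ≤ |x| * e := by linarith
        rw [mul_pow, ← sq_abs x, ← mul_pow]
        linarith [pow_le_pow_left₀ (by norm_num) h6 2]
      have main : 2 ≤ N * (2 * (((j : ℝ) - i) * e) - (((j : ℝ) - i) * e) ^ 2) +
          8 * ((((i : ℝ) - i₀) * e) ^ 2 + (((j : ℝ) - i₀) * e) ^ 2) +
          8 * (μ * ((n₀ : ℝ) - n) * e ^ 2) := by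
        have q1 := sq_nonneg (((j : ℝ) - i₀) * e)
        have q2 := sq_nonneg (((i : ℝ) - i₀) * e)
        rcases hcase with h | h | h | h
        · linarith [sqb _ h]
        · linarith [sqb _ h]
        · have h5 := mul_le_mul_of_nonneg_right h.le he0.le
          have h5' : 1 / 2 ≤ ((j : ℝ) - i) * e := by linarith
          have h6 : 3 / 4 ≤ 2 * (((j : ℝ) - i) * e) - (((j : ℝ) - i) * e) ^ 2 := by
            linarith [mul_nonneg (sub_nonneg.2 h5') (sub_nonneg.2 hs1)]
          have h7 : 8 * (3 / 4) ≤ N * (2 * (((j : ℝ) - i) * e) - (((j : ℝ) - i) * e) ^ 2) :=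
            mul_le_mul hN8 h6 (by norm_num) (by linarith)
          linarith
        · have h5 : (R ^ 2 - μ) * e ^ 2 ≤ μ * ((n₀ : ℝ) - n) * e ^ 2 :=
            mul_le_mul_of_nonneg_right h (by positivity)
          have h6 : R ^ 2 * e ^ 2 = 1 := by rw [← mul_pow, mul_comm R, heR, one_pow]
          have h7 : μ * e ^ 2 ≤ 1 * (1 / 2) ^ 2 := by gcongr
          linarith
      calc u n j - u n i ≤ S * 2 := by linarith
        _ ≤ φ n i j := by rw [hφ]; exact mul_le_mul_of_nonneg_left main hS
    refine cyl_induction hn ?_ ?_ hμ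
    · intro n h1 h2 h3 i j h4 h5 h6 h7
      exact bd n h1 h2 i j h4 h5 h6 h7 (by tauto)
    · intro n h1 h2 ih i j hij hi hj hd
      have h2' : μ * ((n₀ : ℝ) - (n + 1 : ℕ)) ≤ R ^ 2 := by push_cast; linarith
      by_cases hc : R - 1 < |(i : ℝ) - i₀| ∨ R - 1 < |(j : ℝ) - i₀| ∨ R - 1 < (j : ℝ) - i
      · exact bd (n + 1) (by omega) h2' i j hij hi hj hd (by tauto)
      push Not at hc
      obtain ⟨ci, cj, cd⟩ := hc
      rcases eq_or_lt_of_le hij with rfl | hlt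
      · have hn3 : (0 : ℝ) ≤ μ * ((n₀ : ℝ) - (n + 1 : ℕ)) * e ^ 2 := by
          have : ((n + 1 : ℕ) : ℝ) ≤ n₀ := by exact_mod_cast h1
          exact mul_nonneg (mul_nonneg hμ.le (by linarith)) (by positivity)
        simp only [sub_self, hφ]
        have := mul_nonneg hS hn3
        have := mul_nonneg hS (sq_nonneg (((i : ℝ) - i₀) * e))
        linarith
      rw [hs n i h1 h2 (by linarith), hs n j h1 h2 (by linarith)]
      have bi := hb n i ⟨h1.le, h2, hi⟩
      have bj := hb n j ⟨h1.le, h2, hj⟩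
      have hijr : (i : ℝ) + 1 ≤ j := by exact_mod_cast hlt
      have ai := abs_le.1 ci
      have aj := abs_le.1 cj
      have I0 := ih i j hij hi hj hd
      have I1 := ih i (j + 1) (by omega) hi (by push_cast; rw [abs_le]; constructor <;> linarith)
        (by push_cast; linarith)
      have I2 := ih i (j - 1) (by omega) hi (by push_cast; rw [abs_le]; constructor <;> linarith)
        (by push_cast; linarith)
      have I3 := ih (i + 1) j (by omega) (by push_cast; rw [abs_le]; constructor <;> linarith) hj
        (by push_cast; linarith)
      have I4 := ih (i - 1) j (by omega) (by push_cast; rw [abs_le]; constructor <;> linarith) hj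
        (by push_cast; linarith)
      have pi : 0 ≤ μ * b n i := mul_nonneg hμ.le (by linarith)
      have pj : 0 ≤ μ * b n j := mul_nonneg hμ.le (by linarith)
      refine (pair_le pj pi (by linarith) I0 I1 I2 I3 I4).trans ?_
      have E1 : φ n i (j + 1) - 2 * φ n i j + φ n i (j - 1) = S * e ^ 2 * (16 - 2 * N) := by
        simp only [hφ]; push_cast; ring
      have E2 : φ n (i + 1) j - 2 * φ n i j + φ n (i - 1) j = S * e ^ 2 * (16 - 2 * N) := by
        simp only [hφ]; push_cast; ring
      have E3 : φ (n + 1) i j = φ n i j - 8 * (S * e ^ 2) * μ := by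
        simp only [hφ]; push_cast; ring
      rw [E1, E2, E3]
      have hbb : (8 - N) * (b n i + b n j) ≤ -4 := by
        have := mul_le_mul_of_nonneg_left (add_le_add bi.1 bj.1) (by linarith : 0 ≤ N - 8)
        linarith
      have hw : 0 ≤ S * e ^ 2 * μ := by positivity
      have := mul_le_mul_of_nonneg_left hbb hw
      linarith
  have h := key n₀ le_rfl (by simp; positivity) i₀ (i₀ + 1) (by omega) (by simp; linarith)
    (by simp; linarith) (by simp; linarith)
  refine h.trans ?_
  have : φ n₀ i₀ (i₀ + 1) = S * (N * (2 * e - e ^ 2) + 8 * e ^ 2) := by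
    simp only [hφ]; push_cast; ring
  rw [this]
  have h4 : (24 + 4 / lam) * S / R = S * ((2 * N + 8) * e) := by
    rw [hN, he]; field_simp; ring
  rw [h4]
  apply mul_le_mul_of_nonneg_left _ hS
  linarith [mul_nonneg (by linarith : 0 ≤ N - 8) (sq_nonneg e), mul_nonneg he0.le (by linarith : 0 ≤ 1 / 2 - e)]

lemma scheme_le {p a a₁ a₂ φ φ₁ φ₂ : ℝ} (hp : 0 ≤ p) (hp1 : p ≤ 1 / 2)
    (h0 : φ ≤ a) (h1 : φ₁ ≤ a₁) (h2 : φ₂ ≤ a₂) :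
    φ + p * (φ₁ - 2 * φ + φ₂) ≤ a + p * (a₁ - 2 * a + a₂) := by
  have e1 := mul_nonneg hp (sub_nonneg.2 h1)
  have e2 := mul_nonneg hp (sub_nonneg.2 h2)
  have e0 := mul_nonneg (by linarith : 0 ≤ 1 - 2 * p) (sub_nonneg.2 h0)
  linarith

/-- A function with one-sided Lipschitz control decreases slowly in time. -/
lemma drop_lower {μ Lam G A : ℝ} {b u : ℕ → ℤ → ℝ} {n₁ n₀ : ℕ} {c : ℤ} {I : ℕ}
    (hμ : 0 < μ) (hG0 : 0 ≤ G) (hI : 1 ≤ I)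
    (hs : ∀ n i, n₁ ≤ n → n < n₀ → |i - c| < I →
      u (n + 1) i = u n i + μ * b n i * lap (u n) i ∧ 0 ≤ b n i ∧ b n i ≤ Lam ∧ μ * b n i ≤ 1 / 8)
    (hG : ∀ n i, n₁ ≤ n → n ≤ n₀ → |i - c| ≤ I → u n c - G * I ≤ u n i)
    (hA : ∀ i, |i - c| ≤ I → A ≤ u n₁ i) :
    ∀ n, n₁ ≤ n → n ≤ n₀ → A - 2 * Lam * G * (μ * ((n : ℝ) - n₁)) / I ≤ u n c := by
  have hI0 : (0 : ℝ) < I := by exact_mod_cast hI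
  obtain ⟨g, hg⟩ : ∃ g, g = G / I := ⟨_, rfl⟩
  have hg0 : 0 ≤ g := by rw [hg]; positivity
  have hgI : g * I = G := by rw [hg]; field_simp
  have key : ∀ k : ℕ, n₁ + k ≤ n₀ → ∀ i, |i - c| ≤ I →
      A - g * ((i : ℝ) - c) ^ 2 - 2 * Lam * g * (μ * k) ≤ u (n₁ + k) i := by
    intro k
    induction k with
    | zero =>
      intro _ i hi
      have := hA i hi
      have : 0 ≤ g * ((i : ℝ) - c) ^ 2 := by positivity
      simp
      linarith
    | succ k ih =>
      intro hk
      have ih := ih (by omega)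
      have int : ∀ i, |i - c| < I →
          A - g * ((i : ℝ) - c) ^ 2 - 2 * Lam * g * (μ * (k + 1 : ℕ)) ≤ u (n₁ + k + 1) i := by
        intro i hi
        obtain ⟨he, hb0, hb1, hb2⟩ := hs (n₁ + k) i (by omega) (by omega) hi
        have hi' := abs_lt.1 hi
        rw [he]
        refine le_trans ?_ (scheme_le (by positivity) (by linarith) (ih i hi.le)
          (ih (i + 1) (by rw [abs_le]; omega)) (ih (i - 1) (by rw [abs_le]; omega)))
        push_cast
        have := mul_le_mul_of_nonneg_left hb1 (by positivity : 0 ≤ 2 * g * μ)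
        linarith
      intro i hi
      rcases lt_or_eq_of_le hi with h | h
      · exact int i h
      · have h1 := int c (by simp; omega)
        have h2 := hG (n₁ + k + 1) i (by omega) (by omega) hi
        have h3 : ((i : ℝ) - c) ^ 2 = (I : ℝ) ^ 2 := by
          rw [← sq_abs]
          congr 1
          exact_mod_cast h
        rw [← hgI] at h2
        simp only [sub_self] at h1
        rw [h3]
        show _ ≤ u (n₁ + k + 1) i
        linarith
  intro n h1 h2
  obtain ⟨k, rfl⟩ := Nat.exists_eq_add_of_le h1
  have := key k h2 c (by simp)
  simp only [sub_self] at this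
  push_cast
  have e : 2 * Lam * G * (μ * ((n₁ : ℝ) + k - n₁)) / I = 2 * Lam * g * (μ * k) := by
    rw [hg]; field_simp; ring
  rw [e]
  linarith

lemma two_add_sq_le (y : ℝ) : 2 + y ^ 2 ≤ Real.exp y + Real.exp (-y) := by
  wlog hy : 0 ≤ y generalizing y with H
  · have := H (-y) (by linarith)
    rw [neg_neg, neg_sq] at this
    linarith
  have h := Real.self_le_sinh_iff.2 (by linarith : 0 ≤ y / 2)
  rw [Real.sinh_eq] at h
  have h1 : Real.exp (y / 2) * Real.exp (y / 2) = Real.exp y := by rw [← Real.exp_add]; ring_nf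
  have h2 : Real.exp (-(y / 2)) * Real.exp (-(y / 2)) = Real.exp (-y) := by
    rw [← Real.exp_add]; ring_nf
  have h3 : Real.exp (y / 2) * Real.exp (-(y / 2)) = 1 := by rw [← Real.exp_add]; simp
  have h4 := mul_self_le_mul_self (by linarith : 0 ≤ y / 2) h
  linarith

lemma gauss_second_difference {k x : ℝ} (hk1 : k ≤ 1 / 2) :
    Real.exp (-(k * x ^ 2)) * (2 * k ^ 2 * x ^ 2 - 2 * k) ≤
      Real.exp (-(k * (x + 1) ^ 2)) - 2 * Real.exp (-(k * x ^ 2)) +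
        Real.exp (-(k * (x - 1) ^ 2)) := by
  have e1 : Real.exp (-(k * (x + 1) ^ 2)) =
      Real.exp (-(k * x ^ 2)) * (Real.exp (-k) * Real.exp (-(2 * k * x))) := by
    rw [← Real.exp_add, ← Real.exp_add]; ring_nf
  have e2 : Real.exp (-(k * (x - 1) ^ 2)) =
      Real.exp (-(k * x ^ 2)) * (Real.exp (-k) * Real.exp (2 * k * x)) := by
    rw [← Real.exp_add, ← Real.exp_add]; ring_nf
  have h1 : 1 - k ≤ Real.exp (-k) := by linarith [Real.add_one_le_exp (-k)]
  have h2 : 2 + (2 * k * x) ^ 2 ≤ Real.exp (2 * k * x) + Real.exp (-(2 * k * x)) := by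
    exact two_add_sq_le (2 * k * x)
  have h3 : (1 - k) * (2 + (2 * k * x) ^ 2) ≤
      Real.exp (-k) * (Real.exp (2 * k * x) + Real.exp (-(2 * k * x))) :=
    mul_le_mul h1 h2 (by positivity) (by positivity)
  have h4 : 2 * k ^ 2 * x ^ 2 - 2 * k ≤ (1 - k) * (2 + (2 * k * x) ^ 2) - 2 := by
    have : 0 ≤ k ^ 2 * x ^ 2 * (1 - 2 * k) := mul_nonneg (by positivity) (by linarith)
    linarith
  rw [e1, e2]
  have := mul_le_mul_of_nonneg_left (h4.trans (sub_le_sub_right h3 2)) (Real.exp_nonneg (-(k * x ^ 2)))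
  linarith

lemma exp_le_one_add_two_mul {y : ℝ} (h0 : 0 ≤ y) (h1 : y ≤ 1) : Real.exp y ≤ 1 + 2 * y := by
  have h2 := abs_le.1 (Real.abs_exp_sub_one_le (x := y) (by rw [abs_of_nonneg h0]; exact h1))
  rw [abs_of_nonneg h0] at h2
  linarith [h2.2]

/-- Values that are separated initially stay separated for a while. -/
lemma separation_persists {μ Lam ω : ℝ} {b u : ℕ → ℤ → ℝ} {n₁ nf : ℕ} {i₀ : ℤ} {I : ℕ}
    (hμ : 0 < μ) (hLam : 0 < Lam) (hω : 0 ≤ ω) (hI : 1 ≤ I)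
    (hs : ∀ n i, n₁ ≤ n → n < nf → |i - i₀| ≤ 8 * I →
      u (n + 1) i = u n i + μ * b n i * lap (u n) i ∧ 0 ≤ b n i ∧ b n i ≤ Lam ∧ μ * b n i ≤ 1 / 8)
    (hmono : ∀ n i j, n₁ ≤ n → n ≤ nf → |i - i₀| ≤ 8 * I → |j - i₀| ≤ 8 * I → i ≤ j →
      0 ≤ u n j - u n i ∧ u n j - u n i ≤ ω * (j - i))
    (hsep : ω * I ≤ u n₁ (i₀ + I) - u n₁ (i₀ - I))
    (htime : μ * ((nf : ℝ) - n₁) ≤ (I : ℝ) ^ 2 / (8 * Lam)) :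
    ∀ n i j, n₁ ≤ n → n ≤ nf → |i - i₀| ≤ 8 * I → |j - i₀| ≤ 8 * I → i ≤ i₀ - 2 * I →
      i₀ + 2 * I ≤ j → ω * I / 2 ≤ u n j - u n i := by
  intro n i j hn1 hn2 hi hj hi2 hj2
  have hI0 : (0 : ℝ) < I := by exact_mod_cast hI
  have hIz : (1 : ℤ) ≤ I := by exact_mod_cast hI
  have tm : 2 * Lam * ω * (μ * ((n : ℝ) - n₁)) / I ≤ ω * I / 4 := by
    have h1 : μ * ((n : ℝ) - n₁) ≤ (I : ℝ) ^ 2 / (8 * Lam) :=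
      le_trans (mul_le_mul_of_nonneg_left (by
        have : (n : ℝ) ≤ nf := by exact_mod_cast hn2
        linarith) hμ.le) htime
    rw [div_le_iff₀ hI0]
    have h2 := mul_le_mul_of_nonneg_left h1 (by positivity : 0 ≤ 2 * Lam * ω)
    have h3 : 2 * Lam * ω * ((I : ℝ) ^ 2 / (8 * Lam)) = ω * I / 4 * I := by field_simp; ring
    linarith
  have up := drop_lower (μ := μ) (Lam := Lam) (G := ω) (A := u n₁ (i₀ + I)) (b := b) (u := u)
    (n₁ := n₁) (n₀ := nf) (c := i₀ + 2 * I) (I := I) hμ hω hI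
    (fun n i h1 h2 h3 => hs n i h1 h2 (by rw [abs_lt] at h3; rw [abs_le]; omega))
    (by
      intro n i h1 h2 h3
      rw [abs_le] at h3
      rcases le_total i (i₀ + 2 * I) with h | h
      · have h4 := (hmono n i _ h1 h2 (by rw [abs_le]; omega) (by rw [abs_le]; omega) h).2
        have h5 : ((i₀ + 2 * I : ℤ) : ℝ) - i ≤ I := by
          have : (i₀ + 2 * I : ℤ) - i ≤ I := by omega
          exact_mod_cast this
        have := mul_le_mul_of_nonneg_left h5 hω
        linarith
      · have h4 := (hmono n _ i h1 h2 (by rw [abs_le]; omega) (by rw [abs_le]; omega) h).1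
        have : 0 ≤ ω * I := by positivity
        linarith)
    (by
      intro i h3
      rw [abs_le] at h3
      have h4 := (hmono n₁ (i₀ + I) i le_rfl (by omega) (by rw [abs_le]; omega)
        (by rw [abs_le]; omega) (by omega)).1
      linarith) n hn1 hn2
  have dn := drop_lower (μ := μ) (Lam := Lam) (G := ω) (A := - u n₁ (i₀ - I)) (b := b)
    (u := fun n i => - u n i)
    (n₁ := n₁) (n₀ := nf) (c := i₀ - 2 * I) (I := I) hμ hω hI
    (fun n i h1 h2 h3 => by
      obtain ⟨e1, e2⟩ := hs n i h1 h2 (by rw [abs_lt] at h3; rw [abs_le]; omega)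
      refine ⟨?_, e2⟩
      simp only [e1, lap]
      ring)
    (by
      intro n i h1 h2 h3
      rw [abs_le] at h3
      rcases le_total i (i₀ - 2 * I) with h | h
      · have h4 := (hmono n i _ h1 h2 (by rw [abs_le]; omega) (by rw [abs_le]; omega) h).1
        have : 0 ≤ ω * I := by positivity
        linarith
      · have h4 := (hmono n _ i h1 h2 (by rw [abs_le]; omega) (by rw [abs_le]; omega) h).2
        have h5 : (i : ℝ) - (i₀ - 2 * I : ℤ) ≤ I := by
          have : i - (i₀ - 2 * I : ℤ) ≤ I := by omega
          exact_mod_cast this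
        have := mul_le_mul_of_nonneg_left h5 hω
        linarith)
    (by
      intro i h3
      rw [abs_le] at h3
      have h4 := (hmono n₁ i (i₀ - I) le_rfl (by omega) (by rw [abs_le]; omega)
        (by rw [abs_le]; omega) (by omega)).1
      linarith) n hn1 hn2
  have m1 := (hmono n (i₀ + 2 * I) j hn1 hn2 (by rw [abs_le]; omega) hj hj2).1
  have m2 := (hmono n i (i₀ - 2 * I) hn1 hn2 hi (by rw [abs_le]; omega) hi2).1
  linarith

lemma gauss_pair_drift {p q E k X Y lam Lam b c μ K I : ℝ} (hE : 0 ≤ E) (hk : 0 ≤ k)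
    (hlam : 0 ≤ lam) (hb : lam ≤ b) (hb' : b ≤ Lam) (hc : lam ≤ c) (hc' : c ≤ Lam) (hμ : 0 ≤ μ)
    (hK : lam * K = 1160 * Lam) (hkI : k * I ^ 2 = K) (hr : I ^ 2 / 4 ≤ X ^ 2 + Y ^ 2)
    (hp : p = μ * b) (hq : q = μ * c) :
    2 * (k * (288 * Lam) * μ) * E ≤
      p * (E * (2 * k ^ 2 * X ^ 2 - 2 * k)) + q * (E * (2 * k ^ 2 * Y ^ 2 - 2 * k)) := by
  have h1 : 2 * lam * k ^ 2 * X ^ 2 - 2 * Lam * k ≤ b * (2 * k ^ 2 * X ^ 2 - 2 * k) := by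
    have e1 := mul_le_mul_of_nonneg_right hb (by positivity : 0 ≤ 2 * k ^ 2 * X ^ 2)
    have e2 := mul_le_mul_of_nonneg_right hb' (by positivity : 0 ≤ 2 * k)
    linarith
  have h2 : 2 * lam * k ^ 2 * Y ^ 2 - 2 * Lam * k ≤ c * (2 * k ^ 2 * Y ^ 2 - 2 * k) := by
    have e1 := mul_le_mul_of_nonneg_right hc (by positivity : 0 ≤ 2 * k ^ 2 * Y ^ 2)
    have e2 := mul_le_mul_of_nonneg_right hc' (by positivity : 0 ≤ 2 * k)
    linarith
  have h3 : k * (576 * Lam) ≤ 2 * lam * k ^ 2 * (X ^ 2 + Y ^ 2) - 4 * Lam * k := by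
    have e1 := mul_le_mul_of_nonneg_left hr (by positivity : 0 ≤ 2 * lam * k ^ 2)
    have e2 : 2 * lam * k ^ 2 * (I ^ 2 / 4) = k * (lam * K) / 2 := by rw [← hkI]; ring
    rw [e2, hK] at e1
    linarith
  have h4 := mul_le_mul_of_nonneg_left (h3.trans (by linarith : _ ≤
    b * (2 * k ^ 2 * X ^ 2 - 2 * k) + c * (2 * k ^ 2 * Y ^ 2 - 2 * k)))
    (mul_nonneg hμ hE)
  rw [hp, hq]
  linarith

/-- If the mean slope over a long interval is at least half the maximal slope, then later every
slope near the centre is bounded below by a fixed fraction of the maximal slope. -/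
lemma slope_growth {μ lam Lam ω K : ℝ} {b u : ℕ → ℤ → ℝ} {n₁ nf : ℕ} {i₀ k : ℤ} {I : ℕ}
    (hμ : 0 < μ) (hμ1 : μ ≤ 1) (hlam : 0 < lam) (hLam : 1 ≤ Lam) (hω : 0 ≤ ω) (hI : 4 ≤ I)
    (hs : ∀ n i, n₁ ≤ n → n < nf → |i - i₀| ≤ 8 * I →
      u (n + 1) i = u n i + μ * b n i * lap (u n) i ∧ lam ≤ b n i ∧ b n i ≤ Lam ∧
        μ * b n i ≤ 1 / 8)
    (hmono : ∀ n i j, n₁ ≤ n → n ≤ nf → |i - i₀| ≤ 8 * I → |j - i₀| ≤ 8 * I → i ≤ j →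
      0 ≤ u n j - u n i ∧ u n j - u n i ≤ ω * (j - i))
    (hsep : ω * I ≤ u n₁ (i₀ + I) - u n₁ (i₀ - I)) (hn : n₁ ≤ nf)
    (htime : μ * ((nf : ℝ) - n₁) ≤ (I : ℝ) ^ 2 / (8 * Lam))
    (htime' : (I : ℝ) ^ 2 / (16 * Lam) ≤ μ * ((nf : ℝ) - n₁))
    (hK : lam * K = 1160 * Lam) (hIK : 288 * Lam * K ≤ (I : ℝ) ^ 2)
    (hk : 2 * |k - i₀| ≤ I) :
    5 / 2 * K * Real.exp (-(18 * K)) * ω ≤ u nf (k + 1) - u nf k := by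
  have hI0 : (4 : ℝ) ≤ I := by exact_mod_cast hI
  have hI2 : (0 : ℝ) < (I : ℝ) ^ 2 := by positivity
  have hK0 : 0 < K := by
    by_contra h
    push Not at h
    have := mul_le_mul_of_nonneg_left h hlam.le
    linarith
  have sep := separation_persists (b := b) (Lam := Lam) hμ (by linarith) hω (by omega)
    (fun n i h1 h2 h3 => ⟨(hs n i h1 h2 h3).1, by linarith [(hs n i h1 h2 h3).2.1],
      (hs n i h1 h2 h3).2.2⟩) hmono hsep htime
  obtain ⟨k', hk'⟩ : ∃ k', k' = K / (I : ℝ) ^ 2 := ⟨_, rfl⟩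
  have hk'0 : 0 < k' := by rw [hk']; positivity
  have hk'I : k' * (I : ℝ) ^ 2 = K := by rw [hk']; field_simp
  have hk'κ : k' * (288 * Lam) ≤ 1 := by
    rw [hk', div_mul_eq_mul_div, div_le_one hI2]; linarith
  have hk'2 : k' ≤ 1 / 2 := by
    have := mul_le_mul_of_nonneg_left hLam hk'0.le
    linarith
  have hkr := abs_le.1 (by linarith : |k - i₀| ≤ (I : ℤ) - |k - i₀|)
  have hkr1 : 2 * ((k : ℝ) - i₀) ≤ I := by
    have : 2 * (k - i₀) ≤ I := by have := le_abs_self (k - i₀); omega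
    exact_mod_cast this
  have hkr2 : -(I : ℝ) ≤ 2 * ((k : ℝ) - i₀) := by
    have : -(I : ℤ) ≤ 2 * (k - i₀) := by have := neg_abs_le (k - i₀); omega
    exact_mod_cast this
  obtain ⟨E, hE⟩ : ∃ E : ℕ → ℤ → ℤ → ℝ, ∀ n i j, E n i j =
      Real.exp (-(k' * ((i : ℝ) - (k - 3 * I)) ^ 2)) *
      Real.exp (-(k' * ((j : ℝ) - (k + 3 * I)) ^ 2)) *
      Real.exp (-(k' * (288 * Lam) * (μ * ((nf : ℝ) - n)))) := ⟨_, fun _ _ _ => rfl⟩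
  have hEpos : ∀ n i j, 0 ≤ E n i j := fun n i j => by rw [hE]; positivity
  have hE1 : ∀ n i j, E n i j = Real.exp (-(k' * (((i : ℝ) - (k - 3 * I)) ^ 2 +
      ((j : ℝ) - (k + 3 * I)) ^ 2) + k' * (288 * Lam) * (μ * ((nf : ℝ) - n)))) := by
    intro n i j
    rw [hE, ← Real.exp_add, ← Real.exp_add]; ring_nf
  obtain ⟨φ, hφ⟩ : ∃ φ : ℕ → ℤ → ℤ → ℝ, ∀ n i j, φ n i j =
      ω * I / 2 * (E n i j - Real.exp (-(18 * K))) := ⟨_, fun _ _ _ => rfl⟩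
  have hη : 0 ≤ ω * I / 2 := by positivity
  have tpos : ∀ n ≤ nf, 0 ≤ k' * (288 * Lam) * (μ * ((nf : ℝ) - n)) := by
    intro n hn
    have : (n : ℝ) ≤ nf := by exact_mod_cast hn
    exact mul_nonneg (by positivity) (mul_nonneg hμ.le (by linarith))
  -- outside of the large ball or at the initial time the barrier is nonpositive
  have nonpos : ∀ (n : ℕ) (i j : ℤ), 18 * K ≤ k' * (((i : ℝ) - (k - 3 * I)) ^ 2 +
      ((j : ℝ) - (k + 3 * I)) ^ 2) + k' * (288 * Lam) * (μ * ((nf : ℝ) - n)) → φ n i j ≤ 0 := by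
    intro n i j h
    rw [hφ]
    refine mul_nonpos_of_nonneg_of_nonpos hη ?_
    rw [hE1, sub_nonpos]
    exact Real.exp_le_exp.2 (by linarith)
  have key : ∀ m : ℕ, n₁ + m ≤ nf → ∀ i j : ℤ, |i - i₀| ≤ 8 * I → |j - i₀| ≤ 8 * I → i ≤ j →
      φ (n₁ + m) i j ≤ u (n₁ + m) j - u (n₁ + m) i := by
    intro m
    induction m with
    | zero =>
      intro _ i j hi hj hij
      refine (nonpos _ _ _ ?_).trans (hmono n₁ i j le_rfl hn hi hj hij).1
      have h1 : 0 ≤ k' * (((i : ℝ) - (k - 3 * I)) ^ 2 + ((j : ℝ) - (k + 3 * I)) ^ 2) := by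
        positivity
      have h2 := mul_le_mul_of_nonneg_left htime' (by positivity : 0 ≤ k' * (288 * Lam))
      have h3 : k' * (288 * Lam) * ((I : ℝ) ^ 2 / (16 * Lam)) = 18 * K := by
        rw [← hk'I]; field_simp; ring
      simp only [add_zero]
      linarith
    | succ m ih =>
      intro hm i j hi hj hij
      have ih := ih (by omega)
      have mono := (hmono (n₁ + m + 1) i j (by omega) hm hi hj hij).1
      by_cases hin : ((i : ℝ) - (k - 3 * I)) ^ 2 + ((j : ℝ) - (k + 3 * I)) ^ 2 ≤ (I : ℝ) ^ 2 / 4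
      · have hsq : ∀ x : ℝ, x ^ 2 ≤ (I : ℝ) ^ 2 / 4 → |x| ≤ I / 2 := by
          intro x hx
          refine abs_le_of_sq_le_sq ?_ (by positivity)
          rw [div_pow]; linarith
        have a1 := abs_le.1 (hsq ((i : ℝ) - (k - 3 * I)) (by linarith [sq_nonneg ((j : ℝ) - (k + 3 * I))]))
        have a2 := abs_le.1 (hsq ((j : ℝ) - (k + 3 * I)) (by linarith [sq_nonneg ((i : ℝ) - (k - 3 * I))]))
        have s := sep (n₁ + m + 1) i j (by omega) hm hi hj
          (by have : (i : ℝ) ≤ i₀ - 2 * I := by linarith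
              exact_mod_cast this)
          (by have : (i₀ : ℝ) + 2 * I ≤ j := by linarith
              exact_mod_cast this)
        refine le_trans ?_ s
        rw [show n₁ + (m + 1) = n₁ + m + 1 from rfl, hφ]
        have : E (n₁ + m + 1) i j ≤ 1 := by
          rw [hE1]
          have h1 : 0 ≤ k' * (((i : ℝ) - (k - 3 * I)) ^ 2 + ((j : ℝ) - (k + 3 * I)) ^ 2) := by
            positivity
          exact Real.exp_le_one_iff.2 (by linarith [tpos (n₁ + m + 1) hm])
        calc ω * I / 2 * (E (n₁ + m + 1) i j - Real.exp (-(18 * K))) ≤ ω * I / 2 * 1 :=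
              mul_le_mul_of_nonneg_left (by linarith [Real.exp_nonneg (-(18 * K))]) hη
          _ = _ := mul_one _
      push Not at hin
      by_cases hout : 18 * (I : ℝ) ^ 2 ≤ ((i : ℝ) - (k - 3 * I)) ^ 2 + ((j : ℝ) - (k + 3 * I)) ^ 2
      · refine (nonpos _ _ _ ?_).trans mono
        have := mul_le_mul_of_nonneg_left hout hk'0.le
        have := tpos _ hm
        linarith
      push Not at hout
      have hlt : i < j := by
        refine lt_of_le_of_ne hij ?_
        rintro rfl
        have : ((i : ℝ) - (k - 3 * I)) ^ 2 + ((i : ℝ) - (k + 3 * I)) ^ 2 =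
          2 * ((i : ℝ) - k) ^ 2 + 18 * (I : ℝ) ^ 2 := by ring
        linarith [sq_nonneg ((i : ℝ) - k)]
      have hsq : ∀ x : ℝ, x ^ 2 ≤ 18 * (I : ℝ) ^ 2 → |x| ≤ 17 / 4 * I := by
        intro x hx
        refine abs_le_of_sq_le_sq ?_ (by positivity)
        rw [mul_pow]; linarith
      have a1 := abs_le.1 (hsq ((i : ℝ) - (k - 3 * I)) (by linarith [sq_nonneg ((j : ℝ) - (k + 3 * I))]))
      have a2 := abs_le.1 (hsq ((j : ℝ) - (k + 3 * I)) (by linarith [sq_nonneg ((i : ℝ) - (k - 3 * I))]))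
      have i1 : i + 1 ≤ i₀ + 8 * I := by
        have : (i : ℝ) + 1 ≤ i₀ + 8 * I := by linarith
        exact_mod_cast this
      have i2 : i₀ - 8 * I ≤ i - 1 := by
        have : (i₀ : ℝ) - 8 * I ≤ i - 1 := by linarith
        exact_mod_cast this
      have j1 : j + 1 ≤ i₀ + 8 * I := by
        have : (j : ℝ) + 1 ≤ i₀ + 8 * I := by linarith
        exact_mod_cast this
      have j2 : i₀ - 8 * I ≤ j - 1 := by
        have : (i₀ : ℝ) - 8 * I ≤ j - 1 := by linarith
        exact_mod_cast this
      obtain ⟨ei, bi1, bi2, bi3⟩ := hs (n₁ + m) i (by omega) (by omega) hi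
      obtain ⟨ej, bj1, bj2, bj3⟩ := hs (n₁ + m) j (by omega) (by omega) hj
      have I0 := ih i j hi hj hij
      have I1 := ih (i + 1) j (by rw [abs_le]; omega) hj (by omega)
      have I2 := ih (i - 1) j (by rw [abs_le]; omega) hj (by omega)
      have I3 := ih i (j + 1) hi (by rw [abs_le]; omega) (by omega)
      have I4 := ih i (j - 1) hi (by rw [abs_le]; omega) (by omega)
      have pl := pair_le (p := μ * b (n₁ + m) i) (q := μ * b (n₁ + m) j)
        (mul_nonneg hμ.le (by linarith)) (mul_nonneg hμ.le (by linarith)) (by linarith)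
        (by linarith : u (n₁ + m) i - u (n₁ + m) j ≤ - φ (n₁ + m) i j)
        (by linarith : u (n₁ + m) (i + 1) - u (n₁ + m) j ≤ - φ (n₁ + m) (i + 1) j)
        (by linarith : u (n₁ + m) (i - 1) - u (n₁ + m) j ≤ - φ (n₁ + m) (i - 1) j)
        (by linarith : u (n₁ + m) i - u (n₁ + m) (j + 1) ≤ - φ (n₁ + m) i (j + 1))
        (by linarith : u (n₁ + m) i - u (n₁ + m) (j - 1) ≤ - φ (n₁ + m) i (j - 1))
      rw [show n₁ + (m + 1) = n₁ + m + 1 from rfl]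
      rw [lap] at ei ej
      rw [← ei, ← ej] at pl
      suffices hφφ : φ (n₁ + m + 1) i j ≤ φ (n₁ + m) i j + μ * b (n₁ + m) i *
          (φ (n₁ + m) (i + 1) j - 2 * φ (n₁ + m) i j + φ (n₁ + m) (i - 1) j) +
          μ * b (n₁ + m) j * (φ (n₁ + m) i (j + 1) - 2 * φ (n₁ + m) i j + φ (n₁ + m) i (j - 1)) by
        linarith
      have gi := gauss_second_difference (k := k') (x := (i : ℝ) - (k - 3 * I)) hk'2
      have gj := gauss_second_difference (k := k') (x := (j : ℝ) - (k + 3 * I)) hk'2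
      have di : E (n₁ + m) i j * (2 * k' ^ 2 * ((i : ℝ) - (k - 3 * I)) ^ 2 - 2 * k') ≤
          E (n₁ + m) (i + 1) j - 2 * E (n₁ + m) i j + E (n₁ + m) (i - 1) j := by
        have := mul_le_mul_of_nonneg_right gi (mul_nonneg
          (Real.exp_nonneg (-(k' * ((j : ℝ) - (k + 3 * I)) ^ 2)))
          (Real.exp_nonneg (-(k' * (288 * Lam) * (μ * ((nf : ℝ) - (n₁ + m : ℕ)))))))
        simp only [hE, Int.cast_add, Int.cast_sub, Int.cast_one]
        rw [show (i : ℝ) + 1 - (k - 3 * I) = i - (k - 3 * I) + 1 by ring,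
          show (i : ℝ) - 1 - (k - 3 * I) = i - (k - 3 * I) - 1 by ring]
        linarith
      have dj : E (n₁ + m) i j * (2 * k' ^ 2 * ((j : ℝ) - (k + 3 * I)) ^ 2 - 2 * k') ≤
          E (n₁ + m) i (j + 1) - 2 * E (n₁ + m) i j + E (n₁ + m) i (j - 1) := by
        have := mul_le_mul_of_nonneg_right gj (mul_nonneg
          (Real.exp_nonneg (-(k' * ((i : ℝ) - (k - 3 * I)) ^ 2)))
          (Real.exp_nonneg (-(k' * (288 * Lam) * (μ * ((nf : ℝ) - (n₁ + m : ℕ)))))))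
        simp only [hE, Int.cast_add, Int.cast_sub, Int.cast_one]
        rw [show (j : ℝ) + 1 - (k + 3 * I) = j - (k + 3 * I) + 1 by ring,
          show (j : ℝ) - 1 - (k + 3 * I) = j - (k + 3 * I) - 1 by ring]
        linarith
      have dt : E (n₁ + m + 1) i j ≤ E (n₁ + m) i j * (1 + 2 * (k' * (288 * Lam) * μ)) := by
        have h1 : E (n₁ + m + 1) i j = E (n₁ + m) i j * Real.exp (k' * (288 * Lam) * μ) := by
          rw [hE1, hE1, ← Real.exp_add]; push_cast; ring_nf
        rw [h1]
        refine mul_le_mul_of_nonneg_left (exp_le_one_add_two_mul (by positivity) ?_) (hEpos _ _ _)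
        exact mul_le_one₀ hk'κ hμ.le hμ1
      have dr := gauss_pair_drift (hEpos (n₁ + m) i j) hk'0.le hlam.le bi1 bi2 bj1 bj2 hμ.le hK
        hk'I hin.le rfl rfl
      have pi := mul_le_mul_of_nonneg_left di (mul_nonneg hμ.le (by linarith : 0 ≤ b (n₁ + m) i))
      have pj := mul_le_mul_of_nonneg_left dj (mul_nonneg hμ.le (by linarith : 0 ≤ b (n₁ + m) j))
      have tot : E (n₁ + m + 1) i j ≤ E (n₁ + m) i j + μ * b (n₁ + m) i *
          (E (n₁ + m) (i + 1) j - 2 * E (n₁ + m) i j + E (n₁ + m) (i - 1) j) +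
          μ * b (n₁ + m) j * (E (n₁ + m) i (j + 1) - 2 * E (n₁ + m) i j + E (n₁ + m) i (j - 1)) := by
        linarith
      have := mul_le_mul_of_nonneg_left tot hη
      simp only [hφ]
      linarith
  obtain ⟨m, rfl⟩ := Nat.exists_eq_add_of_le hn
  have ek1 := abs_le.1 (by omega : |k - i₀| ≤ (I : ℤ))
  have fin := key m le_rfl k (k + 1) (by rw [abs_le]; omega) (by rw [abs_le]; omega) (by omega)
  refine le_trans ?_ fin
  rw [hφ, hE1]
  have e1 : -(k' * (((k : ℝ) - (k - 3 * I)) ^ 2 + (((k + 1 : ℤ) : ℝ) - (k + 3 * I)) ^ 2) +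
      k' * (288 * Lam) * (μ * (((n₁ + m : ℕ) : ℝ) - (n₁ + m : ℕ)))) =
      -(18 * K) + k' * (6 * I - 1) := by
    rw [← hk'I]; push_cast; ring
  rw [e1, Real.exp_add]
  have e2 := Real.add_one_le_exp (k' * (6 * I - 1))
  have e3 : k' * (5 * I) ≤ k' * (6 * I - 1) := mul_le_mul_of_nonneg_left (by linarith) hk'0.le
  have e4 := mul_le_mul_of_nonneg_left (by linarith : k' * (5 * I) ≤
    Real.exp (k' * (6 * I - 1)) - 1) (mul_nonneg hη (Real.exp_nonneg (-(18 * K))))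
  have e5 : ω * I / 2 * Real.exp (-(18 * K)) * (k' * (5 * I)) =
    5 / 2 * (k' * (I : ℝ) ^ 2) * Real.exp (-(18 * K)) * ω := by ring
  rw [e5, hk'I] at e4
  linarith

lemma scale_induction {θ R₁ : ℝ} (hθ : 0 < θ) (hθ1 : θ < 1) {P : ℝ → Prop}
    (base : ∀ R, θ * R₁ < R → R ≤ R₁ → P R)
    (step : ∀ R, 0 < R → R ≤ θ * R₁ → P (R / θ) → P R) {R : ℝ} (hR : 0 < R) (hR1 : R ≤ R₁) :
    P R := by
  have key : ∀ k : ℕ, ∀ R, 0 < R → θ ^ k * R₁ < R → R ≤ R₁ → P R := by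
    intro k
    induction k with
    | zero =>
      intro R _ h1 h2
      simp at h1
      linarith
    | succ k ih =>
      intro R h0 h1 h2
      by_cases h : θ * R₁ < R
      · exact base R h h2
      · push Not at h
        refine step R h0 h (ih (R / θ) (by positivity) ?_ ?_)
        · rw [lt_div_iff₀ hθ]
          rw [pow_succ] at h1
          linarith
        · rw [div_le_iff₀ hθ]
          linarith
  have hR1' : 0 < R₁ := by linarith
  obtain ⟨k, hk⟩ := exists_pow_lt_of_lt_one (div_pos hR hR1') hθ1
  exact key k R hR ((lt_div_iff₀ hR1').1 hk) hR1

lemma sum_slopes {f : ℤ → ℝ} {m m' : ℝ} {i j : ℤ} (hij : i ≤ j)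
    (h : ∀ l, i ≤ l → l < j → m ≤ f (l + 1) - f l ∧ f (l + 1) - f l ≤ m') :
    m * ((j : ℝ) - i) ≤ f j - f i ∧ f j - f i ≤ m' * ((j : ℝ) - i) := by
  induction j, hij using Int.leInduction with
  | base => simp
  | succ j hj ih =>
    have h1 := ih fun l h1 h2 => h l h1 (by omega)
    have h2 := h j hj (by omega)
    push_cast
    constructor <;> linarith

/-- Upper and lower bounds for the coefficient, stability, and the scheme, in a cylinder. -/
structure Regular (μ lam Lam : ℝ) (b u : ℕ → ℤ → ℝ) (R : ℝ) (n₀ : ℕ) (i₀ : ℤ) : Prop where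
  elliptic : Elliptic μ lam b R n₀ i₀
  solves : Solves μ b u R n₀ i₀
  upper : ∀ n i, Cyl μ R n₀ i₀ n i → b n i ≤ Lam
  start : R ^ 2 ≤ μ * n₀

lemma Regular.mono {μ lam Lam R R' : ℝ} {b u : ℕ → ℤ → ℝ} {n₀ : ℕ} {i₀ : ℤ}
    (h : Regular μ lam Lam b u R n₀ i₀) (h0 : 0 ≤ R') (hR : R' ≤ R) :
    Regular μ lam Lam b u R' n₀ i₀ := by
  have h2 : R' ^ 2 ≤ R ^ 2 := by gcongr
  refine ⟨fun n i hc => h.elliptic n i ⟨hc.1, hc.2.1.trans h2, hc.2.2.trans hR⟩,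
    fun n i h3 h4 h5 => h.solves n i h3 (h4.trans h2) (h5.trans hR),
    fun n i hc => h.upper n i ⟨hc.1, hc.2.1.trans h2, hc.2.2.trans hR⟩, h2.trans h.start⟩

/-- Slope growth after subtraction of a linear function. -/
lemma slope_growth_affine {μ lam Lam ω K ε q : ℝ} {b u : ℕ → ℤ → ℝ} {n₁ nf : ℕ} {i₀ k : ℤ} {I : ℕ}
    (hμ : 0 < μ) (hμ1 : μ ≤ 1) (hlam : 0 < lam) (hLam : 1 ≤ Lam) (hω : 0 ≤ ω) (hI : 4 ≤ I)
    (hs : ∀ n i, n₁ ≤ n → n < nf → |i - i₀| ≤ 8 * I →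
      u (n + 1) i = u n i + μ * b n i * lap (u n) i ∧ lam ≤ b n i ∧ b n i ≤ Lam ∧
        μ * b n i ≤ 1 / 8)
    (hmono : ∀ n i, n₁ ≤ n → n ≤ nf → |i - i₀| ≤ 8 * I →
      0 ≤ ε * (u n (i + 1) - u n i) - q ∧ ε * (u n (i + 1) - u n i) - q ≤ ω)
    (hsep : ω * I ≤ ε * (u n₁ (i₀ + I) - u n₁ (i₀ - I)) - q * (2 * I)) (hn : n₁ ≤ nf)
    (htime : μ * ((nf : ℝ) - n₁) ≤ (I : ℝ) ^ 2 / (8 * Lam))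
    (htime' : (I : ℝ) ^ 2 / (16 * Lam) ≤ μ * ((nf : ℝ) - n₁))
    (hK : lam * K = 1160 * Lam) (hIK : 288 * Lam * K ≤ (I : ℝ) ^ 2)
    (hk : 2 * |k - i₀| ≤ I) :
    5 / 2 * K * Real.exp (-(18 * K)) * ω ≤ ε * (u nf (k + 1) - u nf k) - q := by
  have := slope_growth (u := fun n i => ε * u n i - q * i) hμ hμ1 hlam hLam hω hI
    (fun n i h1 h2 h3 => by
      obtain ⟨e, r⟩ := hs n i h1 h2 h3
      refine ⟨?_, r⟩
      simp only [e, lap]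
      push_cast
      ring)
    (fun n i j h1 h2 h3 h4 h5 => by
      rw [abs_le] at h3 h4
      have := sum_slopes (f := fun i => ε * u n i - q * i) (m := 0) (m' := ω) h5
        (fun l h6 h7 => by
          have := hmono n l h1 h2 (by rw [abs_le]; omega)
          push_cast
          constructor <;> linarith)
      simpa using this)
    (by push_cast; linarith) hn htime htime' hK hIK hk
  push_cast at this
  linarith

/-- The oscillation of the slopes decreases by a fixed factor on a smaller cylinder. -/
lemma oscillation_step {lam Lam : ℝ} (hlam : 0 < lam) (hlL : lam ≤ Lam) (hLam : 1 ≤ Lam) :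
    ∃ θ c : ℝ, 0 < θ ∧ θ ≤ 1 / 2 ∧ 0 < c ∧ c ≤ 1 / 2 ∧
      ∀ (μ R m ω : ℝ) (b u : ℕ → ℤ → ℝ) (n₀ : ℕ) (i₀ : ℤ), 0 < μ → μ ≤ 1 → 1 ≤ θ * R → 0 ≤ ω →
      Regular μ lam Lam b u R n₀ i₀ →
      (∀ n i, Cyl μ R n₀ i₀ n i → m ≤ u n (i + 1) - u n i ∧ u n (i + 1) - u n i ≤ m + ω) →
      ∃ m', ∀ n i, Cyl μ (θ * R) n₀ i₀ n i →
        m' ≤ u n (i + 1) - u n i ∧ u n (i + 1) - u n i ≤ m' + (1 - c) * ω := by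
  obtain ⟨K, hKd⟩ : ∃ K, K = 1160 * Lam / lam := ⟨_, rfl⟩
  have hK : lam * K = 1160 * Lam := by rw [hKd]; field_simp
  have hK1 : 1160 ≤ K := by rw [hKd, le_div_iff₀ hlam]; linarith
  obtain ⟨y, hy⟩ : ∃ y, y = 288 * Lam * K := ⟨_, rfl⟩
  have hyL : 288 * 1160 * Lam ≤ y := by
    rw [hy]
    linarith [mul_le_mul_of_nonneg_left hK1 (by linarith : 0 ≤ Lam)]
  obtain ⟨c, hc⟩ : ∃ c, c = 5 / 2 * K * Real.exp (-(18 * K)) := ⟨_, rfl⟩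
  have hc0 : 0 < c := by rw [hc]; positivity
  have hc1 : c ≤ 1 / 2 := by
    rw [hc, Real.exp_neg, ← div_eq_mul_inv, div_le_iff₀ (Real.exp_pos _)]
    linarith [Real.add_one_le_exp (18 * K)]
  have hy0 : 0 < y := by linarith
  refine ⟨1 / (18 * y), c, by positivity, ?_, hc0, hc1, ?_⟩
  · apply one_div_le_one_div_of_le <;> linarith
  intro μ R m ω b u n₀ i₀ hμ hμ1 hθR hω hreg hv
  obtain ⟨ρ, hρ⟩ : ∃ ρ, ρ = R / 18 := ⟨_, rfl⟩
  have hRρ : R = 18 * ρ := by rw [hρ]; ring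
  have hyρ : y ≤ ρ := by
    rw [one_div_mul_eq_div, le_div_iff₀ (by positivity)] at hθR
    linarith
  have hθρ : 1 / (18 * y) * R = ρ / y := by rw [hRρ]; field_simp
  rw [hθρ]
  obtain ⟨I, hI⟩ : ∃ I : ℕ, I = ⌊2 * ρ⌋₊ := ⟨_, rfl⟩
  have hI1 : (I : ℝ) ≤ 2 * ρ := by rw [hI]; exact Nat.floor_le (by linarith)
  have hI2 : ρ ≤ I := by rw [hI]; linarith [Nat.lt_floor_add_one (2 * ρ)]
  have hI4 : 4 ≤ I := by
    have : (4 : ℝ) ≤ I := by linarith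
    exact_mod_cast this
  have hII : ρ ^ 2 ≤ (I : ℝ) ^ 2 := by gcongr; linarith
  have hyy : y ≤ (I : ℝ) ^ 2 := by
    refine le_trans ?_ hII
    have := mul_le_mul hyρ (by linarith : 1 ≤ ρ) zero_le_one (by linarith)
    linarith
  have hIR : (I : ℝ) ^ 2 / (8 * Lam) ≤ R ^ 2 := by
    have h1 : (I : ℝ) ^ 2 ≤ (2 * ρ) ^ 2 := by gcongr
    have h2 : (I : ℝ) ^ 2 / (8 * Lam) ≤ (I : ℝ) ^ 2 := div_le_self (by positivity) (by linarith)
    rw [hRρ]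
    linarith [sq_nonneg ρ]
  obtain ⟨d, hd⟩ : ∃ d : ℕ, d = ⌊(I : ℝ) ^ 2 / (8 * Lam) / μ⌋₊ := ⟨_, rfl⟩
  have hd1 : μ * d ≤ (I : ℝ) ^ 2 / (8 * Lam) := by
    have : (d : ℝ) ≤ (I : ℝ) ^ 2 / (8 * Lam) / μ := by rw [hd]; exact Nat.floor_le (by positivity)
    rw [le_div_iff₀ hμ] at this
    linarith
  have hd2 : (I : ℝ) ^ 2 / (8 * Lam) - μ ≤ μ * d := by
    have : (I : ℝ) ^ 2 / (8 * Lam) / μ < d + 1 := by rw [hd]; exact Nat.lt_floor_add_one _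
    rw [div_lt_iff₀ hμ] at this
    linarith
  have hdn : d ≤ n₀ := by
    have : μ * d ≤ μ * n₀ := hd1.trans (hIR.trans hreg.start)
    exact_mod_cast le_of_mul_le_mul_left this hμ
  obtain ⟨n₁, rfl⟩ := Nat.exists_eq_add_of_le' hdn
  have hsmall : (I : ℝ) ^ 2 / (16 * Lam) = (I : ℝ) ^ 2 / (8 * Lam) - 2 * ((I : ℝ) ^ 2 / (32 * Lam)) := by
    field_simp; ring
  have hμI : μ ≤ (I : ℝ) ^ 2 / (32 * Lam) := by
    rw [le_div_iff₀ (by positivity)]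
    have := mul_le_mul_of_nonneg_right hμ1 (by linarith : 0 ≤ 32 * Lam)
    linarith
  have hρI : (ρ / y) ^ 2 ≤ (I : ℝ) ^ 2 / (32 * Lam) := by
    rw [div_pow]
    have h3 : 32 * Lam ≤ y ^ 2 := by
      have := mul_le_mul (by linarith : 32 * Lam ≤ y) (by linarith : 1 ≤ y) zero_le_one hy0.le
      linarith
    gcongr
  have window : ∀ n i, n₁ ≤ n → n ≤ n₁ + d → |i - i₀| ≤ 8 * I →
      Cyl μ R (n₁ + d) i₀ n i ∧ |(i : ℝ) - i₀| + 1 ≤ R := by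
    intro n i h1 h2 h3
    have h3' : |(i : ℝ) - i₀| ≤ 8 * I := by exact_mod_cast h3
    have h1' : (n₁ : ℝ) ≤ n := by exact_mod_cast h1
    refine ⟨⟨h2, le_trans ?_ (hd1.trans hIR), by linarith⟩, by linarith⟩
    push_cast
    exact mul_le_mul_of_nonneg_left (by linarith) hμ.le
  have hs : ∀ nf ≤ n₁ + d, ∀ n i, n₁ ≤ n → n < nf → |i - i₀| ≤ 8 * I →
      u (n + 1) i = u n i + μ * b n i * lap (u n) i ∧ lam ≤ b n i ∧ b n i ≤ Lam ∧
        μ * b n i ≤ 1 / 8 := by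
    intro nf h0 n i h1 h2 h3
    obtain ⟨w1, w2⟩ := window n i h1 (by omega) h3
    have e := hreg.elliptic n i w1
    exact ⟨hreg.solves n i (by omega) w1.2.1 w2, e.1, hreg.upper n i w1, e.2⟩
  have times : ∀ n i, Cyl μ (ρ / y) (n₁ + d) i₀ n i → n₁ ≤ n ∧
      μ * ((n : ℝ) - n₁) ≤ (I : ℝ) ^ 2 / (8 * Lam) ∧
      (I : ℝ) ^ 2 / (16 * Lam) ≤ μ * ((n : ℝ) - n₁) ∧ 2 * |i - i₀| ≤ I := by
    intro n i ⟨h1, h2, h3⟩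
    push_cast at h2
    have h4 : (I : ℝ) ^ 2 / (16 * Lam) ≤ μ * ((n : ℝ) - n₁) := by linarith
    have h5 : 0 < (I : ℝ) ^ 2 / (16 * Lam) := by positivity
    have h6 : (n₁ : ℝ) < n := by
      by_contra h
      push Not at h
      have := mul_le_mul_of_nonneg_left (sub_nonpos.2 h) hμ.le
      linarith
    have h7 : (n : ℝ) ≤ n₁ + d := by exact_mod_cast h1
    refine ⟨by exact_mod_cast h6.le, ?_, h4, ?_⟩
    · have := mul_le_mul_of_nonneg_left (by linarith : (n : ℝ) - n₁ ≤ d) hμ.le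
      linarith
    · have h8 : ρ / y ≤ ρ / 2 := by
        apply div_le_div_of_nonneg_left <;> linarith
      have : 2 * |(i : ℝ) - i₀| ≤ I := by linarith
      exact_mod_cast this
  by_cases hsep : ω * I ≤ (u n₁ (i₀ + I) - u n₁ (i₀ - I)) - m * (2 * I)
  · refine ⟨m + c * ω, fun n i hni => ?_⟩
    obtain ⟨t0, t1, t2, t3⟩ := times n i hni
    have g := slope_growth_affine (ε := 1) (q := m) hμ hμ1 hlam hLam hω hI4 (hs n hni.1)
      (fun n' i' h1 h2 h3 => by
        have := hv n' i' (window n' i' h1 (by have := hni.1; omega) h3).1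
        constructor <;> linarith) (by linarith) t0 t1 t2 hK (by linarith) t3
    rw [← hc] at g
    have ai : |i - i₀| ≤ 8 * I := by have := abs_nonneg (i - i₀); omega
    have := hv n i (window n i t0 hni.1 ai).1
    constructor <;> linarith
  · push Not at hsep
    refine ⟨m, fun n i hni => ?_⟩
    obtain ⟨t0, t1, t2, t3⟩ := times n i hni
    have g := slope_growth_affine (ε := -1) (q := -(m + ω)) hμ hμ1 hlam hLam hω hI4 (hs n hni.1)
      (fun n' i' h1 h2 h3 => by
        have := hv n' i' (window n' i' h1 (by have := hni.1; omega) h3).1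
        constructor <;> linarith) (by linarith) t0 t1 t2 hK (by linarith) t3
    rw [← hc] at g
    have ai : |i - i₀| ≤ 8 * I := by have := abs_nonneg (i - i₀); omega
    have := hv n i (window n i t0 hni.1 ai).1
    constructor <;> linarith

/-- Interior Hölder estimate for the slopes. -/
lemma slope_holder {lam Lam : ℝ} (hlam : 0 < lam) (hlL : lam ≤ Lam) (hLam : 1 ≤ Lam) :
    ∃ C γ : ℝ, 0 < C ∧ 0 < γ ∧ γ ≤ 1 ∧
      ∀ (μ R₀ G : ℝ) (b u : ℕ → ℤ → ℝ) (n₀ : ℕ) (i₀ : ℤ), 0 < μ → μ ≤ 1 → 0 ≤ G →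
      Regular μ lam Lam b u R₀ n₀ i₀ →
      (∀ n i, Cyl μ R₀ n₀ i₀ n i → |u n (i + 1) - u n i| ≤ G) →
      ∀ R, 1 ≤ R → R ≤ R₀ → ∃ m, ∀ n i, Cyl μ R n₀ i₀ n i →
        m ≤ u n (i + 1) - u n i ∧ u n (i + 1) - u n i ≤ m + C * G * (R / R₀) ^ γ := by
  obtain ⟨θ, c, hθ0, hθ1, hc0, hc1, H⟩ := oscillation_step hlam hlL hLam
  have hlogθ : Real.log θ < 0 := Real.log_neg hθ0 (by linarith)
  have hlogc : Real.log (1 - c) < 0 := Real.log_neg (by linarith) (by linarith)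
  obtain ⟨γ, hγ⟩ : ∃ γ, γ = min 1 (Real.log (1 - c) / Real.log θ) := ⟨_, rfl⟩
  have hγ0 : 0 < γ := by rw [hγ]; exact lt_min one_pos (div_pos_of_neg_of_neg hlogc hlogθ)
  have hγ1 : γ ≤ 1 := by rw [hγ]; exact min_le_left _ _
  have hcγ : 1 - c ≤ θ ^ γ := by
    rw [← Real.log_le_log_iff (by linarith) (by positivity), Real.log_rpow hθ0]
    have : γ ≤ Real.log (1 - c) / Real.log θ := by rw [hγ]; exact min_le_right _ _
    rw [le_div_iff_of_neg hlogθ] at this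
    linarith
  have hθγ : 0 < θ ^ γ := by positivity
  refine ⟨2 / θ ^ γ, γ, by positivity, hγ0, hγ1, ?_⟩
  intro μ R₀ G b u n₀ i₀ hμ hμ1 hG hreg hv R hR1 hR
  have hR0 : 0 < R₀ := by linarith
  refine scale_induction (P := fun R => 1 ≤ R → ∃ m, ∀ n i, Cyl μ R n₀ i₀ n i →
        m ≤ u n (i + 1) - u n i ∧ u n (i + 1) - u n i ≤ m + 2 / θ ^ γ * G * (R / R₀) ^ γ)
      hθ0 (by linarith) ?_ ?_ (by linarith : 0 < R) hR hR1
  · intro R h1 h2 h3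
    refine ⟨-G, fun n i hni => ?_⟩
    have hs2 : R ^ 2 ≤ R₀ ^ 2 := by gcongr
    have hb := abs_le.1 (hv n i ⟨hni.1, hni.2.1.trans hs2, hni.2.2.trans h2⟩)
    have h4 : θ ^ γ ≤ (R / R₀) ^ γ :=
      Real.rpow_le_rpow hθ0.le (by rw [le_div_iff₀ hR0]; exact h1.le) hγ0.le
    have h5 : 2 * G ≤ 2 / θ ^ γ * G * (R / R₀) ^ γ := by
      calc 2 * G = 2 / θ ^ γ * G * θ ^ γ := by field_simp
        _ ≤ _ := mul_le_mul_of_nonneg_left h4 (by positivity)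
    constructor <;> linarith
  · intro R h0 h1 ih h2
    have h3 : 1 ≤ R / θ := by rw [le_div_iff₀ hθ0]; linarith
    obtain ⟨m, hm⟩ := ih h3
    have e : θ * (R / θ) = R := by field_simp
    have h4 : R / θ ≤ R₀ := by rw [div_le_iff₀ hθ0]; linarith
    obtain ⟨m', hm'⟩ := H μ (R / θ) m _ b u n₀ i₀ hμ hμ1 (by rw [e]; exact h2) (by positivity)
      (hreg.mono (by positivity) h4) hm
    rw [e] at hm'
    refine ⟨m', fun n i hni => ⟨(hm' n i hni).1, (hm' n i hni).2.trans ?_⟩⟩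
    have h5 : (R / θ / R₀) ^ γ = (R / R₀) ^ γ / θ ^ γ := by
      rw [div_right_comm, Real.div_rpow (by positivity) hθ0.le]
    rw [h5]
    have h6 : (1 - c) * (2 / θ ^ γ * G * ((R / R₀) ^ γ / θ ^ γ)) ≤
        θ ^ γ * (2 / θ ^ γ * G * ((R / R₀) ^ γ / θ ^ γ)) :=
      mul_le_mul_of_nonneg_right hcγ (by positivity)
    have h7 : θ ^ γ * (2 / θ ^ γ * G * ((R / R₀) ^ γ / θ ^ γ)) = 2 / θ ^ γ * G * (R / R₀) ^ γ := by
      field_simp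
    linarith

lemma Cyl.mono {μ R R' : ℝ} {n₀ n : ℕ} {i₀ i : ℤ} (h : Cyl μ R' n₀ i₀ n i) (h0 : 0 ≤ R')
    (hR : R' ≤ R) : Cyl μ R n₀ i₀ n i :=
  ⟨h.1, h.2.1.trans (by gcongr), h.2.2.trans hR⟩

lemma Cyl.self {μ R : ℝ} {n₀ : ℕ} {i₀ : ℤ} (hR : 0 ≤ R) : Cyl μ R n₀ i₀ n₀ i₀ :=
  ⟨le_rfl, by simp; positivity, by simpa⟩

lemma sq_add_sq_le {R r r' : ℝ} (h0 : 0 ≤ r) (h0' : 0 ≤ r') (h : r + r' ≤ R) :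
    r ^ 2 + r' ^ 2 ≤ R ^ 2 := by
  have h1 : (r + r') ^ 2 ≤ R ^ 2 := by gcongr
  linarith [mul_nonneg h0 h0']

lemma Cyl.trans {μ R r r' : ℝ} {n₀ n n' : ℕ} {i₀ i i' : ℤ} (h : Cyl μ r n₀ i₀ n i)
    (h' : Cyl μ r' n i n' i') (h0 : 0 ≤ r) (h0' : 0 ≤ r') (hR : r + r' ≤ R) :
    Cyl μ R n₀ i₀ n' i' := by
  obtain ⟨a1, a2, a3⟩ := h
  obtain ⟨b1, b2, b3⟩ := h'
  refine ⟨b1.trans a1, ?_, ?_⟩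
  · linarith [sq_add_sq_le h0 h0' hR]
  · have : |(i' : ℝ) - i₀| ≤ |(i' : ℝ) - i| + |(i : ℝ) - i₀| := abs_sub_le _ _ _
    linarith

lemma Regular.sub {μ lam Lam R r r' : ℝ} {b u : ℕ → ℤ → ℝ} {n₀ n : ℕ} {i₀ i : ℤ}
    (h : Regular μ lam Lam b u R n₀ i₀) (hc : Cyl μ r n₀ i₀ n i) (h0 : 0 ≤ r) (h0' : 0 ≤ r')
    (hR : r + r' ≤ R) : Regular μ lam Lam b u r' n i := by
  have sq := sq_add_sq_le h0 h0' hR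
  refine ⟨fun n' i' h' => h.elliptic n' i' (hc.trans h' h0 h0' hR), fun n' i' h1 h2 h3 => ?_,
    fun n' i' h' => h.upper n' i' (hc.trans h' h0 h0' hR), ?_⟩
  · obtain ⟨a1, a2, a3⟩ := hc
    refine h.solves n' i' (by omega) (by linarith) ?_
    have : |(i' : ℝ) - i₀| ≤ |(i' : ℝ) - i| + |(i : ℝ) - i₀| := abs_sub_le _ _ _
    linarith
  · linarith [h.start, hc.2.1]

lemma Regular.neg {μ lam Lam R : ℝ} {b u : ℕ → ℤ → ℝ} {n₀ : ℕ} {i₀ : ℤ}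
    (h : Regular μ lam Lam b u R n₀ i₀) : Regular μ lam Lam b (fun n i => - u n i) R n₀ i₀ := by
  refine ⟨h.elliptic, fun n i h1 h2 h3 => ?_, h.upper, h.start⟩
  simp only [h.solves n i h1 h2 h3, lap]
  ring

lemma abs_sub_le_of_slopes {f : ℤ → ℝ} {G R : ℝ} {c : ℤ}
    (h : ∀ i : ℤ, |(i : ℝ) - c| ≤ R → |f (i + 1) - f i| ≤ G) {i : ℤ} (hi : |(i : ℝ) - c| ≤ R) :
    |f i - f c| ≤ G * |(i : ℝ) - c| := by
  rcases le_total c i with hc | hc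
  · have hc' : (c : ℝ) ≤ i := by exact_mod_cast hc
    have := sum_slopes (f := f) (m := -G) (m' := G) hc (fun l h1 h2 => abs_le.1 (h l (by
      have h1' : (c : ℝ) ≤ l := by exact_mod_cast h1
      have h2' : (l : ℝ) ≤ i := by exact_mod_cast h2.le
      have := (le_abs_self _).trans hi
      rw [abs_of_nonneg (by linarith)]
      linarith)))
    rw [abs_of_nonneg (by linarith : 0 ≤ (i : ℝ) - c), abs_le]
    constructor <;> linarith
  · have hc' : (i : ℝ) ≤ c := by exact_mod_cast hc
    have := sum_slopes (f := f) (m := -G) (m' := G) hc (fun l h1 h2 => abs_le.1 (h l (by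
      have h1' : (i : ℝ) ≤ l := by exact_mod_cast h1
      have h2' : (l : ℝ) ≤ c := by exact_mod_cast h2.le
      have := (neg_le_abs _).trans hi
      rw [abs_of_nonpos (by linarith)]
      linarith)))
    rw [abs_of_nonpos (by linarith : (i : ℝ) - c ≤ 0), abs_le]
    constructor <;> linarith

lemma time_lower {μ lam Lam R G : ℝ} {b u : ℕ → ℤ → ℝ} {n₀ n : ℕ} {i₀ : ℤ}
    (hμ : 0 < μ) (hlam : 0 ≤ lam) (hLam : 0 ≤ Lam) (hG : 0 ≤ G) (hR : 1 ≤ R)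
    (hreg : Regular μ lam Lam b u R n₀ i₀)
    (hv : ∀ n i, Cyl μ R n₀ i₀ n i → |u n (i + 1) - u n i| ≤ G)
    (h1 : n ≤ n₀) (h2 : μ * ((n₀ : ℝ) - n) ≤ R ^ 2) :
    u n i₀ - (1 + 4 * Lam) * G * R ≤ u n₀ i₀ := by
  obtain ⟨I, hI⟩ : ∃ I : ℕ, I = ⌊R⌋₊ := ⟨_, rfl⟩
  have hI1 : (I : ℝ) ≤ R := by rw [hI]; exact Nat.floor_le (by linarith)
  have hI3 : 1 ≤ I := by rw [hI]; exact (Nat.le_floor (by simpa using hR))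
  have hI3' : (1 : ℝ) ≤ I := by exact_mod_cast hI3
  have hI2 : R ≤ 2 * I := by
    have : R < I + 1 := by rw [hI]; exact Nat.lt_floor_add_one R
    linarith
  have tm : ∀ n', n ≤ n' → n' ≤ n₀ → μ * ((n₀ : ℝ) - n') ≤ R ^ 2 := by
    intro n' h3 h4
    have h3' : (n : ℝ) ≤ n' := by exact_mod_cast h3
    exact le_trans (mul_le_mul_of_nonneg_left (by linarith) hμ.le) h2
  have lip : ∀ n' i, n ≤ n' → n' ≤ n₀ → |i - i₀| ≤ I → u n' i₀ - G * I ≤ u n' i := by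
    intro n' i h3 h4 h5
    have h5' : |(i : ℝ) - i₀| ≤ I := by exact_mod_cast h5
    have := abs_sub_le_of_slopes (f := u n') (R := R)
      (fun i hi => hv n' i ⟨h4, tm n' h3 h4, hi⟩) (h5'.trans hI1)
    have h6 := (abs_le.1 (this.trans (mul_le_mul_of_nonneg_left h5' hG))).1
    linarith
  have := drop_lower (μ := μ) (Lam := Lam) (G := G) (A := u n i₀ - G * I) (b := b) (u := u)
    (n₁ := n) (n₀ := n₀) (c := i₀) (I := I) hμ hG hI3
    (fun n' i h3 h4 h5 => by
      have h5' : |(i : ℝ) - i₀| + 1 ≤ I := by exact_mod_cast h5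
      have hc : Cyl μ R n₀ i₀ n' i := ⟨h4.le, tm n' h3 h4.le, by linarith⟩
      have e := hreg.elliptic n' i hc
      exact ⟨hreg.solves n' i h4 hc.2.1 (by linarith), by linarith, hreg.upper n' i hc, e.2⟩)
    lip (fun i hi => lip n i le_rfl h1 hi) n₀ h1 le_rfl
  refine le_trans ?_ this
  have e1 : 2 * Lam * G * (μ * ((n₀ : ℝ) - n)) / I ≤ 4 * Lam * G * R := by
    rw [div_le_iff₀ (by linarith)]
    have e2 := mul_le_mul_of_nonneg_left h2 (by positivity : 0 ≤ 2 * Lam * G)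
    have e3 := mul_le_mul_of_nonneg_left hI2 (by positivity : 0 ≤ 2 * Lam * G * R)
    linarith
  have e4 := mul_le_mul_of_nonneg_left hI1 hG
  linarith

/-- A bound on the slopes controls the variation on a cylinder. -/
lemma variation_le {μ lam Lam R G : ℝ} {b u : ℕ → ℤ → ℝ} {n₀ : ℕ} {i₀ : ℤ}
    (hμ : 0 < μ) (hlam : 0 ≤ lam) (hLam : 0 ≤ Lam) (hG : 0 ≤ G) (hR : 1 ≤ R)
    (hreg : Regular μ lam Lam b u R n₀ i₀)
    (hv : ∀ n i, Cyl μ R n₀ i₀ n i → |u n (i + 1) - u n i| ≤ G) {n : ℕ} {i : ℤ}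
    (hc : Cyl μ R n₀ i₀ n i) : |u n i - u n₀ i₀| ≤ (2 + 4 * Lam) * G * R := by
  have h1 := time_lower hμ hlam hLam hG hR hreg hv hc.1 hc.2.1
  have h2 := time_lower hμ hlam hLam hG hR hreg.neg (fun n i h => by
    have := hv n i h
    rw [abs_sub_comm] at this
    rwa [neg_sub_neg]) hc.1 hc.2.1
  have h3 := abs_le.1 ((abs_sub_le_of_slopes (f := u n) (R := R)
      (fun i hi => hv n i ⟨hc.1, hc.2.1, hi⟩) hc.2.2).trans
      (mul_le_mul_of_nonneg_left hc.2.2 hG))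
  rw [abs_le]
  constructor <;> linarith

lemma abs_slope_le {μ lam Lam R S : ℝ} {b u : ℕ → ℤ → ℝ} {n₀ : ℕ} {i₀ : ℤ}
    (hμ : 0 < μ) (hμ1 : μ ≤ 1) (hlam : 0 < lam) (hR : 2 ≤ R)
    (hreg : Regular μ lam Lam b u R n₀ i₀)
    (hu : ∀ n i, Cyl μ R n₀ i₀ n i → |u n i| ≤ S) :
    |u n₀ (i₀ + 1) - u n₀ i₀| ≤ (24 + 4 / lam) * S / R := by
  have h1 := gradient_estimate hμ hμ1 hlam hR hreg.start hreg.elliptic hreg.solves hu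
  have h2 := gradient_estimate hμ hμ1 hlam hR hreg.neg.start hreg.neg.elliptic hreg.neg.solves
    (fun n i h => by rw [abs_neg]; exact hu n i h)
  rw [abs_le]
  constructor <;> linarith

/-- Forward difference in space. -/
def fwd (f : ℕ → ℤ → ℝ) (n : ℕ) (i : ℤ) : ℝ := f n (i + 1) - f n i

/-- For constant coefficients the forward difference solves the same scheme, with a bound. -/
lemma fwd_regular {μ lam Lam β R S : ℝ} {h : ℕ → ℤ → ℝ} {n₀ : ℕ} {i₀ : ℤ}
    (hμ : 0 < μ) (hμ1 : μ ≤ 1) (hlam : 0 < lam) (hR : 4 ≤ R)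
    (hreg : Regular μ lam Lam (fun _ _ => β) h R n₀ i₀)
    (hu : ∀ n i, Cyl μ R n₀ i₀ n i → |h n i| ≤ S) :
    Regular μ lam Lam (fun _ _ => β) (fwd h) (R / 2) n₀ i₀ ∧
      ∀ n i, Cyl μ (R / 2) n₀ i₀ n i → |fwd h n i| ≤ (48 + 8 / lam) * S / R := by
  have hr := hreg.mono (R' := R / 2) (by linarith) (by linarith)
  refine ⟨⟨hr.elliptic, fun n i h1 h2 h3 => ?_, hr.upper, hr.start⟩, fun n i hc => ?_⟩
  · have h2' : μ * ((n₀ : ℝ) - n) ≤ R ^ 2 := by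
      refine h2.trans ?_
      gcongr
      linarith
    have e1 := hreg.solves n i h1 h2' (by linarith)
    have e2 := hreg.solves n (i + 1) h1 h2' (by
      have := abs_add_le ((i : ℝ) - i₀) 1
      rw [abs_one] at this
      push_cast
      rw [show (i : ℝ) + 1 - i₀ = i - i₀ + 1 by ring]
      linarith)
    simp only [fwd, lap] at e1 e2 ⊢
    rw [e1, e2, show i - 1 + 1 = i + 1 - 1 by ring]
    ring
  · have := abs_slope_le hμ hμ1 hlam (R := R / 2) (by linarith)
      (hreg.sub hc (by linarith) (by linarith) (by linarith))
      (fun n' i' h' => hu n' i' (hc.trans h' (by linarith) (by linarith) (by linarith)))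
    rw [fwd]
    refine this.trans (le_of_eq ?_)
    field_simp
    ring

/-- The caloric polynomial with prescribed value, slope and second difference at the vertex. -/
noncomputable def caloric (μ β : ℝ) (n₀ : ℕ) (i₀ : ℤ) (A B D : ℝ) (n : ℕ) (i : ℤ) : ℝ :=
  A + B * ((i : ℝ) - i₀) + D * (((i : ℝ) - i₀) * ((i : ℝ) - i₀ - 1) / 2 + β * (μ * ((n : ℝ) - n₀)))

/-- Second order expansion for solutions with constant coefficients. -/
lemma constant_taylor {lam Lam : ℝ} (hlam : 0 < lam) (hLam : 0 ≤ Lam) :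
    ∃ C : ℝ, 0 < C ∧ ∀ (μ β R S : ℝ) (h : ℕ → ℤ → ℝ) (n₀ : ℕ) (i₀ : ℤ),
      0 < μ → μ ≤ 1 → 16 ≤ R → Regular μ lam Lam (fun _ _ => β) h R n₀ i₀ →
      (∀ n i, Cyl μ R n₀ i₀ n i → |h n i| ≤ S) →
      ∃ A B D : ℝ, ∀ r, 1 ≤ r → r ≤ R / 8 → ∀ n i, Cyl μ r n₀ i₀ n i →
        |h n i - caloric μ β n₀ i₀ A B D n i| ≤ C * S * (r / R) ^ 3 := by
  obtain ⟨c, hc⟩ : ∃ c, c = 48 + 8 / lam := ⟨_, rfl⟩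
  have hc0 : 0 < c := by rw [hc]; positivity
  refine ⟨(2 + 4 * Lam) ^ 3 * (8 * c ^ 3), by positivity, ?_⟩
  intro μ β R S h n₀ i₀ hμ hμ1 hR hreg hu
  have hR0 : 0 < R := by linarith
  have hS : 0 ≤ S := (abs_nonneg _).trans (hu n₀ i₀ (Cyl.self hR0.le))
  obtain ⟨r1, b1⟩ := fwd_regular hμ hμ1 hlam (by linarith) hreg hu
  obtain ⟨r2, b2⟩ := fwd_regular hμ hμ1 hlam (by linarith) r1 b1
  obtain ⟨-, b3⟩ := fwd_regular hμ hμ1 hlam (by linarith) r2 b2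
  rw [← hc] at b3
  refine ⟨h n₀ i₀, fwd h n₀ i₀, fwd (fwd h) n₀ i₀, fun r hr1 hr n i hni => ?_⟩
  obtain ⟨T, hT⟩ : ∃ T, T = 8 * c ^ 3 * S / R ^ 3 := ⟨_, rfl⟩
  have hT0 : 0 ≤ T := by rw [hT]; positivity
  have b3' : ∀ n i, Cyl μ r n₀ i₀ n i → |fwd (fwd (fwd h)) n i| ≤ T := by
    intro n i hc'
    refine (b3 n i (hc'.mono (by linarith) (by linarith))).trans (le_of_eq ?_)
    rw [hT]
    field_simp
    ring
  have k0 : 0 ≤ 2 + 4 * Lam := by linarith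
  have s2 : ∀ n i, Cyl μ r n₀ i₀ n i → |fwd (fwd h) n i - fwd (fwd h) n₀ i₀| ≤
      (2 + 4 * Lam) * T * r := fun n i hc' =>
    variation_le hμ hlam.le hLam hT0 hr1 (r2.mono (by linarith) (by linarith)) b3' hc'
  have rem : ∀ (f : ℕ → ℤ → ℝ) (A B D : ℝ), Regular μ lam Lam (fun _ _ => β) f r n₀ i₀ →
      Regular μ lam Lam (fun _ _ => β) (fun n i => f n i - caloric μ β n₀ i₀ A B D n i) r n₀ i₀ := by
    intro f A B D hf
    refine ⟨hf.elliptic, fun n i h1 h2 h3 => ?_, hf.upper, hf.start⟩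
    simp only [hf.solves n i h1 h2 h3, lap, caloric]
    push_cast
    ring
  have s1 : ∀ n i, Cyl μ r n₀ i₀ n i → |fwd h n i -
      caloric μ β n₀ i₀ (fwd h n₀ i₀) (fwd (fwd h) n₀ i₀) 0 n i| ≤
      (2 + 4 * Lam) * ((2 + 4 * Lam) * T * r) * r := fun n i hc' => by
    have := variation_le (u := fun n i => fwd h n i -
      caloric μ β n₀ i₀ (fwd h n₀ i₀) (fwd (fwd h) n₀ i₀) 0 n i) hμ hlam.le hLam
      (by positivity : 0 ≤ (2 + 4 * Lam) * T * r) hr1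
      (rem _ _ _ _ (r1.mono (by linarith) (by linarith))) (fun n i hc' => by
        refine le_of_eq_of_le (congrArg _ ?_) (s2 n i hc')
        rw [show fwd (fwd h) n i = fwd h n (i + 1) - fwd h n i from rfl]
        simp only [caloric]
        push_cast
        ring) hc'
    refine le_of_eq_of_le (congrArg _ ?_) this
    simp [caloric]
  have s0 := variation_le (u := fun n i => h n i -
      caloric μ β n₀ i₀ (h n₀ i₀) (fwd h n₀ i₀) (fwd (fwd h) n₀ i₀) n i) hμ hlam.le hLam
      (by positivity : 0 ≤ (2 + 4 * Lam) * ((2 + 4 * Lam) * T * r) * r) hr1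
      (rem _ _ _ _ (hreg.mono (by linarith) (by linarith))) (fun n i hc' => by
        refine le_of_eq_of_le (congrArg _ ?_) (s1 n i hc')
        rw [show fwd h n i = h n (i + 1) - h n i from rfl]
        simp only [caloric]
        push_cast
        ring) hni
  have e0 : h n i - caloric μ β n₀ i₀ (h n₀ i₀) (fwd h n₀ i₀) (fwd (fwd h) n₀ i₀) n i =
      h n i - caloric μ β n₀ i₀ (h n₀ i₀) (fwd h n₀ i₀) (fwd (fwd h) n₀ i₀) n i -
      (h n₀ i₀ - caloric μ β n₀ i₀ (h n₀ i₀) (fwd h n₀ i₀) (fwd (fwd h) n₀ i₀) n₀ i₀) := by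
    simp [caloric]
  rw [e0]
  refine s0.trans (le_of_eq ?_)
  rw [hT]
  field_simp

open Classical in
/-- The solution of the constant coefficient scheme in a cylinder with the values of `w` on the
parabolic boundary. -/
noncomputable def replacement (μ β R : ℝ) (n₀ : ℕ) (i₀ : ℤ) (w : ℕ → ℤ → ℝ) : ℕ → ℤ → ℝ
  | 0, i => w 0 i
  | n + 1, i =>
    if μ * ((n₀ : ℝ) - n) ≤ R ^ 2 ∧ |(i : ℝ) - i₀| + 1 ≤ R then
      replacement μ β R n₀ i₀ w n i + μ * β * lap (replacement μ β R n₀ i₀ w n) i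
    else w (n + 1) i

lemma replacement_interior {μ β R : ℝ} {n₀ : ℕ} {i₀ : ℤ} {w : ℕ → ℤ → ℝ} {n : ℕ} {i : ℤ}
    (h1 : μ * ((n₀ : ℝ) - n) ≤ R ^ 2) (h2 : |(i : ℝ) - i₀| + 1 ≤ R) :
    replacement μ β R n₀ i₀ w (n + 1) i = replacement μ β R n₀ i₀ w n i +
      μ * β * lap (replacement μ β R n₀ i₀ w n) i := by
  rw [replacement, if_pos ⟨h1, h2⟩]

lemma replacement_bottom {μ β R : ℝ} {n₀ : ℕ} {i₀ : ℤ} {w : ℕ → ℤ → ℝ} {n : ℕ} {i : ℤ}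
    (h : R ^ 2 - μ < μ * ((n₀ : ℝ) - n)) :
    replacement μ β R n₀ i₀ w n i = w n i := by
  cases n with
  | zero => rw [replacement]
  | succ n =>
    rw [replacement, if_neg]
    rintro ⟨h1, -⟩
    push_cast at h
    linarith

lemma replacement_lateral {μ β R : ℝ} {n₀ : ℕ} {i₀ : ℤ} {w : ℕ → ℤ → ℝ} {n : ℕ} {i : ℤ}
    (h : R < |(i : ℝ) - i₀| + 1) :
    replacement μ β R n₀ i₀ w n i = w n i := by
  cases n with
  | zero => rw [replacement]
  | succ n =>
    rw [replacement, if_neg]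
    rintro ⟨-, h1⟩
    linarith

/-- Discrete maximum principle with a right-hand side, in a cylinder. -/
lemma max_principle {μ β R S F : ℝ} {e f : ℕ → ℤ → ℝ} {n₀ : ℕ} {i₀ : ℤ} (hμ : 0 < μ) (hβ : 0 ≤ β)
    (hμβ : μ * β ≤ 1 / 8) (hF : 0 ≤ F)
    (hs : ∀ (n : ℕ) (i : ℤ), n < n₀ → μ * ((n₀ : ℝ) - n) ≤ R ^ 2 → |(i : ℝ) - i₀| + 1 ≤ R →
      e (n + 1) i = e n i + μ * β * lap (e n) i + μ * f n i)
    (hf : ∀ n i, Cyl μ R n₀ i₀ n i → |f n i| ≤ F)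
    (hbot : ∀ n i, Cyl μ R n₀ i₀ n i → R ^ 2 - μ < μ * ((n₀ : ℝ) - n) → |e n i| ≤ S)
    (hbot' : ∀ i, Cyl μ R n₀ i₀ 0 i → |e 0 i| ≤ S)
    (hlat : ∀ n i, Cyl μ R n₀ i₀ n i → R < |(i : ℝ) - i₀| + 1 → |e n i| ≤ S) :
    ∀ n i, Cyl μ R n₀ i₀ n i → |e n i| ≤ S + F * R ^ 2 := by
  have key : ∀ n ≤ n₀, μ * ((n₀ : ℝ) - n) ≤ R ^ 2 → ∀ i : ℤ, |(i : ℝ) - i₀| ≤ R →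
      |e n i| ≤ S + F * (R ^ 2 - μ * ((n₀ : ℝ) - n)) := by
    intro n
    induction n with
    | zero =>
      intro h1 h2 i h3
      have := mul_nonneg hF (sub_nonneg.2 h2)
      linarith [hbot' i ⟨h1, h2, h3⟩]
    | succ n ih =>
      intro h1 h2 i hi
      have hc : Cyl μ R n₀ i₀ (n + 1) i := ⟨h1, h2, hi⟩
      have hF2 := mul_nonneg hF (sub_nonneg.2 h2)
      by_cases h3 : R < |(i : ℝ) - i₀| + 1
      · linarith [hlat _ i hc h3]
      push Not at h3
      by_cases h4 : μ * ((n₀ : ℝ) - n) ≤ R ^ 2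
      · have ih := ih (by omega) h4
        have hb : ∀ j : ℤ, |j - i| ≤ 1 → |(j : ℝ) - i₀| ≤ R := by
          intro j hj
          have hj' : |(j : ℝ) - i| ≤ 1 := by exact_mod_cast hj
          have : |(j : ℝ) - i₀| ≤ |(j : ℝ) - i| + |(i : ℝ) - i₀| := abs_sub_le _ _ _
          linarith
        have I0 := abs_le.1 (ih i hi)
        have I1 := abs_le.1 (ih (i + 1) (hb _ (by simp)))
        have I2 := abs_le.1 (ih (i - 1) (hb _ (by simp)))
        have If := abs_le.1 (hf n i ⟨by omega, h4, hi⟩)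
        rw [hs n i (by omega) h4 h3, lap]
        have p0 : 0 ≤ μ * β := mul_nonneg hμ.le hβ
        have up := scheme_le p0 (by linarith) I0.2 I1.2 I2.2
        have dn := scheme_le p0 (by linarith) I0.1 I1.1 I2.1
        have f1 := mul_le_mul_of_nonneg_left If.1 hμ.le
        have f2 := mul_le_mul_of_nonneg_left If.2 hμ.le
        push_cast
        rw [abs_le]
        constructor <;> linarith
      · have := hbot _ i hc (by push_cast; linarith)
        linarith
  intro n i hc
  refine (key n hc.1 hc.2.1 i hc.2.2).trans ?_
  have : (n : ℝ) ≤ n₀ := by exact_mod_cast hc.1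
  have := mul_nonneg hF (mul_nonneg hμ.le (sub_nonneg.2 this))
  linarith

/-- One step of the approximation by caloric polynomials. -/
lemma approximation_step {lam Lam : ℝ} (hlam : 0 < lam) (hLam : 0 ≤ Lam) :
    ∃ C : ℝ, 0 < C ∧ ∀ (μ β η K R S A B D : ℝ) (b u : ℕ → ℤ → ℝ) (n₀ : ℕ) (i₀ : ℤ),
      0 < μ → μ ≤ 1 → 16 ≤ R → 0 ≤ η → 0 ≤ K → lam ≤ β → β ≤ Lam → μ * β ≤ 1 / 8 →
      Regular μ lam Lam b u R n₀ i₀ →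
      (∀ n i, Cyl μ R n₀ i₀ n i → |b n i - β| ≤ η) →
      (∀ n i, Cyl μ R n₀ i₀ n i → |lap (u n) i| ≤ K) →
      (∀ n i, Cyl μ R n₀ i₀ n i → |u n i - caloric μ β n₀ i₀ A B D n i| ≤ S) →
      ∃ A' B' D' : ℝ, ∀ r, 1 ≤ r → r ≤ R / 8 → ∀ n i, Cyl μ r n₀ i₀ n i →
        |u n i - caloric μ β n₀ i₀ A' B' D' n i| ≤ C * S * (r / R) ^ 3 + η * K * R ^ 2 := by
  obtain ⟨C, hC, H⟩ := constant_taylor hlam hLam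
  refine ⟨C, hC, ?_⟩
  intro μ β η K R S A B D b u n₀ i₀ hμ hμ1 hR hη hK hβ1 hβ2 hβ3 hreg hb hK' hS
  obtain ⟨w, hw⟩ : ∃ w : ℕ → ℤ → ℝ, ∀ n i, w n i = u n i - caloric μ β n₀ i₀ A B D n i :=
    ⟨_, fun _ _ => rfl⟩
  obtain ⟨h, hh⟩ : ∃ h, h = replacement μ β R n₀ i₀ w := ⟨_, rfl⟩
  have hS' : ∀ n i, Cyl μ R n₀ i₀ n i → |w n i| ≤ S := fun n i hc => by rw [hw]; exact hS n i hc
  have h0 : ∀ i, h 0 i = w 0 i := fun i => by rw [hh, replacement]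
  have hbot : ∀ (n : ℕ) i, R ^ 2 - μ < μ * ((n₀ : ℝ) - n) → h n i = w n i := fun n i h1 => by
    rw [hh, replacement_bottom h1]
  have hlat : ∀ n (i : ℤ), R < |(i : ℝ) - i₀| + 1 → h n i = w n i := fun n i h1 => by
    rw [hh, replacement_lateral h1]
  have hsolve : ∀ (n : ℕ) (i : ℤ), n < n₀ → μ * ((n₀ : ℝ) - n) ≤ R ^ 2 → |(i : ℝ) - i₀| + 1 ≤ R →
      h (n + 1) i = h n i + μ * β * lap (h n) i := fun n i _ h2 h3 => by
    rw [hh, replacement_interior h2 h3]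
  have hβ0 : 0 ≤ β := by linarith
  have bound : ∀ n i, Cyl μ R n₀ i₀ n i → |h n i| ≤ S := by
    have := max_principle (e := h) (S := S) (f := fun _ _ => 0) hμ hβ0 hβ3 le_rfl
      (fun n i h1 h2 h3 => by rw [hsolve n i h1 h2 h3, mul_zero, add_zero]) (fun _ _ _ => by simp)
      (fun n i hc h1 => by rw [hbot n i h1]; exact hS' n i hc)
      (fun i hc => by rw [h0]; exact hS' 0 i hc)
      (fun n i hc h1 => by rw [hlat n i h1]; exact hS' n i hc)
    simpa using this
  have hreg' : Regular μ lam Lam (fun _ _ => β) h R n₀ i₀ :=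
    ⟨fun _ _ _ => ⟨hβ1, hβ3⟩, hsolve, fun _ _ _ => hβ2, hreg.start⟩
  have close : ∀ n i, Cyl μ R n₀ i₀ n i → |w n i - h n i| ≤ 0 + η * K * R ^ 2 := by
    refine max_principle (e := fun n i => w n i - h n i) (f := fun n i => (b n i - β) * lap (u n) i)
      hμ hβ0 hβ3 (by positivity) (fun n i h1 h2 h3 => ?_) (fun n i hc => ?_)
      (fun n i hc h1 => by rw [hbot n i h1]; simp) (fun i _ => by rw [h0]; simp)
      (fun n i hc h1 => by rw [hlat n i h1]; simp)
    · rw [hsolve n i h1 h2 h3, hw, hreg.solves n i h1 h2 h3]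
      simp only [lap, hw, caloric]
      push_cast
      ring
    · rw [abs_mul]
      exact mul_le_mul (hb n i hc) (hK' n i hc) (abs_nonneg _) hη
  obtain ⟨A', B', D', H'⟩ := H μ β R S h n₀ i₀ hμ hμ1 hR hreg' bound
  refine ⟨A + A', B + B', D + D', fun r hr1 hr n i hc => ?_⟩
  have e1 := abs_le.1 (H' r hr1 hr n i hc)
  have e2 := abs_le.1 (close n i (hc.mono (by linarith) (by linarith)))
  rw [hw] at e2
  have e3 : caloric μ β n₀ i₀ (A + A') (B + B') (D + D') n i =
      caloric μ β n₀ i₀ A B D n i + caloric μ β n₀ i₀ A' B' D' n i := by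
    simp only [caloric]; ring
  rw [e3, abs_le]
  constructor <;> linarith

/-- Comparison of the second differences of two quadratic approximations. -/
lemma second_difference_compare {R S S' D D' : ℝ} {f q q' : ℤ → ℝ} {c : ℤ} (hR : 1 ≤ R)
    (hq : ∀ m : ℤ, q (c + m) - 2 * q c + q (c - m) = D * m ^ 2)
    (hq' : ∀ m : ℤ, q' (c + m) - 2 * q' c + q' (c - m) = D' * m ^ 2)
    (hf : ∀ i : ℤ, |(i : ℝ) - c| ≤ R → |f i - q i| ≤ S)
    (hf' : ∀ i : ℤ, |(i : ℝ) - c| ≤ R → |f i - q' i| ≤ S') :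
    |D - D'| ≤ 16 * (S + S') / R ^ 2 := by
  obtain ⟨m, hm⟩ : ∃ m : ℤ, m = ⌊R⌋ := ⟨_, rfl⟩
  have hm1 : (m : ℝ) ≤ R := by rw [hm]; exact Int.floor_le R
  have hm2 : R < m + 1 := by rw [hm]; exact Int.lt_floor_add_one R
  have hm3 : (1 : ℝ) ≤ m := by
    have : 1 ≤ m := by rw [hm]; exact Int.le_floor.2 (by simpa using hR)
    exact_mod_cast this
  have am : |(m : ℝ)| ≤ R := by rw [abs_of_pos (by linarith)]; exact hm1
  have a1 := abs_le.1 (hf (c + m) (by push_cast; rwa [add_sub_cancel_left]))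
  have a2 := abs_le.1 (hf c (by simp; linarith))
  have a3 := abs_le.1 (hf (c - m) (by push_cast; rwa [sub_sub_cancel_left, abs_neg]))
  have b1 := abs_le.1 (hf' (c + m) (by push_cast; rwa [add_sub_cancel_left]))
  have b2 := abs_le.1 (hf' c (by simp; linarith))
  have b3 := abs_le.1 (hf' (c - m) (by push_cast; rwa [sub_sub_cancel_left, abs_neg]))
  have q1 := hq m
  have q2 := hq' m
  have h1 : |D - D'| * (m : ℝ) ^ 2 ≤ 4 * (S + S') := by
    rw [← abs_of_pos (by positivity : (0 : ℝ) < (m : ℝ) ^ 2), ← abs_mul, sub_mul, ← q1, ← q2, abs_le]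
    constructor <;> linarith
  have h2 : R ^ 2 ≤ 4 * (m : ℝ) ^ 2 := by
    have : R ^ 2 ≤ (2 * m) ^ 2 := by gcongr; linarith
    linarith
  rw [le_div_iff₀ (by positivity)]
  have := mul_le_mul_of_nonneg_left h2 (abs_nonneg (D - D'))
  linarith

lemma caloric_second_difference (μ β : ℝ) (n₀ : ℕ) (i₀ : ℤ) (A B D : ℝ) (n : ℕ) (c m : ℤ) :
    caloric μ β n₀ i₀ A B D n (c + m) - 2 * caloric μ β n₀ i₀ A B D n c +
      caloric μ β n₀ i₀ A B D n (c - m) = D * m ^ 2 := by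
  simp only [caloric]; push_cast; ring

/-- Approximation by caloric polynomials at all scales. -/
lemma caloric_approximation {lam Lam γ : ℝ} (hlam : 0 < lam) (hLam : 0 ≤ Lam) (hγ0 : 0 < γ)
    (hγ1 : γ < 1) :
    ∃ C : ℝ, 0 < C ∧
      ∀ (μ κ K R₁ S A : ℝ) (b u : ℕ → ℤ → ℝ) (n₀ : ℕ) (i₀ : ℤ),
      0 < μ → μ ≤ 1 → 0 ≤ κ → 0 ≤ K → 0 < R₁ →
      Regular μ lam Lam b u R₁ n₀ i₀ →
      (∀ r n i, 1 ≤ r → r ≤ R₁ → Cyl μ r n₀ i₀ n i → |b n i - b n₀ i₀| ≤ κ * (r / R₁) ^ γ) →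
      (∀ n i, Cyl μ R₁ n₀ i₀ n i → |lap (u n) i| ≤ K) →
      (∀ n i, Cyl μ R₁ n₀ i₀ n i → |u n i - A| ≤ S) →
      ∀ R, 1 ≤ R → R ≤ R₁ → ∃ A' B' D' : ℝ, ∀ n i, Cyl μ R n₀ i₀ n i →
        |u n i - caloric μ (b n₀ i₀) n₀ i₀ A' B' D' n i| ≤
          C * (S + κ * K * R₁ ^ 2) * (R / R₁) ^ (2 + γ) := by
  obtain ⟨C, hC, H⟩ := approximation_step hlam hLam
  -- the contraction ratio
  obtain ⟨θ, hθ0, hθ1, hθC⟩ : ∃ θ : ℝ, 0 < θ ∧ θ ≤ 1 / 32 ∧ C * θ ^ 3 ≤ θ ^ (2 + γ) / 2 := by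
    obtain ⟨τ, hτ⟩ : ∃ τ, τ = (1 / (2 * C)) ^ (1 / (1 - γ)) := ⟨_, rfl⟩
    have hτ0 : 0 < τ := by rw [hτ]; positivity
    refine ⟨min (1 / 32) τ, lt_min (by norm_num) hτ0, min_le_left _ _, ?_⟩
    obtain ⟨θ, hθ⟩ : ∃ θ, θ = min (1 / 32) τ := ⟨_, rfl⟩
    rw [← hθ]
    have hθ0 : 0 < θ := by rw [hθ]; exact lt_min (by norm_num) hτ0
    have h1 : θ ^ (1 - γ) ≤ 1 / (2 * C) := by
      have : θ ^ (1 - γ) ≤ τ ^ (1 - γ) :=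
        Real.rpow_le_rpow hθ0.le (by rw [hθ]; exact min_le_right _ _) (by linarith)
      refine this.trans (le_of_eq ?_)
      rw [hτ, ← Real.rpow_mul (by positivity), one_div_mul_cancel (by linarith), Real.rpow_one]
    have h2 : θ ^ 3 = θ ^ (2 + γ) * θ ^ (1 - γ) := by
      rw [← Real.rpow_add hθ0, ← Real.rpow_natCast]
      norm_num
    rw [h2]
    have := mul_le_mul_of_nonneg_left h1 (by positivity : 0 ≤ C * θ ^ (2 + γ))
    have e : C * θ ^ (2 + γ) * (1 / (2 * C)) = θ ^ (2 + γ) / 2 := by field_simp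
    linarith
  obtain ⟨t, ht⟩ : ∃ t, t = θ ^ (2 + γ) := ⟨_, rfl⟩
  have ht0 : 0 < t := by rw [ht]; positivity
  rw [← ht] at hθC
  refine ⟨2 / t, by positivity, ?_⟩
  intro μ κ K R₁ S A b u n₀ i₀ hμ hμ1 hκ hK hR₁ hreg hb hK' hS R hR1 hR
  have hS0 : 0 ≤ S := (abs_nonneg _).trans (hS n₀ i₀ (Cyl.self hR₁.le))
  obtain ⟨X, hX⟩ : ∃ X, X = 2 / t * (S + κ * K * R₁ ^ 2) := ⟨_, rfl⟩
  have hXt : X * t = 2 * (S + κ * K * R₁ ^ 2) := by rw [hX]; field_simp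
  have hκK : 0 ≤ κ * K * R₁ ^ 2 := by positivity
  have hX0 : 0 ≤ X := by rw [hX]; positivity
  rw [← hX]
  refine scale_induction (P := fun R => 1 ≤ R → ∃ A' B' D' : ℝ, ∀ n i, Cyl μ R n₀ i₀ n i →
        |u n i - caloric μ (b n₀ i₀) n₀ i₀ A' B' D' n i| ≤ X * (R / R₁) ^ (2 + γ))
      hθ0 (by linarith) ?_ ?_ (by linarith : 0 < R) hR hR1
  · intro R h1 h2 h3
    refine ⟨A, 0, 0, fun n i hc => ?_⟩
    have h4 : t ≤ (R / R₁) ^ (2 + γ) := by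
      rw [ht]
      exact Real.rpow_le_rpow hθ0.le (by rw [le_div_iff₀ hR₁]; exact h1.le) (by linarith)
    have h5 := hS n i (hc.mono (by linarith) h2)
    have h6 := mul_le_mul_of_nonneg_left h4 hX0
    simp only [caloric, zero_mul, add_zero]
    linarith
  · intro R h0 h1 ih h2
    have h3 : 32 ≤ R / θ := by
      rw [le_div_iff₀ hθ0]; linarith
    obtain ⟨A', B', D', h4⟩ := ih (by linarith)
    have h5 : R / θ ≤ R₁ := by rw [div_le_iff₀ hθ0]; linarith
    have eb := hreg.elliptic n₀ i₀ (Cyl.self hR₁.le)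
    obtain ⟨y, hy⟩ : ∃ y, y = R / θ := ⟨_, rfl⟩
    rw [← hy] at h3 h4 h5
    have hRy : R = θ * y := by rw [hy]; field_simp
    obtain ⟨A'', B'', D'', h6⟩ := H μ (b n₀ i₀) (κ * (y / R₁) ^ γ) K y _ A' B' D' b u n₀ i₀
      hμ hμ1 (by linarith) (by positivity) hK eb.1 (hreg.upper _ _ (Cyl.self hR₁.le)) eb.2
      (hreg.mono (by linarith) h5) (fun n i hc => hb y n i (by linarith) h5 hc)
      (fun n i hc => hK' n i (hc.mono (by linarith) h5)) h4
    refine ⟨A'', B'', D'', fun n i hc => ?_⟩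
    refine (h6 R h2 ?_ n i hc).trans ?_
    · rw [hRy]
      have := mul_le_mul_of_nonneg_right hθ1 (by linarith : 0 ≤ y)
      linarith
    have e1 : R / y = θ := by rw [hRy]; field_simp
    have e2 : (R / R₁) ^ (2 + γ) = t * (y / R₁) ^ (2 + γ) := by
      rw [hRy, mul_div_assoc, Real.mul_rpow hθ0.le (by positivity), ht]
    have e3 : κ * (y / R₁) ^ γ * K * y ^ 2 = κ * K * R₁ ^ 2 * (y / R₁) ^ (2 + γ) := by
      rw [Real.rpow_add (by positivity), show (y / R₁) ^ (2 : ℝ) = (y / R₁) ^ 2 from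
        Real.rpow_natCast _ 2]
      field_simp
    rw [e1, e2, e3]
    obtain ⟨z, hz⟩ : ∃ z, z = (y / R₁) ^ (2 + γ) := ⟨_, rfl⟩
    have hz0 : 0 ≤ z := by rw [hz]; positivity
    rw [← hz]
    have e4 := mul_le_mul_of_nonneg_left hθC (by positivity : 0 ≤ X * z)
    have e5 : κ * K * R₁ ^ 2 * z ≤ X * t / 2 * z := mul_le_mul_of_nonneg_right (by linarith) hz0
    linarith

lemma dyadic_induction {P : ℝ → Prop} (base : ∀ R, 1 ≤ R → R < 2 → P R)
    (step : ∀ R, 2 ≤ R → P (R / 2) → P R) : ∀ R, 1 ≤ R → P R := by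
  have key : ∀ (k : ℕ) (R : ℝ), 1 ≤ R → R < 2 ^ k → P R := by
    intro k
    induction k with
    | zero => intro R h1 h2; simp at h2; linarith
    | succ k ih =>
      intro R h1 h2
      rcases lt_or_ge R 2 with h | h
      · exact base R h1 h
      · refine step R h (ih _ (by linarith) ?_)
        rw [pow_succ] at h2
        linarith
  intro R hR
  obtain ⟨k, hk⟩ := pow_unbounded_of_one_lt R (by norm_num : (1 : ℝ) < 2)
  exact key k R hR hk

/-- Approximation of a solution by caloric polynomials at all scales, whose second differences
approximate that of the solution at the vertex. -/
lemma caloric_approximation_vertex {lam Lam γ : ℝ} (hlam : 0 < lam) (hLam : 0 ≤ Lam) (hγ0 : 0 < γ)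
    (hγ1 : γ < 1) :
    ∃ C : ℝ, 0 < C ∧
      ∀ (μ κ K R₁ S A : ℝ) (b u : ℕ → ℤ → ℝ) (n₀ : ℕ) (i₀ : ℤ),
      0 < μ → μ ≤ 1 → 0 ≤ κ → 0 ≤ K → 1 ≤ R₁ →
      Regular μ lam Lam b u R₁ n₀ i₀ →
      (∀ r n i, 1 ≤ r → r ≤ R₁ → Cyl μ r n₀ i₀ n i → |b n i - b n₀ i₀| ≤ κ * (r / R₁) ^ γ) →
      (∀ n i, Cyl μ R₁ n₀ i₀ n i → |lap (u n) i| ≤ K) →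
      (∀ n i, Cyl μ R₁ n₀ i₀ n i → |u n i - A| ≤ S) →
      |lap (u n₀) i₀| ≤ C * (S / R₁ ^ 2 + κ * K) ∧
      ∀ R, 1 ≤ R → R ≤ R₁ → ∃ A' B' D' : ℝ,
        |lap (u n₀) i₀ - D'| ≤ C * (S / R₁ ^ 2 + κ * K) * (R / R₁) ^ γ ∧
        ∀ n i, Cyl μ R n₀ i₀ n i →
        |u n i - caloric μ (b n₀ i₀) n₀ i₀ A' B' D' n i| ≤
          C * (S / R₁ ^ 2 + κ * K) * (R / R₁) ^ γ * R ^ 2 := by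
  obtain ⟨C, hC, H⟩ := caloric_approximation hlam hLam hγ0 hγ1
  obtain ⟨τ, hτ⟩ : ∃ τ : ℝ, τ = (1 / 2) ^ γ := ⟨_, rfl⟩
  have hτ1 : τ < 1 := by rw [hτ]; exact Real.rpow_lt_one (by norm_num) (by norm_num) hγ0
  have hτ0 : 0 < τ := by rw [hτ]; positivity
  obtain ⟨C', hC'⟩ : ∃ C', C' = 128 / (1 - τ) := ⟨_, rfl⟩
  have hC'1 : C' * τ + 128 = C' := by
    rw [hC']; field_simp [show (1 - τ) ≠ 0 by linarith]; ring
  have hC'2 : 128 ≤ C' := by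
    rw [hC', le_div_iff₀ (by linarith)]; linarith
  refine ⟨C * C' + 16 * C + 16, by positivity, ?_⟩
  intro μ κ K R₁ S A b u n₀ i₀ hμ hμ1 hκ hK hR₁ hreg hb hK' hS
  have hS0 : 0 ≤ S := (abs_nonneg _).trans (hS n₀ i₀ (Cyl.self (by linarith)))
  obtain ⟨Y, hY⟩ : ∃ Y, Y = S / R₁ ^ 2 + κ * K := ⟨_, rfl⟩
  have hY0 : 0 ≤ Y := by rw [hY]; positivity
  have hYR : S + κ * K * R₁ ^ 2 = Y * R₁ ^ 2 := by rw [hY]; field_simp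
  have hSY : S ≤ Y * R₁ ^ 2 := by
    rw [← hYR]
    have : 0 ≤ κ * K * R₁ ^ 2 := by positivity
    linarith
  rw [← hY]
  obtain ⟨z, hz⟩ : ∃ z : ℝ → ℝ, ∀ R, z R = (R / R₁) ^ γ := ⟨_, fun _ => rfl⟩
  have hz0 : ∀ R, 0 ≤ R → 0 ≤ z R := fun R hR => by rw [hz]; positivity
  have hzhalf : ∀ R, 0 ≤ R → z (R / 2) = τ * z R := fun R hR => by
    rw [hz, hz, hτ, ← Real.mul_rpow (by norm_num) (by positivity)]
    congr 1; ring
  have H' : ∀ R, ∃ A' B' D' : ℝ, 1 ≤ R → R ≤ R₁ → ∀ n i, Cyl μ R n₀ i₀ n i →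
      |u n i - caloric μ (b n₀ i₀) n₀ i₀ A' B' D' n i| ≤ C * Y * z R * R ^ 2 := by
    intro R
    by_cases h : 1 ≤ R ∧ R ≤ R₁
    · obtain ⟨A', B', D', h'⟩ := H μ κ K R₁ S A b u n₀ i₀ hμ hμ1 hκ hK (by linarith) hreg hb hK' hS
        R h.1 h.2
      refine ⟨A', B', D', fun _ _ n i hc => (h' n i hc).trans (le_of_eq ?_)⟩
      have hR0 : 0 < R := by linarith
      have hR₁0 : 0 < R₁ := by linarith
      rw [hYR, Real.rpow_add (by positivity), show (R / R₁) ^ (2 : ℝ) = (R / R₁) ^ 2 from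
        Real.rpow_natCast _ 2, ← hz]
      field_simp
    · exact ⟨0, 0, 0, fun h1 h2 => absurd ⟨h1, h2⟩ h⟩
  choose A' B' D' H' using H'
  have hq : ∀ R, ∀ m : ℤ, caloric μ (b n₀ i₀) n₀ i₀ (A' R) (B' R) (D' R) n₀ (i₀ + m) -
      2 * caloric μ (b n₀ i₀) n₀ i₀ (A' R) (B' R) (D' R) n₀ i₀ +
      caloric μ (b n₀ i₀) n₀ i₀ (A' R) (B' R) (D' R) n₀ (i₀ - m) = D' R * m ^ 2 :=
    fun R m => caloric_second_difference _ _ _ _ _ _ _ _ _ _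
  have hcyl : ∀ R, ∀ i : ℤ, |(i : ℝ) - i₀| ≤ R → Cyl μ R n₀ i₀ n₀ i := fun R i hi =>
    ⟨le_rfl, by rw [sub_self, mul_zero]; positivity, hi⟩
  have tele : ∀ R, 1 ≤ R → R ≤ R₁ → |lap (u n₀) i₀ - D' R| ≤ C * C' * Y * z R := by
    refine dyadic_induction ?_ ?_
    · intro R h1 h2 h3
      have e0 := abs_le.1 (H' R h1 h3 n₀ i₀ (hcyl R _ (by simp; linarith)))
      have e1 := abs_le.1 (H' R h1 h3 n₀ (i₀ + 1) (hcyl R _ (by simp; linarith)))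
      have e2 := abs_le.1 (H' R h1 h3 n₀ (i₀ - 1) (hcyl R _ (by simp; linarith)))
      have e3 := hq R 1
      have hR2 : R ^ 2 ≤ 2 ^ 2 := by gcongr
      have e4 := mul_le_mul_of_nonneg_left hR2
        (mul_nonneg (mul_nonneg hC.le hY0) (hz0 R (by linarith)))
      have e5 := mul_le_mul_of_nonneg_left hC'2
        (mul_nonneg (mul_nonneg hC.le hY0) (hz0 R (by linarith)))
      have e6 := mul_nonneg (mul_nonneg hC.le hY0) (hz0 R (by linarith))
      simp only [Int.cast_one, one_pow, mul_one] at e3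
      rw [lap, abs_le]
      constructor <;> linarith
    · intro R h1 ih h3
      have ih := ih (by linarith)
      rw [hzhalf R (by linarith)] at ih
      have e1 := second_difference_compare (f := u n₀) (c := i₀) (R := R / 2) (by linarith) (hq (R / 2))
        (hq R) (fun i hi => H' (R / 2) (by linarith) (by linarith) n₀ i (hcyl _ i hi))
        (fun i hi => H' R (by linarith) h3 n₀ i (hcyl _ i (by linarith)))
      rw [hzhalf R (by linarith)] at e1
      have e2 : 16 * (C * Y * (τ * z R) * (R / 2) ^ 2 + C * Y * z R * R ^ 2) / (R / 2) ^ 2 =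
          C * Y * z R * (16 * τ + 64) := by field_simp; ring
      rw [e2] at e1
      have e3 := mul_nonneg (mul_nonneg hC.le hY0) (hz0 R (by linarith))
      have e4 := mul_le_mul_of_nonneg_left (by linarith : 16 * τ + 64 ≤ 128) e3
      have e5 := abs_sub_le (lap (u n₀) i₀) (D' (R / 2)) (D' R)
      have e6 : C * C' * Y * z R = C * C' * Y * (τ * z R) + C * Y * z R * 128 := by
        linear_combination (- C * Y * z R) * hC'1
      linarith
  have hCY : 0 ≤ C * Y := mul_nonneg hC.le hY0
  refine ⟨?_, fun R h1 h2 => ⟨A' R, B' R, D' R, ?_, ?_⟩⟩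
  · have e1 := tele R₁ hR₁ le_rfl
    have e2 := second_difference_compare (f := u n₀) (q' := fun _ => A) (D' := 0) (S' := S) (c := i₀) hR₁
      (hq R₁) (fun m => by ring) (fun i hi => H' R₁ hR₁ le_rfl n₀ i (hcyl _ i hi))
      (fun i hi => hS n₀ i (hcyl _ i hi))
    have hz1 : z R₁ = 1 := by rw [hz, div_self (by linarith), Real.one_rpow]
    rw [hz1] at e1 e2
    have e3 : 16 * (C * Y * 1 * R₁ ^ 2 + S) / R₁ ^ 2 ≤ 16 * (C * Y + Y) := by
      rw [div_le_iff₀ (by positivity)]; linarith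
    have e4 := abs_sub_le (lap (u n₀) i₀) (D' R₁) 0
    rw [sub_zero] at e4
    linarith
  · rw [← hz]
    refine (tele R h1 h2).trans ?_
    have := mul_nonneg hCY (hz0 R (by linarith))
    have := mul_nonneg hY0 (hz0 R (by linarith))
    linarith
  · intro n i hc
    rw [← hz]
    refine (H' R h1 h2 n i hc).trans ?_
    have e1 := mul_nonneg (mul_nonneg hCY (hz0 R (by linarith))) (sq_nonneg R)
    have e2 := mul_nonneg (mul_nonneg hY0 (hz0 R (by linarith))) (sq_nonneg R)
    have e3 := mul_le_mul_of_nonneg_right hC'2 e1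
    linarith

/-- Hölder continuity, down to the lattice scale, of a lattice function on a cylinder. -/
def HolderOn (μ κ γ : ℝ) (b : ℕ → ℤ → ℝ) (R₀ : ℝ) (n₀ : ℕ) (i₀ : ℤ) : Prop :=
  ∀ (ρ : ℝ) (n : ℕ) (i : ℤ) (n' : ℕ) (i' : ℤ), 1 ≤ ρ → ρ ≤ R₀ → Cyl μ R₀ n₀ i₀ n i →
    Cyl μ R₀ n₀ i₀ n' i' → Cyl μ ρ n i n' i' → |b n' i' - b n i| ≤ κ * (ρ / R₀) ^ γ

lemma HolderOn.localize {μ κ γ R₀ s r : ℝ} {b : ℕ → ℤ → ℝ} {n₀ n : ℕ} {i₀ i : ℤ}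
    (h : HolderOn μ κ γ b R₀ n₀ i₀) (hs : 0 ≤ s) (hr : 1 ≤ r) (hsr : s + r ≤ R₀)
    (hc : Cyl μ s n₀ i₀ n i) (ρ : ℝ) (n' : ℕ) (i' : ℤ) (h1 : 1 ≤ ρ) (h2 : ρ ≤ r)
    (hc' : Cyl μ ρ n i n' i') : |b n' i' - b n i| ≤ κ * (r / R₀) ^ γ * (ρ / r) ^ γ := by
  refine (h ρ n i n' i' h1 (by linarith) (hc.mono hs (by linarith))
    (hc.trans hc' hs (by linarith) (by linarith)) hc').trans (le_of_eq ?_)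
  rw [mul_assoc, ← Real.mul_rpow (div_nonneg (by linarith) (by linarith))
    (div_nonneg (by linarith) (by linarith))]
  congr 2
  field_simp

lemma le_of_halving {P : ℝ → Prop} {B Z₀ v : ℝ} (h0 : P Z₀) (step : ∀ Z, P Z → P (B + Z / 2))
    (hv : ∀ Z, P Z → v ≤ Z) : v ≤ 2 * B := by
  have key : ∀ k : ℕ, P (2 * B + (Z₀ - 2 * B) * (1 / 2) ^ k) := by
    intro k
    induction k with
    | zero => simpa using h0
    | succ k ih =>
      have := step _ ih
      rw [pow_succ]
      convert this using 1
      ring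
  have lim : Filter.Tendsto (fun k : ℕ => 2 * B + (Z₀ - 2 * B) * (1 / 2 : ℝ) ^ k) Filter.atTop
      (nhds (2 * B + (Z₀ - 2 * B) * 0)) :=
    ((tendsto_pow_atTop_nhds_zero_of_lt_one (by norm_num) (by norm_num)).const_mul _).const_add _
  rw [mul_zero, add_zero] at lim
  exact ge_of_tendsto' lim fun k => hv _ (key k)

/-- Interior estimate of the second differences. -/
lemma interior_second_difference {lam Lam γ κ : ℝ} (hlam : 0 < lam) (hLam : 0 ≤ Lam) (hγ0 : 0 < γ)
    (hγ1 : γ < 1) (hκ : 0 ≤ κ) :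
    ∃ C : ℝ, 0 < C ∧ ∀ (μ R₀ G : ℝ) (b u : ℕ → ℤ → ℝ) (n₀ : ℕ) (i₀ : ℤ),
      0 < μ → μ ≤ 1 → 0 < R₀ → 0 ≤ G →
      Regular μ lam Lam b u R₀ n₀ i₀ → HolderOn μ κ γ b R₀ n₀ i₀ →
      (∀ n i, Cyl μ R₀ n₀ i₀ n i → |u n (i + 1) - u n i| ≤ G) →
      (∀ n i, Cyl μ R₀ n₀ i₀ n i → |lap (u n) i| ≤ 2 * G) →
      ∀ s n i, 0 ≤ s → s ≤ R₀ → Cyl μ s n₀ i₀ n i → (R₀ - s) * |lap (u n) i| ≤ C * G := by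
  obtain ⟨C, hC, H⟩ := caloric_approximation_vertex hlam hLam hγ0 hγ1
  obtain ⟨θ, hθ0, hθ1, hθ⟩ : ∃ θ : ℝ, 0 < θ ∧ θ ≤ 1 / 2 ∧ C * (κ * θ ^ γ * 2) ≤ 1 / 2 := by
    obtain ⟨τ, hτ⟩ : ∃ τ : ℝ, τ = (1 / (4 * C * (κ + 1))) ^ (1 / γ) := ⟨_, rfl⟩
    have hτ0 : 0 < τ := by rw [hτ]; positivity
    have e : τ ^ γ = 1 / (4 * C * (κ + 1)) := by
      rw [hτ, ← Real.rpow_mul (by positivity), one_div_mul_cancel hγ0.ne', Real.rpow_one]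
    refine ⟨min (1 / 2) τ, lt_min (by norm_num) hτ0, min_le_left _ _, ?_⟩
    have h1 : (min (1 / 2) τ) ^ γ ≤ τ ^ γ :=
      Real.rpow_le_rpow (le_min (by norm_num) hτ0.le) (min_le_right _ _) hγ0.le
    rw [e] at h1
    have h2 := mul_le_mul_of_nonneg_left h1 (by positivity : 0 ≤ C * κ * 2)
    have h3 : C * κ * 2 * (1 / (4 * C * (κ + 1))) ≤ 1 / 2 := by
      rw [mul_one_div, div_le_iff₀ (by positivity)]
      linarith
    linarith
  refine ⟨2 * (2 / θ + C * (2 + 4 * Lam) / θ), by positivity, ?_⟩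
  intro μ R₀ G b u n₀ i₀ hμ hμ1 hR₀ hG hreg hb hv hw s n i hs0 hs hc
  rw [mul_assoc]
  refine le_of_halving (P := fun Z => 0 ≤ Z ∧ ∀ s n i, 0 ≤ s → s ≤ R₀ → Cyl μ s n₀ i₀ n i →
    (R₀ - s) * |lap (u n) i| ≤ Z) (Z₀ := R₀ * (2 * G)) ⟨by positivity, ?_⟩ ?_
    (fun Z hZ => hZ.2 s n i hs0 hs hc)
  · intro s n i h0 h1 hc
    exact mul_le_mul (by linarith) (hw n i (hc.mono h0 h1)) (abs_nonneg _) hR₀.le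
  intro Z ⟨hZ0, hZ⟩
  refine ⟨by positivity, ?_⟩
  clear hc hs hs0 n i s
  intro s n i h0 h1 hc
  obtain ⟨d, hd⟩ : ∃ d, d = R₀ - s := ⟨_, rfl⟩
  rw [← hd]
  have hd0 : 0 ≤ d := by linarith
  have hw0 := hw n i (hc.mono h0 h1)
  rcases lt_or_ge (θ * d) 1 with hr | hr
  · have e1 : d ≤ 1 / θ := by rw [le_div_iff₀ hθ0]; linarith
    have e2 := mul_le_mul e1 hw0 (abs_nonneg _) (by positivity)
    have e3 : 1 / θ * (2 * G) = 2 / θ * G := by ring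
    have e4 : 0 ≤ C * (2 + 4 * Lam) / θ * G := by positivity
    linarith
  obtain ⟨r, hr'⟩ : ∃ r, r = θ * d := ⟨_, rfl⟩
  rw [← hr'] at hr
  have hrd : r ≤ d / 2 := by
    have := mul_le_mul_of_nonneg_right hθ1 hd0
    linarith
  have hsr : s + r ≤ R₀ := by linarith
  have hd1 : 0 < d := by linarith
  have hcyl : ∀ n' i', Cyl μ r n i n' i' → Cyl μ (s + r) n₀ i₀ n' i' := fun n' i' h =>
    hc.trans h h0 (by linarith) le_rfl
  have hreg' : Regular μ lam Lam b u r n i := hreg.sub hc h0 (by linarith) hsr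
  have h2 := (H μ (κ * (r / R₀) ^ γ) (2 * Z / d) r ((2 + 4 * Lam) * G * r) (u n i) b u n i hμ hμ1
    (by positivity) (by positivity) hr hreg' (fun ρ n' i' a1 a2 a3 => hb.localize h0 hr hsr hc ρ n' i' a1 a2 a3)
    (fun n' i' h => by
      have e1 := hZ (s + r) n' i' (by linarith) hsr (hcyl n' i' h)
      rw [le_div_iff₀ hd1]
      have e2 := mul_le_mul_of_nonneg_right (by linarith : d / 2 ≤ R₀ - (s + r))
        (abs_nonneg (lap (u n') i'))
      linarith)
    (fun n' i' h => variation_le hμ hlam.le hLam hG hr hreg'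
      (fun n'' i'' h'' => hv n'' i'' ((hcyl n'' i'' h'').mono (by linarith) hsr)) h)).1
  have e1 := mul_le_mul_of_nonneg_left h2 hd0
  have e2 : (r / R₀) ^ γ ≤ θ ^ γ := by
    refine Real.rpow_le_rpow (div_nonneg (by linarith) hR₀.le) ?_ hγ0.le
    rw [div_le_iff₀ hR₀, hr']
    exact mul_le_mul_of_nonneg_left (by linarith) hθ0.le
  have e3 : d * (C * ((2 + 4 * Lam) * G * r / r ^ 2 + κ * (r / R₀) ^ γ * (2 * Z / d))) =
      C * (2 + 4 * Lam) / θ * G + C * (κ * (r / R₀) ^ γ * 2) * Z := by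
    rw [show (2 + 4 * Lam) * G * r / r ^ 2 = (2 + 4 * Lam) * G / (θ * d) by rw [← hr']; field_simp]
    field_simp
  rw [e3] at e1
  have e4 := mul_le_mul_of_nonneg_left e2 (by positivity : 0 ≤ C * κ * 2 * Z)
  have e5 := mul_le_mul_of_nonneg_right hθ hZ0
  have e6 : 0 ≤ 2 / θ * G := by positivity
  linarith

/-- Interior Schauder estimate, uniform in the mesh. -/
lemma interior_schauder {lam Lam γ κ : ℝ} (hlam : 0 < lam) (hLam : 0 ≤ Lam) (hγ0 : 0 < γ)
    (hγ1 : γ < 1) (hκ : 0 ≤ κ) :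
    ∃ C : ℝ, 0 < C ∧ ∀ (μ R₀ G : ℝ) (b u : ℕ → ℤ → ℝ) (n₀ : ℕ) (i₀ : ℤ),
      0 < μ → μ ≤ 1 → 0 < R₀ → 0 ≤ G →
      Regular μ lam Lam b u R₀ n₀ i₀ → HolderOn μ κ γ b R₀ n₀ i₀ →
      (∀ n i, Cyl μ R₀ n₀ i₀ n i → |u n (i + 1) - u n i| ≤ G) →
      (∀ n i, Cyl μ R₀ n₀ i₀ n i → |lap (u n) i| ≤ 2 * G) →
      (∀ n i, Cyl μ (R₀ / 2) n₀ i₀ n i → |lap (u n) i| ≤ C * G / R₀) ∧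
      ∀ (ρ : ℝ) (n : ℕ) (i : ℤ) (n' : ℕ) (i' : ℤ), 1 ≤ ρ → ρ ≤ R₀ / 8 →
        Cyl μ (R₀ / 4) n₀ i₀ n i → Cyl μ ρ n i n' i' →
        |lap (u n') i' - lap (u n) i| ≤ C * G / R₀ * (ρ / R₀) ^ γ := by
  obtain ⟨C, hC, H⟩ := caloric_approximation_vertex hlam hLam hγ0 hγ1
  obtain ⟨C₁, hC₁, H₁⟩ := interior_second_difference hlam hLam hγ0 hγ1 hκ
  obtain ⟨C₂, hC₂⟩ : ∃ C₂, C₂ = C * (4 * (2 + 4 * Lam) + 4 * κ * C₁) := ⟨_, rfl⟩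
  have hC₂0 : 0 < C₂ := by rw [hC₂]; positivity
  refine ⟨2 * C₁ + 680 * C₂, by positivity, ?_⟩
  intro μ R₀ G b u n₀ i₀ hμ hμ1 hR₀ hG hreg hb hv hw
  have H₁ := H₁ μ R₀ G b u n₀ i₀ hμ hμ1 hR₀ hG hreg hb hv hw
  have hGR : 0 ≤ G / R₀ := by positivity
  constructor
  · intro n i hc
    have e1 := H₁ (R₀ / 2) n i (by linarith) (by linarith) hc
    rw [le_div_iff₀ hR₀]
    have : 0 ≤ C₂ * G := by positivity
    linarith
  have near : ∀ n i, 1 ≤ R₀ / 4 → Cyl μ (R₀ / 2) n₀ i₀ n i → ∀ R, 1 ≤ R → R ≤ R₀ / 4 →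
      ∃ A' B' D' : ℝ, |lap (u n) i - D'| ≤ C₂ * (G / R₀) * (4 * R / R₀) ^ γ ∧
        ∀ n' i', Cyl μ R n i n' i' → |u n' i' - caloric μ (b n i) n i A' B' D' n' i'| ≤
          C₂ * (G / R₀) * (4 * R / R₀) ^ γ * R ^ 2 := by
    intro n i hR4 hc R h1 h2
    have hcyl : ∀ n' i', Cyl μ (R₀ / 4) n i n' i' → Cyl μ (R₀ * (3 / 4)) n₀ i₀ n' i' :=
      fun n' i' h => hc.trans h (by linarith) (by linarith) (by linarith)
    have hreg' : Regular μ lam Lam b u (R₀ / 4) n i :=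
      hreg.sub hc (by linarith) (by linarith) (by linarith)
    obtain ⟨A', B', D', e1, e2⟩ := (H μ (κ * (R₀ / 4 / R₀) ^ γ) (4 * C₁ * (G / R₀)) (R₀ / 4)
      ((2 + 4 * Lam) * G * (R₀ / 4)) (u n i) b u n i hμ hμ1
      (by positivity) (by positivity) hR4 hreg'
      (fun ρ n' i' a1 a2 a3 => hb.localize (by linarith) hR4 (by linarith) hc ρ n' i' a1 a2 a3)
      (fun n' i' h => by
        have e1 := H₁ (R₀ * (3 / 4)) n' i' (by linarith) (by linarith) (hcyl n' i' h)
        rw [← mul_div_assoc, le_div_iff₀ hR₀]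
        linarith)
      (fun n' i' h => variation_le hμ hlam.le hLam hG hR4 hreg'
        (fun n'' i'' h'' => hv n'' i'' ((hcyl n'' i'' h'').mono (by linarith) (by linarith))) h)).2
        R h1 h2
    have e3 : C * ((2 + 4 * Lam) * G * (R₀ / 4) / (R₀ / 4) ^ 2 +
        κ * (R₀ / 4 / R₀) ^ γ * (4 * C₁ * (G / R₀))) ≤ C₂ * (G / R₀) := by
      have f1 : (2 + 4 * Lam) * G * (R₀ / 4) / (R₀ / 4) ^ 2 = 4 * (2 + 4 * Lam) * (G / R₀) := by
        field_simp
      have f2 : (R₀ / 4 / R₀) ^ γ ≤ 1 :=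
        Real.rpow_le_one (by positivity) (by rw [div_le_one hR₀]; linarith) hγ0.le
      have f3 := mul_le_mul_of_nonneg_left f2 (by positivity : 0 ≤ C * κ * (4 * C₁ * (G / R₀)))
      rw [f1, hC₂]
      linarith
    have e4 : R / (R₀ / 4) = 4 * R / R₀ := by field_simp
    rw [e4] at e1 e2
    have e5 := mul_le_mul_of_nonneg_right e3
      (Real.rpow_nonneg (by positivity : 0 ≤ 4 * R / R₀) γ)
    exact ⟨A', B', D', e1.trans e5, fun n' i' h =>
      (e2 n' i' h).trans (mul_le_mul_of_nonneg_right e5 (sq_nonneg R))⟩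
  intro ρ n i n' i' h1 h2 hc hc'
  obtain ⟨A, B, D, a1, a2⟩ := near n i (by linarith) (hc.mono (by linarith) (by linarith))
    (2 * ρ) (by linarith) (by linarith)
  obtain ⟨A', B', D', b1, b2⟩ := near n' i' (by linarith)
    (hc.trans hc' (by linarith) (by linarith) (by linarith)) ρ (by linarith) (by linarith)
  have hrow : ∀ k : ℤ, |(k : ℝ) - i'| ≤ ρ → Cyl μ ρ n' i' n' k := fun k hk =>
    ⟨le_rfl, by rw [sub_self, mul_zero]; positivity, hk⟩
  have e1 := second_difference_compare (f := u n') (c := i') h1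
    (fun m => caloric_second_difference μ (b n i) n i A B D n' i' m)
    (fun m => caloric_second_difference μ (b n' i') n' i' A' B' D' n' i' m)
    (fun k hk => a2 n' k (hc'.trans (hrow k hk) (by linarith) (by linarith) (by linarith)))
    (fun k hk => b2 n' k (hrow k hk))
  obtain ⟨z, hz⟩ : ∃ z, z = (ρ / R₀) ^ γ := ⟨_, rfl⟩
  have hz0 : 0 ≤ z := by rw [hz]; positivity
  have z1 : (4 * (2 * ρ) / R₀) ^ γ ≤ 8 * z := by
    rw [show 4 * (2 * ρ) / R₀ = 8 * (ρ / R₀) by ring, Real.mul_rpow (by norm_num) (by positivity), hz]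
    gcongr
    exact (Real.rpow_le_rpow_of_exponent_le (by norm_num) hγ1.le).trans (by norm_num)
  have z2 : (4 * ρ / R₀) ^ γ ≤ (4 * (2 * ρ) / R₀) ^ γ := by
    refine Real.rpow_le_rpow (by positivity) ?_ hγ0.le
    gcongr
    linarith
  rw [← hz]
  have hq : 0 ≤ C₂ * (G / R₀) := by positivity
  have y1 := mul_le_mul_of_nonneg_left z1 hq
  have y2 := mul_le_mul_of_nonneg_left (z2.trans z1) hq
  have e2 : 16 * (C₂ * (G / R₀) * (4 * (2 * ρ) / R₀) ^ γ * (2 * ρ) ^ 2 +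
      C₂ * (G / R₀) * (4 * ρ / R₀) ^ γ * ρ ^ 2) / ρ ^ 2 =
      64 * (C₂ * (G / R₀) * (4 * (2 * ρ) / R₀) ^ γ) + 16 * (C₂ * (G / R₀) * (4 * ρ / R₀) ^ γ) := by
    field_simp; ring
  rw [e2] at e1
  have e3 : (2 * C₁ + 680 * C₂) * G / R₀ * z = 2 * (C₁ * (G / R₀) * z) + 680 * (C₂ * (G / R₀) * z) := by
    ring
  have e4 : 0 ≤ C₁ * (G / R₀) * z := by positivity
  have a1 := abs_le.1 a1
  have b1 := abs_le.1 b1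
  have e1 := abs_le.1 e1
  have e5 : 0 ≤ C₂ * (G / R₀) * z := by positivity
  rw [e3, abs_le]
  constructor <;> linarith

/-- Interior estimates for a quasilinear scheme: the coefficient is a Hölder function, with exponent
`α`, of an intermediate slope `ξ`, the value, the position and the time. -/
lemma quasilinear_estimates {lam Lam α G κ r : ℝ} (hlam : 0 < lam) (hlL : lam ≤ Lam)
    (hLam : 1 ≤ Lam) (hα0 : 0 < α) (hα1 : α < 1) (hG : 0 ≤ G) (hκ : 0 ≤ κ) (hr0 : 0 < r)
    (hr1 : r ≤ 1) :
    ∃ C γ : ℝ, 0 < C ∧ 0 < γ ∧ γ < 1 ∧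
      ∀ (μ h : ℝ) (b U ξ : ℕ → ℤ → ℝ) (n₀ : ℕ) (i₀ : ℤ), 0 < μ → μ ≤ 1 → 0 < h → h ≤ r / 64 →
      Regular μ lam Lam b (fun n i => U n i / h) (r / h) n₀ i₀ →
      (∀ n i, n ≤ n₀ → μ * ((n₀ : ℝ) - n) ≤ (r / h) ^ 2 → |U n (i + 1) - U n i| ≤ G * h) →
      (∀ n i, Cyl μ (r / h) n₀ i₀ n i →
        ξ n i ∈ Set.uIcc ((U n i - U n (i - 1)) / h) ((U n (i + 1) - U n i) / h)) →
      (∀ n i n' i' δ, Cyl μ (r / h) n₀ i₀ n i → Cyl μ (r / h) n₀ i₀ n' i' →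
        |ξ n' i' - ξ n i| ≤ δ → |U n' i' - U n i| ≤ δ → h * |(i' : ℝ) - i| ≤ δ →
        μ * h ^ 2 * |(n' : ℝ) - n| ≤ δ → |b n' i' - b n i| ≤ κ * δ ^ α) →
      |lap (U n₀) i₀| ≤ C * h ^ 2 ∧
      ∀ (ρ : ℝ) (n : ℕ) (i : ℤ), h ≤ ρ → ρ ≤ r / 32 → Cyl μ (ρ / h) n₀ i₀ n i →
        |U n i - U n₀ i₀| ≤ C * ρ ^ γ ∧
        |(U n (i + 1) - U n i) / h - (U n₀ (i₀ + 1) - U n₀ i₀) / h| ≤ C * ρ ^ γ ∧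
        |lap (U n) i - lap (U n₀) i₀| ≤ C * h ^ 2 * ρ ^ γ := by
  have hLam0 : 0 < Lam := by linarith
  obtain ⟨C₁, γ₁, hC₁, hγ₁0, hγ₁1, H₁⟩ := slope_holder hlam hlL hLam
  have hγ0 : 0 < γ₁ * α := by positivity
  have hγ1 : γ₁ * α < 1 := (mul_le_mul_of_nonneg_right hγ₁1 hα0.le).trans_lt (by linarith)
  obtain ⟨c, hc⟩ : ∃ c, c = 8 * C₁ * G + (2 + 4 * Lam) * G + 1 := ⟨_, rfl⟩
  have hc0 : 0 < c := by rw [hc]; positivity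
  obtain ⟨C₂, hC₂, H₂⟩ := interior_schauder (κ := κ * c ^ α) hlam hLam0.le hγ0 hγ1 (by positivity)
  obtain ⟨Q, hQ⟩ : ∃ Q : ℝ, Q = (4 / r) ^ (γ₁ * α) := ⟨_, rfl⟩
  have hQ0 : 0 < Q := by rw [hQ]; positivity
  obtain ⟨Q₁, hQ₁⟩ : ∃ Q : ℝ, Q = (1 / r) ^ γ₁ := ⟨_, rfl⟩
  have hQ₁0 : 0 < Q₁ := by rw [hQ₁]; positivity
  refine ⟨4 * C₂ * G / r + 4 * C₂ * G / r * Q + (2 + 4 * Lam) * G + C₁ * G * Q₁ + 1, γ₁ * α,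
    by positivity, hγ0, hγ1, ?_⟩
  intro μ h b U ξ n₀ i₀ hμ hμ1 hh hhr hreg hv hξ hb
  obtain ⟨u, hu⟩ : ∃ u : ℕ → ℤ → ℝ, u = fun n i => U n i / h := ⟨_, rfl⟩
  have hu' : ∀ n i, u n i = U n i / h := fun n i => by rw [hu]
  have hU : ∀ n i, U n i = h * u n i := fun n i => by rw [hu']; field_simp
  rw [← hu] at hreg
  obtain ⟨R, hR⟩ : ∃ R, R = r / h := ⟨_, rfl⟩
  rw [← hR] at hreg hv hξ hb
  have hRh : R * h = r := by rw [hR]; field_simp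
  have hR64 : 64 ≤ R := by rw [hR, le_div_iff₀ hh]; linarith
  have slope : ∀ n i, n ≤ n₀ → μ * ((n₀ : ℝ) - n) ≤ R ^ 2 → |u n (i + 1) - u n i| ≤ G := by
    intro n i h1 h2
    rw [hu', hu', ← sub_div, abs_div, abs_of_pos hh, div_le_iff₀ hh]
    exact hv n i h1 h2
  have slope' : ∀ n i, Cyl μ R n₀ i₀ n i → |u n (i + 1) - u n i| ≤ G := fun n i hc =>
    slope n i hc.1 hc.2.1
  have hξ' : ∀ n i, Cyl μ R n₀ i₀ n i → ∀ p q, p ≤ u n i - u n (i - 1) → p ≤ u n (i + 1) - u n i →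
      u n i - u n (i - 1) ≤ q → u n (i + 1) - u n i ≤ q → p ≤ ξ n i ∧ ξ n i ≤ q := by
    intro n i hc p q h1 h2 h3 h4
    have := hξ n i hc
    rw [sub_div, sub_div, ← hu', ← hu', ← hu', Set.mem_uIcc] at this
    rcases this with ⟨e1, e2⟩ | ⟨e1, e2⟩
    · exact ⟨h1.trans e1, e2.trans h4⟩
    · exact ⟨h2.trans e1, e2.trans h3⟩
  have hreg4 : Regular μ lam Lam b u (R / 4) n₀ i₀ := hreg.mono (by linarith) (by linarith)
  have hhol : HolderOn μ (κ * c ^ α) (γ₁ * α) b (R / 4) n₀ i₀ := by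
    intro ρ n i n' i' h1 h2 hz hz' hzz
    obtain ⟨y, hy⟩ : ∃ y, y = ρ / (R / 4) := ⟨_, rfl⟩
    have hy0 : 0 < y := by rw [hy]; positivity
    have hy1 : y ≤ 1 := by rw [hy, div_le_one (by linarith)]; exact h2
    have hyy : y ≤ y ^ γ₁ := by
      calc y = y ^ (1 : ℝ) := (Real.rpow_one y).symm
        _ ≤ y ^ γ₁ := Real.rpow_le_rpow_of_exponent_ge hy0 hy1 hγ₁1
    have hρh : ρ * h ≤ y := by
      have : ρ * h = y * (r / 4) := by rw [hy, ← hRh]; field_simp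
      rw [this]
      exact mul_le_of_le_one_right hy0.le (by linarith)
    have hregz : Regular μ lam Lam b u (R / 2) n i :=
      hreg.sub hz (by linarith) (by linarith) (by linarith)
    have hinc : ∀ n' i', Cyl μ (R / 2) n i n' i' → Cyl μ R n₀ i₀ n' i' := fun n' i' h =>
      hz.trans h (by linarith) (by linarith) (by linarith)
    have hvz : ∀ n' i', Cyl μ (R / 2) n i n' i' → |u n' (i' + 1) - u n' i'| ≤ G := fun n' i' h =>
      slope' n' i' (hinc n' i' h)
    obtain ⟨p, hp⟩ := H₁ μ (R / 2) G b u n i hμ hμ1 hG hregz hvz (ρ + 1) (by linarith) (by linarith)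
    have hosc : C₁ * G * ((ρ + 1) / (R / 2)) ^ γ₁ ≤ 8 * C₁ * G * y ^ γ₁ := by
      have e1 : ((ρ + 1) / (R / 2)) ^ γ₁ ≤ (8 * y) ^ γ₁ := by
        refine Real.rpow_le_rpow (by positivity) ?_ hγ₁0.le
        rw [hy, div_le_iff₀ (by linarith)]
        have : 8 * (ρ / (R / 4)) * (R / 2) = 16 * ρ := by field_simp; norm_num
        linarith
      have e2 : (8 * y) ^ γ₁ ≤ 8 * y ^ γ₁ := by
        rw [Real.mul_rpow (by norm_num) hy0.le]
        gcongr
        exact (Real.rpow_le_rpow_of_exponent_le (by norm_num) hγ₁1).trans (by norm_num)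
      have := mul_le_mul_of_nonneg_left (e1.trans e2) (by positivity : 0 ≤ C₁ * G)
      linarith
    have hξb : ∀ n' i', Cyl μ ρ n i n' i' → p ≤ ξ n' i' ∧ ξ n' i' ≤ p + 8 * C₁ * G * y ^ γ₁ := by
      intro n' i' hc'
      have k1 := hp n' i' (hc'.mono (by linarith) (by linarith))
      have k2 := hp n' (i' - 1) (hc'.trans (r' := 1) ⟨le_rfl, by simp, by simp⟩ (by linarith)
        (by norm_num) le_rfl)
      rw [sub_add_cancel] at k2
      exact hξ' n' i' (hinc n' i' (hc'.mono (by linarith) (by linarith))) _ _ k2.1 k1.1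
        (by linarith) (by linarith)
    have hρ0 : 0 ≤ ρ := by linarith
    have x1 := hξb n i (Cyl.self hρ0)
    have x2 := hξb n' i' hzz
    have x3 : |u n' i' - u n i| ≤ (2 + 4 * Lam) * G * ρ :=
      variation_le hμ hlam.le hLam0.le hG h1 (hregz.mono hρ0 (by linarith))
        (fun n'' i'' h'' => hvz n'' i'' (h''.mono hρ0 (by linarith))) hzz
    have hyγ : 0 ≤ y ^ γ₁ := by positivity
    have P1 : 0 ≤ C₁ * G * y ^ γ₁ := by positivity
    have P2 : 0 ≤ (2 + 4 * Lam) * G * y ^ γ₁ := by positivity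
    have hcy : c * y ^ γ₁ = 8 * (C₁ * G * y ^ γ₁) + (2 + 4 * Lam) * G * y ^ γ₁ + y ^ γ₁ := by
      rw [hc]; ring
    have hsq : (ρ * h) ^ 2 ≤ y := by
      have : (ρ * h) ^ 2 ≤ y ^ 2 := by gcongr
      have : y ^ 2 ≤ y := by rw [pow_two]; exact mul_le_of_le_one_right hy0.le hy1
      linarith
    have := hb n i n' i' (c * y ^ γ₁) (hz.mono (by linarith) (by linarith))
      (hz'.mono (by linarith) (by linarith)) (by rw [abs_le]; constructor <;> linarith)
      (by
        rw [hU, hU, ← mul_sub, abs_mul, abs_of_pos hh]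
        have e1 := mul_le_mul_of_nonneg_left x3 hh.le
        have e2 := mul_le_mul_of_nonneg_left (hρh.trans hyy) (by positivity : 0 ≤ (2 + 4 * Lam) * G)
        linarith)
      (by
        have := mul_le_mul_of_nonneg_left hzz.2.2 hh.le
        linarith)
      (by
        have e0 : (n' : ℝ) ≤ n := by exact_mod_cast hzz.1
        rw [abs_sub_comm, abs_of_nonneg (sub_nonneg.2 e0)]
        have := mul_le_mul_of_nonneg_left hzz.2.1 (sq_nonneg h)
        linarith)
    refine this.trans (le_of_eq ?_)
    rw [Real.mul_rpow hc0.le hyγ, ← Real.rpow_mul hy0.le, ← hy, mul_assoc]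
  have hlap : ∀ n i, lap (U n) i = h * lap (u n) i := fun n i => by
    simp only [lap, hU]; ring
  obtain ⟨W₁, W₂⟩ := H₂ μ (R / 4) G b u n₀ i₀ hμ hμ1 (by linarith) hG hreg4 hhol
    (fun n i hc => slope' n i (hc.mono (by linarith) (by linarith)))
    (fun n i hc => by
      have hc := hc.mono (by linarith) (by linarith : R / 4 ≤ R)
      have k1 := abs_le.1 (slope n i hc.1 hc.2.1)
      have k2 := abs_le.1 (slope n (i - 1) hc.1 hc.2.1)
      rw [sub_add_cancel] at k2
      rw [lap, abs_le]
      constructor <;> linarith)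
  have hGR : C₂ * G / (R / 4) = 4 * C₂ * G / r * h := by rw [← hRh]; field_simp
  rw [hGR] at W₁ W₂
  have T1 : 0 ≤ 4 * C₂ * G / r := by positivity
  have T2 : 0 ≤ 4 * C₂ * G / r * Q := by positivity
  have T3 : 0 ≤ (2 + 4 * Lam) * G := by positivity
  have T4 : 0 ≤ C₁ * G * Q₁ := by positivity
  constructor
  · have e1 := W₁ n₀ i₀ (Cyl.self (by linarith))
    rw [hlap, abs_mul, abs_of_pos hh]
    have e2 := mul_le_mul_of_nonneg_left e1 hh.le
    have e3 : 0 ≤ (4 * C₂ * G / r * Q + (2 + 4 * Lam) * G + C₁ * G * Q₁ + 1) * h ^ 2 := by positivity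
    linarith
  intro ρ n i hρh hρr hcz
  obtain ⟨σ, hσ⟩ : ∃ σ, σ = ρ / h := ⟨_, rfl⟩
  have hσh : ρ = σ * h := by rw [hσ]; field_simp
  have hσ1 : 1 ≤ σ := by rw [hσ, le_div_iff₀ hh]; linarith
  have hσR : σ ≤ R / 32 := by rw [hσ, div_le_iff₀ hh]; linarith
  rw [← hσ] at hcz
  have hρ0 : 0 < ρ := by linarith
  have hρ1 : ρ ≤ 1 := by linarith
  obtain ⟨z, hz⟩ : ∃ z, z = ρ ^ (γ₁ * α) := ⟨_, rfl⟩
  have hz0 : 0 ≤ z := by rw [hz]; positivity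
  have hρz : ρ ≤ z := by
    rw [hz]
    calc ρ = ρ ^ (1 : ℝ) := (Real.rpow_one ρ).symm
      _ ≤ _ := Real.rpow_le_rpow_of_exponent_ge hρ0 hρ1 hγ1.le
  have hρz1 : ρ ^ γ₁ ≤ z := by
    rw [hz]
    exact Real.rpow_le_rpow_of_exponent_ge hρ0 hρ1 (mul_le_of_le_one_right hγ₁0.le hα1.le)
  rw [← hz]
  have Z1 := mul_nonneg T1 hz0
  have Z2 := mul_nonneg T2 hz0
  have Z3 := mul_nonneg T3 hz0
  have Z4 := mul_nonneg T4 hz0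
  have hcR := hcz.mono (by linarith) (by linarith : σ ≤ R)
  refine ⟨?_, ?_, ?_⟩
  · have e1 := variation_le hμ hlam.le hLam0.le hG hσ1 (hreg.mono (by linarith) (by linarith))
      (fun n'' i'' h'' => slope' n'' i'' (h''.mono (by linarith) (by linarith))) hcz
    rw [hU, hU, ← mul_sub, abs_mul, abs_of_pos hh]
    have e2 := mul_le_mul_of_nonneg_left e1 hh.le
    have e3 := mul_le_mul_of_nonneg_left hρz T3
    rw [hσh] at e3
    linarith
  · obtain ⟨p, hp⟩ := H₁ μ R G b u n₀ i₀ hμ hμ1 hG hreg slope' σ hσ1 (by linarith)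
    have k1 := hp n i hcz
    have k2 := hp n₀ i₀ (Cyl.self (by linarith))
    rw [sub_div, sub_div, ← hu', ← hu', ← hu', ← hu']
    have e1 : (σ / R) ^ γ₁ = Q₁ * ρ ^ γ₁ := by
      rw [hQ₁, ← Real.mul_rpow (by positivity) hρ0.le, hσh, ← hRh]
      congr 1
      field_simp
    rw [e1] at k1 k2
    have e2 := mul_le_mul_of_nonneg_left hρz1 T4
    rw [abs_le]
    constructor <;> linarith
  · have e1 := W₂ σ n₀ i₀ n i hσ1 (by linarith) (Cyl.self (by linarith)) hcz
    have e2 : (σ / (R / 4)) ^ (γ₁ * α) = Q * z := by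
      rw [hQ, hz, ← Real.mul_rpow (by positivity) hρ0.le, hσh, ← hRh]
      congr 1
      field_simp
    rw [e2] at e1
    rw [hlap, hlap, ← mul_sub, abs_mul, abs_of_pos hh]
    have e3 := mul_le_mul_of_nonneg_left e1 hh.le
    have e4 : 0 ≤ h ^ 2 * (4 * C₂ * G / r * z + (2 + 4 * Lam) * G * z + C₁ * G * Q₁ * z + z) := by
      positivity
    linarith

end DiscreteParabolic

namespace DiscreteParabolic

open MeasureTheory intervalIntegral

lemma integral_le_of_le_add {f : ℝ → ℝ} {N p q e : ℝ} (hf : Continuous f) (h0 : ∀ s, 0 ≤ f s)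
    (hN : ∀ s, f s ≤ N) (he : 0 ≤ e) (h : p ≤ q + e) : ∫ s in q..p, f s ≤ N * e := by
  have hN0 : 0 ≤ N := (h0 0).trans (hN 0)
  rcases le_total q p with hqp | hpq
  · have h1 : ∫ s in q..p, f s ≤ ∫ _ in q..p, N :=
      integral_mono_on hqp (hf.intervalIntegrable _ _) (by simp) fun s _ => hN s
    rw [intervalIntegral.integral_const, smul_eq_mul, mul_comm] at h1
    exact h1.trans (mul_le_mul_of_nonneg_left (by linarith) hN0)
  · rw [integral_symm]
    have : 0 ≤ ∫ s in p..q, f s := integral_nonneg hpq fun s _ => h0 s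
    have := mul_nonneg hN0 he
    linarith

/-- Almost monotonicity of the flux difference in its end points. -/
lemma flux_le {f : ℝ → ℝ} {N p q p' q' e : ℝ} (hf : Continuous f) (h0 : ∀ s, 0 ≤ f s)
    (hN : ∀ s, f s ≤ N) (he : 0 ≤ e) (hp : p ≤ p' + e) (hq : q' ≤ q + e) :
    ∫ s in q..p, f s ≤ (∫ s in q'..p', f s) + 2 * (N * e) := by
  have h1 := integral_le_of_le_add hf h0 hN he hp
  have h2 := integral_le_of_le_add hf h0 hN he hq
  have i1 := fun a b => hf.intervalIntegrable (μ := volume) a b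
  rw [← integral_add_adjacent_intervals (i1 q q') (i1 q' p),
    ← integral_add_adjacent_intervals (i1 q' p') (i1 p' p)]
  linarith

/-- The explicit scheme in flux form, with frozen coefficient functions `f n i`. -/
structure Scheme (μ h N : ℝ) (f : ℕ → ℤ → ℝ → ℝ) (U : ℕ → ℤ → ℝ) : Prop where
  mu_pos : 0 < μ
  h_pos : 0 < h
  stable : μ * N ≤ 1 / 8
  cont : ∀ n i, Continuous (f n i)
  nonneg : ∀ n i s, 0 ≤ f n i s
  le : ∀ n i s, f n i s ≤ N
  step : ∀ n i, U (n + 1) i = U n i +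
    μ * h * ∫ s in ((U n i - U n (i - 1)) / h)..((U n (i + 1) - U n i) / h), f n i s

namespace Scheme

variable {μ h N : ℝ} {f : ℕ → ℤ → ℝ → ℝ} {U : ℕ → ℤ → ℝ}

lemma neg (hs : Scheme μ h N f U) :
    Scheme μ h N (fun n i s => f n i (-s)) (fun n i => - U n i) := by
  refine ⟨hs.mu_pos, hs.h_pos, hs.stable, fun n i => (hs.cont n i).comp continuous_neg,
    fun n i s => hs.nonneg n i _, fun n i s => hs.le n i _, fun n i => ?_⟩
  rw [hs.step, intervalIntegral.integral_comp_neg, integral_symm]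
  rw [show -((-U n i - -U n (i - 1)) / h) = (U n i - U n (i - 1)) / h by ring,
    show -((-U n (i + 1) - -U n i) / h) = (U n (i + 1) - U n i) / h by ring]
  ring

/-- The scheme in nondivergence form. -/
lemma exists_slope (hs : Scheme μ h N f U) (n : ℕ) (i : ℤ) :
    ∃ ξ ∈ Set.uIcc ((U n i - U n (i - 1)) / h) ((U n (i + 1) - U n i) / h),
      U (n + 1) i = U n i + μ * f n i ξ * lap (U n) i := by
  have hh := hs.h_pos
  obtain ⟨p, hp⟩ : ∃ p, p = (U n i - U n (i - 1)) / h := ⟨_, rfl⟩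
  obtain ⟨q, hq⟩ : ∃ q, q = (U n (i + 1) - U n i) / h := ⟨_, rfl⟩
  have hlap : lap (U n) i = h * (q - p) := by rw [lap, hp, hq]; field_simp; ring
  rw [hs.step, hlap, ← hp, ← hq]
  by_cases hpq : p = q
  · exact ⟨p, Set.left_mem_uIcc, by simp [hpq]⟩
  · obtain ⟨c, hc, e⟩ := exists_eq_interval_average hpq (hs.cont n i).continuousOn
    refine ⟨c, Set.uIoo_subset_uIcc_self hc, ?_⟩
    rw [e, interval_average_eq_div]
    have : q - p ≠ 0 := sub_ne_zero.2 (Ne.symm hpq)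
    field_simp

lemma coeff_bounds (hs : Scheme μ h N f U) (n : ℕ) (i : ℤ) (s : ℝ) :
    0 ≤ μ * f n i s ∧ μ * f n i s ≤ 1 / 8 :=
  ⟨mul_nonneg hs.mu_pos.le (hs.nonneg n i s),
    (mul_le_mul_of_nonneg_left (hs.le n i s) hs.mu_pos.le).trans hs.stable⟩

lemma le_of_init (hs : Scheme μ h N f U) {M : ℝ} (h0 : ∀ i, U 0 i ≤ M) (n : ℕ) (i : ℤ) :
    U n i ≤ M := by
  induction n generalizing i with
  | zero => exact h0 i
  | succ n ih =>
    obtain ⟨ξ, -, e⟩ := hs.exists_slope n i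
    have hb := hs.coeff_bounds n i ξ
    rw [e, lap]
    have := scheme_le hb.1 (by linarith) (ih i) (ih (i + 1)) (ih (i - 1))
    linarith

lemma abs_le_of_init (hs : Scheme μ h N f U) {M : ℝ} (h0 : ∀ i, |U 0 i| ≤ M) (n : ℕ) (i : ℤ) :
    |U n i| ≤ M :=
  abs_le'.2 ⟨hs.le_of_init (fun i => (le_abs_self _).trans (h0 i)) n i,
    hs.neg.le_of_init (fun i => (neg_le_abs _).trans (h0 i)) n i⟩

lemma monotone (hs : Scheme μ h N f U) (h0 : ∀ i, U 0 i ≤ U 0 (i + 1)) (n : ℕ) (i : ℤ) :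
    U n i ≤ U n (i + 1) := by
  induction n generalizing i with
  | zero => exact h0 i
  | succ n ih =>
    obtain ⟨ξ, -, e⟩ := hs.exists_slope n i
    obtain ⟨ξ', -, e'⟩ := hs.exists_slope n (i + 1)
    have hb := hs.coeff_bounds n i ξ
    have hb' := hs.coeff_bounds n (i + 1) ξ'
    rw [e, e', lap, lap, add_sub_cancel_right]
    have i0 := ih i
    have i1 := mul_nonneg hb'.1 (sub_nonneg.2 (ih (i + 1)))
    have i2 := ih (i - 1)
    rw [sub_add_cancel] at i2
    have i2 := mul_nonneg hb.1 (sub_nonneg.2 i2)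
    have i3 := mul_nonneg (by linarith : 0 ≤ 1 - (μ * f n i ξ + μ * f n (i + 1) ξ')) (sub_nonneg.2 i0)
    linarith

/-- One step of the comparison of the increments with a concave function of the distance. -/
lemma increment_step (hs : Scheme μ h N f U) {n : ℕ} {Φ : ℤ → ℝ}
    (hΦ : ∀ i j, i ≤ j → U n j - U n i ≤ Φ (j - i)) {i j : ℤ} (hij : i < j)
    (hconc : Φ (j - i + 1) - Φ (j - i) ≤ Φ (j - i) - Φ (j - i - 1)) :
    U (n + 1) j - U (n + 1) i ≤ Φ (j - i) -
      μ * h * ∫ s in ((Φ (j - i + 1) - Φ (j - i)) / h)..((Φ (j - i) - Φ (j - i - 1)) / h), f n j s := by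
  have hh := hs.h_pos
  have hμ := hs.mu_pos
  have k0 := hΦ i j hij.le
  have k1 := hΦ i (j + 1) (by omega)
  have k2 := hΦ i (j - 1) (by omega)
  have k3 := hΦ (i + 1) j (by omega)
  have k4 := hΦ (i - 1) j (by omega)
  rw [show j + 1 - i = j - i + 1 by ring] at k1
  rw [show j - 1 - i = j - i - 1 by ring] at k2
  rw [show j - (i + 1) = j - i - 1 by ring] at k3
  rw [show j - (i - 1) = j - i + 1 by ring] at k4
  obtain ⟨p, hp⟩ : ∃ p, p = Φ (j - i + 1) - Φ (j - i) := ⟨_, rfl⟩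
  obtain ⟨q, hq⟩ : ∃ q, q = Φ (j - i) - Φ (j - i - 1) := ⟨_, rfl⟩
  obtain ⟨δ, hδ⟩ : ∃ δ, δ = Φ (j - i) - (U n j - U n i) := ⟨_, rfl⟩
  have hδ0 : 0 ≤ δ / h := div_nonneg (by linarith) hh.le
  rw [hs.step, hs.step, ← hp, ← hq]
  rw [← hp, ← hq] at hconc
  have J := flux_le (p' := p / h) (q' := q / h) (hs.cont n j) (hs.nonneg n j) (hs.le n j) hδ0
    (p := (U n (j + 1) - U n j) / h) (q := (U n j - U n (j - 1)) / h)
    (by rw [← add_div]; gcongr; linarith) (by rw [← add_div]; gcongr; linarith)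
  have I := flux_le (p' := p / h) (q' := q / h) (hs.cont n i) (hs.nonneg n i) (hs.le n i) hδ0
    (p := (U n i - U n (i - 1)) / h) (q := (U n (i + 1) - U n i) / h)
    (by rw [← add_div]; gcongr; linarith) (by rw [← add_div]; gcongr; linarith)
  rw [integral_symm, integral_symm (p / h)] at I
  rw [integral_symm (p / h)] at J
  have I0 : 0 ≤ ∫ s in (p / h)..(q / h), f n i s :=
    integral_nonneg (by gcongr) fun s _ => hs.nonneg n i s
  have mh : 0 ≤ μ * h := by positivity
  have J' := mul_le_mul_of_nonneg_left J mh
  have I' := mul_le_mul_of_nonneg_left I mh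
  have I0' := mul_nonneg mh I0
  have e1 : μ * h * (N * (δ / h)) = μ * N * δ := by field_simp
  have e2 := mul_le_mul_of_nonneg_right hs.stable (by linarith : 0 ≤ δ)
  have e3 : 0 ≤ δ := by linarith
  linarith

/-- A quadratic lower barrier. -/
lemma barrier (hs : Scheme μ h N f U) {M K L x r B : ℝ} (hM : ∀ n i, -M ≤ U n i) (hK : 0 ≤ K)
    (hr : 0 ≤ r) (hKr : 2 * M ≤ K * r ^ 2) (hL : L = 2 * K * B) (hB : 0 ≤ B)
    (hf : ∀ (n : ℕ) (i : ℤ) (s : ℝ), |i * h - x| ≤ r → |s| ≤ 2 * K * (r + h) → f n i s ≤ B)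
    (h0 : ∀ i : ℤ, |i * h - x| < r → M ≤ U 0 i) (n : ℕ) (i : ℤ) :
    M - K * (i * h - x) ^ 2 - L * (n * (μ * h ^ 2)) ≤ U n i := by
  have hh := hs.h_pos
  have hμ := hs.mu_pos
  have hL0 : 0 ≤ L := by rw [hL]; positivity
  have far : ∀ (n : ℕ) (i : ℤ), r ≤ |i * h - x| →
      M - K * (i * h - x) ^ 2 - L * (n * (μ * h ^ 2)) ≤ U n i := by
    intro n i hi
    have e1 : r ^ 2 ≤ (i * h - x) ^ 2 := by rw [← sq_abs (i * h - x)]; gcongr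
    have e2 := mul_le_mul_of_nonneg_left e1 hK
    have e3 : 0 ≤ L * (n * (μ * h ^ 2)) := by positivity
    linarith [hM n i]
  induction n generalizing i with
  | zero =>
    rcases lt_or_ge (|i * h - x|) r with hi | hi
    · have e2 : 0 ≤ K * (i * h - x) ^ 2 := by positivity
      simp only [Nat.cast_zero, zero_mul, mul_zero]
      linarith [h0 i hi]
    · exact far 0 i hi
  | succ n ih =>
    rcases le_or_gt r (|i * h - x|) with hi | hi
    · exact far _ i hi
    obtain ⟨y, hy⟩ : ∃ y, y = i * h - x := ⟨_, rfl⟩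
    obtain ⟨c, hc⟩ : ∃ c, c = M - L * (n * (μ * h ^ 2)) := ⟨_, rfl⟩
    have k0 := ih i
    have k1 := ih (i + 1)
    have k2 := ih (i - 1)
    push_cast at k1 k2 ⊢
    rw [show ((i : ℝ) + 1) * h - x = y + h by rw [hy]; ring] at k1
    rw [show ((i : ℝ) - 1) * h - x = y - h by rw [hy]; ring] at k2
    rw [← hy] at k0 hi ⊢
    obtain ⟨δ, hδ⟩ : ∃ δ, δ = U n i - (c - K * y ^ 2) := ⟨_, rfl⟩
    have hδ' : 0 ≤ δ := by linarith
    have hδ0 : 0 ≤ δ / h := by positivity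
    have I := flux_le (p' := K * (h - 2 * y)) (q' := -(K * (2 * y + h))) (hs.cont n i) (hs.nonneg n i)
      (hs.le n i) hδ0 (p := (U n i - U n (i - 1)) / h) (q := (U n (i + 1) - U n i) / h)
      (by
        rw [div_le_iff₀ hh, add_mul, div_mul_cancel₀ _ hh.ne']
        linarith)
      (by
        rw [← sub_le_iff_le_add, le_div_iff₀ hh, sub_mul, div_mul_cancel₀ _ hh.ne']
        linarith)
    have hy' := abs_lt.1 hi
    have hle : -(K * (2 * y + h)) ≤ K * (h - 2 * y) := by
      have := mul_nonneg hK hh.le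
      linarith
    have I1 : ∫ s in (-(K * (2 * y + h)))..(K * (h - 2 * y)), f n i s ≤
        ∫ _ in (-(K * (2 * y + h)))..(K * (h - 2 * y)), B := by
      refine integral_mono_on hle ((hs.cont n i).intervalIntegrable _ _) (by simp) fun s hs' => ?_
      refine hf n i s (by rw [← hy]; exact hi.le) (abs_le.2 ⟨?_, ?_⟩)
      · have := mul_nonneg hK (by linarith : 0 ≤ 2 * (r + h) - (2 * y + h))
        linarith [hs'.1]
      · have := mul_nonneg hK (by linarith : 0 ≤ 2 * (r + h) - (h - 2 * y))
        linarith [hs'.2]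
    rw [intervalIntegral.integral_const, smul_eq_mul] at I1
    rw [integral_symm] at I
    have mh : 0 ≤ μ * h := by positivity
    have I' := mul_le_mul_of_nonneg_left I mh
    have e1 : μ * h * (N * (δ / h)) = μ * N * δ := by field_simp
    have e2 := mul_le_mul_of_nonneg_right hs.stable hδ'
    have I1' := mul_le_mul_of_nonneg_left I1 mh
    rw [hs.step]
    rw [hL] at hc ⊢
    linarith

end Scheme

/-- The modulus of continuity propagated by the scheme. -/
noncomputable def modulus (k β t x : ℝ) : ℝ := t / k * Real.log (1 + x * Real.exp (β / t))

lemma modulus_zero (k β t : ℝ) : modulus k β t 0 = 0 := by simp [modulus]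

lemma modulus_time {k β t τ x : ℝ} (hk : 0 < k) (hβ : 0 ≤ β) (ht : 0 < t) (hτ : 0 ≤ τ)
    (hx : 0 ≤ x) : modulus k β t x - β / k * (τ / t) ≤ modulus k β (t + τ) x := by
  obtain ⟨E, hE⟩ : ∃ E, E = Real.exp (β / t) := ⟨_, rfl⟩
  obtain ⟨E', hE'⟩ : ∃ E', E' = Real.exp (β / (t + τ)) := ⟨_, rfl⟩
  obtain ⟨s, hs⟩ : ∃ s, s = β * τ / (t * (t + τ)) := ⟨_, rfl⟩
  have hE0 : 0 < E := by rw [hE]; positivity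
  have hE0' : 0 < E' := by rw [hE']; positivity
  have hs0 : 0 ≤ s := by rw [hs]; positivity
  have h1 : E = Real.exp s * E' := by
    rw [hE, hE', ← Real.exp_add, hs]
    congr 1
    field_simp
    ring
  have h2 : 1 + x * E ≤ Real.exp s * (1 + x * E') := by
    have : 1 ≤ Real.exp s := Real.one_le_exp hs0
    rw [h1]
    linarith
  have h3 : Real.log (1 + x * E) ≤ s + Real.log (1 + x * E') := by
    have := Real.log_le_log (by positivity) h2
    rwa [Real.log_mul (by positivity) (by positivity), Real.log_exp] at this
  have h4 := mul_le_mul_of_nonneg_left h3 (by positivity : 0 ≤ (t + τ) / k)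
  have h5 : 0 ≤ τ / k * Real.log (1 + x * E) :=
    mul_nonneg (by positivity) (Real.log_nonneg (by linarith [mul_nonneg hx hE0.le]))
  have h6 : (t + τ) / k * s = β / k * (τ / t) := by rw [hs]; field_simp
  have h7 : (t + τ) / k * Real.log (1 + x * E) = t / k * Real.log (1 + x * E) +
    τ / k * Real.log (1 + x * E) := by ring
  rw [modulus, modulus, ← hE, ← hE']
  linarith

lemma modulus_increments {k β t x h : ℝ} (hh : 0 < h) (hx : h ≤ x) :
    ∃ y : ℝ, y = h / (Real.exp (-(β / t)) + x) ∧ 0 < y ∧ y < 1 ∧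
      modulus k β t (x + h) - modulus k β t x = t / k * Real.log (1 + y) ∧
      modulus k β t x - modulus k β t (x - h) = t / k * -Real.log (1 - y) := by
  obtain ⟨E, hE⟩ : ∃ E, E = Real.exp (β / t) := ⟨_, rfl⟩
  have hE0 : 0 < E := by rw [hE]; positivity
  have hEi : Real.exp (-(β / t)) = E⁻¹ := by rw [Real.exp_neg, hE]
  have hx0 : 0 < x := by linarith
  have hd : 0 < E⁻¹ + x := by positivity
  refine ⟨_, rfl, by positivity, ?_, ?_, ?_⟩
  · rw [hEi, div_lt_one hd]
    have : 0 < E⁻¹ := by positivity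
    linarith
  · rw [modulus, modulus, ← mul_sub, ← hE, ← Real.log_div (by positivity) (by positivity), hEi]
    congr 2
    field_simp
    ring
  · have h1 : 0 ≤ (x - h) * E := mul_nonneg (by linarith) hE0.le
    rw [modulus, modulus, ← mul_sub, ← hE, ← Real.log_div (by positivity) (by linarith), hEi,
      ← Real.log_inv]
    congr 2
    have h2 : 1 + (x - h) * E ≠ 0 := by linarith
    have h3 : 1 - h / (E⁻¹ + x) = (1 + (x - h) * E) / (1 + x * E) := by
      field_simp
      ring
    rw [h3, inv_div]

lemma half_le_inv_log_sub {y : ℝ} (h0 : 0 < y) (h1 : y < 1) :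
    1 / 2 ≤ 1 / Real.log (1 + y) - 1 / (-Real.log (1 - y)) := by
  have a1 : 0 < Real.log (1 + y) := Real.log_pos (by linarith)
  have a2 : Real.log (1 + y) ≤ y := by
    have := Real.log_le_sub_one_of_pos (by linarith : 0 < 1 + y)
    linarith
  have a3 : 1 / y ≤ 1 / Real.log (1 + y) := one_div_le_one_div_of_le a1 a2
  have b1 : 2 * (y / (1 - y)) / (y / (1 - y) + 2) ≤ -Real.log (1 - y) := by
    have hy1 : 0 < 1 - y := by linarith
    have := Real.le_log_one_add_of_nonneg (by positivity : 0 ≤ y / (1 - y))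
    rw [show 1 + y / (1 - y) = (1 - y)⁻¹ by field_simp; ring, Real.log_inv] at this
    exact this
  have b2 : 2 * (y / (1 - y)) / (y / (1 - y) + 2) = 2 * y / (2 - y) := by
    have hy1 : 1 - y ≠ 0 := by linarith
    have hy2 : 2 - y ≠ 0 := by linarith
    have hy3 : y / (1 - y) + 2 = (2 - y) / (1 - y) := by field_simp; ring
    rw [hy3]
    field_simp
  rw [b2] at b1
  have hy2 : 0 < 2 - y := by linarith
  have b3 : 1 / (-Real.log (1 - y)) ≤ 1 / (2 * y / (2 - y)) :=
    one_div_le_one_div_of_le (by positivity) b1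
  have b4 : 1 / (2 * y / (2 - y)) = 1 / y - 1 / 2 := by field_simp
  linarith

lemma inv_sub_inv_le_integral {f : ℝ → ℝ} {A P p q : ℝ} (hf : Continuous f) (hP : 0 < P)
    (hA : ∀ s, P ≤ |s| → A ≤ f s * s ^ 2) (hPp : P ≤ p) (hpq : p ≤ q) :
    A * (1 / p - 1 / q) ≤ ∫ s in p..q, f s := by
  have pos : ∀ s ∈ Set.Icc p q, 0 < s := fun s hs => by linarith [hs.1]
  have hcont : ContinuousOn (fun s : ℝ => A / s ^ 2) (Set.uIcc p q) := by
    rw [Set.uIcc_of_le hpq]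
    exact continuousOn_const.div (by fun_prop) fun s hs => (pow_pos (pos s hs) 2).ne'
  have h1 : ∫ s in p..q, A / s ^ 2 = -A / q - -A / p := by
    refine integral_eq_sub_of_hasDerivAt (f := fun s => -A / s) (fun s hs => ?_)
      hcont.intervalIntegrable
    rw [Set.uIcc_of_le hpq] at hs
    have := (hasDerivAt_inv (pos s hs).ne').const_mul (-A)
    have e : -A * -(s ^ 2)⁻¹ = A / s ^ 2 := by ring
    rw [e] at this
    simpa only [div_eq_mul_inv] using this
  have h2 : ∫ s in p..q, A / s ^ 2 ≤ ∫ s in p..q, f s := by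
    refine integral_mono_on hpq hcont.intervalIntegrable (hf.intervalIntegrable _ _) fun s hs => ?_
    have hs0 := pos s hs
    rw [div_le_iff₀ (by positivity)]
    exact hA s (by rw [abs_of_pos hs0]; linarith [hs.1])
  have h3 : -A / q - -A / p = A * (1 / p - 1 / q) := by ring
  linarith

/-- The flux decreases the modulus fast enough, as long as it is not too large. -/
lemma modulus_flux {f : ℝ → ℝ} {A P M k t x h : ℝ} (hA : 0 < A) (hP : 0 < P) (hM : 0 < M)
    (hk : k = 8 * M / A) (hf : Continuous f) (hfA : ∀ s, P ≤ |s| → A ≤ f s * s ^ 2)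
    (ht : 0 < t) (htT : t ≤ (M * k) ^ 2 / (4 * k * P)) (hh : 0 < h) (hx : h ≤ x)
    (hφ : modulus k (4 * M * k) t x ≤ 3 * M) :
    modulus k (4 * M * k) t (x + h) - modulus k (4 * M * k) t x ≤
      modulus k (4 * M * k) t x - modulus k (4 * M * k) t (x - h) ∧
    4 * M * h / t ≤ ∫ s in ((modulus k (4 * M * k) t (x + h) - modulus k (4 * M * k) t x) / h)..
      ((modulus k (4 * M * k) t x - modulus k (4 * M * k) t (x - h)) / h), f s := by
  have hk0 : 0 < k := by rw [hk]; positivity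
  obtain ⟨y, hy, hy0, hy1, e1, e2⟩ := modulus_increments (k := k) (β := 4 * M * k) (t := t) hh hx
  obtain ⟨w, hw⟩ : ∃ w, w = Real.exp (-(4 * M * k / t)) + x := ⟨_, rfl⟩
  rw [← hw] at hy
  have hx0 : 0 < x := by linarith
  have hw0 : 0 < w := by rw [hw]; positivity
  have hwle : w ≤ Real.exp (-(M * k / t)) := by
    have a1 : Real.log (1 + x * Real.exp (4 * M * k / t)) ≤ 3 * M * k / t := by
      rw [le_div_iff₀ ht]
      have := mul_le_mul_of_nonneg_right hφ hk0.le
      rw [modulus] at this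
      have e : t / k * Real.log (1 + x * Real.exp (4 * M * k / t)) * k =
        Real.log (1 + x * Real.exp (4 * M * k / t)) * t := by field_simp
      linarith
    have a2 := (Real.log_le_iff_le_exp (by positivity)).1 a1
    have a3 := mul_le_mul_of_nonneg_left a2 (Real.exp_pos (-(4 * M * k / t))).le
    rw [← Real.exp_add] at a3
    have a4 : Real.exp (-(4 * M * k / t)) * (1 + x * Real.exp (4 * M * k / t)) = w := by
      rw [hw, Real.exp_neg]
      field_simp
    rw [a4] at a3
    refine a3.trans (le_of_eq ?_)
    congr 1
    ring
  have hlog1 : y / 2 ≤ Real.log (1 + y) := by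
    refine le_trans ?_ (Real.le_log_one_add_of_nonneg hy0.le)
    rw [le_div_iff₀ (by linarith)]
    have := mul_nonneg hy0.le (by linarith : 0 ≤ 2 - y)
    linarith
  have hpP : P ≤ t / k * Real.log (1 + y) / h := by
    have b1 : t / k * (y / 2) / h ≤ t / k * Real.log (1 + y) / h := by gcongr
    have b2 : t / k * (y / 2) / h = t / (2 * k) * w⁻¹ := by rw [hy]; field_simp
    have b3 : Real.exp (M * k / t) ≤ w⁻¹ := by
      rw [Real.exp_neg] at hwle
      exact (le_inv_comm₀ hw0 (by positivity)).1 hwle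
    have b4 : (M * k / t) ^ 2 / 2 ≤ Real.exp (M * k / t) := by
      have := Real.quadratic_le_exp_of_nonneg (by positivity : 0 ≤ M * k / t)
      have : 0 ≤ M * k / t := by positivity
      linarith
    have b5 := mul_le_mul_of_nonneg_left (b4.trans b3) (by positivity : 0 ≤ t / (2 * k))
    have b6 : P ≤ t / (2 * k) * ((M * k / t) ^ 2 / 2) := by
      have : t / (2 * k) * ((M * k / t) ^ 2 / 2) = (M * k) ^ 2 / (4 * k) / t := by
        field_simp; ring
      rw [this, le_div_iff₀ ht]
      rw [le_div_iff₀ (by positivity)] at htT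
      rw [le_div_iff₀ (by positivity)]
      linarith
    linarith
  have hL0 : 0 < Real.log (1 + y) := by linarith
  have hdiff := half_le_inv_log_sub hy0 hy1
  have hL1 : 0 < -Real.log (1 - y) := by
    have := Real.log_neg (by linarith : 0 < 1 - y) (by linarith)
    linarith
  have hLL : Real.log (1 + y) ≤ -Real.log (1 - y) := by
    have : 1 / (-Real.log (1 - y)) ≤ 1 / Real.log (1 + y) := by linarith
    exact (one_div_le_one_div hL1 hL0).1 this
  have htk : 0 < t / k := by positivity
  have hconc := mul_le_mul_of_nonneg_left hLL htk.le
  rw [e1, e2]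
  refine ⟨hconc, le_trans ?_ (inv_sub_inv_le_integral hf hP hfA hpP (by gcongr))⟩
  have c1 : A * (1 / (t / k * Real.log (1 + y) / h) - 1 / (t / k * -Real.log (1 - y) / h)) =
      A * k * h / t * (1 / Real.log (1 + y) - 1 / (-Real.log (1 - y))) := by
    generalize -Real.log (1 - y) = b at *
    field_simp
  rw [c1]
  have c2 := mul_le_mul_of_nonneg_left hdiff (by positivity : 0 ≤ A * k * h / t)
  have c3 : A * k * h / t * (1 / 2) = 4 * M * h / t := by rw [hk]; field_simp; norm_num
  linarith

lemma modulus_initial {M k t x h : ℝ} (hM : 0 < M) (hk : 0 < k) (ht : 0 < t) (hth : t ≤ h ^ 2)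
    (hh : 0 < h) (hhk : h ≤ 2 * M * k) (hx : h ≤ x) : 2 * M ≤ modulus k (4 * M * k) t x := by
  have hE := Real.exp_pos (4 * M * k / t)
  have h1 : h * Real.exp (4 * M * k / t) ≤ 1 + x * Real.exp (4 * M * k / t) := by
    have := mul_le_mul_of_nonneg_right hx hE.le
    linarith
  have h2 := Real.log_le_log (by positivity) h1
  rw [Real.log_mul hh.ne' hE.ne', Real.log_exp] at h2
  have h3 : -(1 / h) ≤ Real.log h := by
    have := Real.log_le_sub_one_of_pos (by positivity : 0 < h⁻¹)
    rw [Real.log_inv] at this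
    rw [one_div]
    linarith
  have h4 := mul_le_mul_of_nonneg_left h2 (by positivity : 0 ≤ t / k)
  have h5 := mul_le_mul_of_nonneg_left h3 (by positivity : 0 ≤ t / k)
  have h6 : t / k * (1 / h) ≤ 2 * M := by
    rw [div_mul_div_comm, mul_one, div_le_iff₀ (by positivity)]
    have := mul_le_mul_of_nonneg_right hhk hh.le
    linarith
  have h7 : t / k * (4 * M * k / t) = 4 * M := by field_simp
  rw [modulus]
  linarith

lemma Scheme.increment_le {μ h N M A P k : ℝ} {f : ℕ → ℤ → ℝ → ℝ} {U : ℕ → ℤ → ℝ}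
    (hs : Scheme μ h N f U) (hM : 0 < M) (hA : 0 < A) (hP : 0 < P) (hk : k = 8 * M / A)
    (hU : ∀ n i, |U n i| ≤ M) (hfA : ∀ n i s, P ≤ |s| → A ≤ f n i s * s ^ 2)
    (hμ : μ ≤ 1 / 4) (hhk : h ≤ 2 * M * k) (n : ℕ)
    (ht : n * (μ * h ^ 2) ≤ (M * k) ^ 2 / (4 * k * P)) :
    ∀ i j : ℤ, i ≤ j →
      U (n + 1) j - U (n + 1) i ≤ modulus k (4 * M * k) ((n + 1 : ℕ) * (μ * h ^ 2)) ((j - i : ℤ) * h) := by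
  have hk0 : 0 < k := by rw [hk]; positivity
  have hh := hs.h_pos
  have hμ0 := hs.mu_pos
  have hdt : 0 < μ * h ^ 2 := by positivity
  induction n with
  | zero =>
    intro i j hij
    rcases hij.eq_or_lt with rfl | hij
    · simp [modulus_zero]
    have h1 : (1 : ℝ) ≤ (j - i : ℤ) := by exact_mod_cast (by omega : 1 ≤ j - i)
    have h2 := modulus_initial (t := (0 + 1 : ℕ) * (μ * h ^ 2)) (x := (j - i : ℤ) * h) hM hk0
      (by simpa using hdt) (by
        have := mul_le_mul_of_nonneg_right hμ (sq_nonneg h)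
        have := sq_nonneg h
        simp only [zero_add, Nat.cast_one, one_mul]
        linarith) hh hhk (le_mul_of_one_le_left hh.le h1)
    have := abs_le.1 (hU (0 + 1) j)
    have := abs_le.1 (hU (0 + 1) i)
    linarith
  | succ n ih =>
    intro i j hij
    rcases hij.eq_or_lt with rfl | hij
    · simp [modulus_zero]
    have h1 : (1 : ℝ) ≤ (j - i : ℤ) := by exact_mod_cast (by omega : 1 ≤ j - i)
    have hx : h ≤ (j - i : ℤ) * h := le_mul_of_one_le_left hh.le h1
    have b1 := abs_le.1 (hU (n + 1 + 1) j)
    have b2 := abs_le.1 (hU (n + 1 + 1) i)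
    obtain ⟨t, ht'⟩ : ∃ t : ℝ, t = (n + 1 : ℕ) * (μ * h ^ 2) := ⟨_, rfl⟩
    have ht0 : 0 < t := by rw [ht']; positivity
    have hnext : ((n + 1 + 1 : ℕ) : ℝ) * (μ * h ^ 2) = t + μ * h ^ 2 := by
      rw [ht']; push_cast; ring
    rw [hnext]
    by_cases hbig : 2 * M ≤ modulus k (4 * M * k) (t + μ * h ^ 2) ((j - i : ℤ) * h)
    · linarith
    push Not at hbig
    have hn4 : 4 * (μ * h ^ 2) ≤ t := by
      by_contra hlt
      push Not at hlt
      have e1 : ((n + 1 + 1 : ℕ) : ℝ) ≤ 4 := by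
        rw [ht'] at hlt
        have : ((n + 1 : ℕ) : ℝ) < 4 := lt_of_mul_lt_mul_right hlt hdt.le
        have : n + 1 < 4 := by exact_mod_cast this
        exact_mod_cast (by omega : n + 1 + 1 ≤ 4)
      have e2 := mul_le_mul_of_nonneg_right e1 hdt.le
      rw [hnext] at e2
      have e3 := mul_le_mul_of_nonneg_right hμ (sq_nonneg h)
      have := modulus_initial (t := t + μ * h ^ 2) hM hk0 (by positivity) (by linarith) hh hhk hx
      linarith
    rw [← ht'] at ht ih
    have ihn := ih (by rw [ht'] at ht; push_cast at ht; linarith)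
    have tm := modulus_time (k := k) (β := 4 * M * k) (x := (j - i : ℤ) * h) hk0 (by positivity) ht0
      hdt.le (by linarith)
    have hβ : 4 * M * k / k = 4 * M := by field_simp
    rw [hβ] at tm
    have hq : μ * h ^ 2 / t ≤ 1 / 4 := by rw [div_le_iff₀ ht0]; linarith
    have hq' := mul_le_mul_of_nonneg_left hq hM.le
    obtain ⟨hc, hfl⟩ := modulus_flux (x := (j - i : ℤ) * h) hA hP hM hk (hs.cont (n + 1) j)
      (hfA (n + 1) j) ht0 ht hh hx (by linarith)
    obtain ⟨Φ, hΦ⟩ : ∃ Φ : ℤ → ℝ, ∀ d, Φ d = modulus k (4 * M * k) t (d * h) := ⟨_, fun _ => rfl⟩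
    have p1 : modulus k (4 * M * k) t ((j - i : ℤ) * h + h) = Φ (j - i + 1) := by
      rw [hΦ]; push_cast; ring_nf
    have p2 : modulus k (4 * M * k) t ((j - i : ℤ) * h - h) = Φ (j - i - 1) := by
      rw [hΦ]; push_cast; ring_nf
    rw [p1, p2, ← hΦ] at hc hfl
    rw [← hΦ] at tm
    have st := hs.increment_step (n := n + 1) (Φ := Φ) (fun i j hij => by rw [hΦ]; exact ihn i j hij)
      hij hc
    have e1 := mul_le_mul_of_nonneg_left hfl (by positivity : 0 ≤ μ * h)
    have e2 : μ * h * (4 * M * h / t) = 4 * M * (μ * h ^ 2 / t) := by ring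
    linarith

/-- The short-time gradient bound. -/
lemma Scheme.slope_le {μ h N M A P k : ℝ} {f : ℕ → ℤ → ℝ → ℝ} {U : ℕ → ℤ → ℝ}
    (hs : Scheme μ h N f U) (hM : 0 < M) (hA : 0 < A) (hP : 0 < P) (hk : k = 8 * M / A)
    (hU : ∀ n i, |U n i| ≤ M) (hfA : ∀ n i s, P ≤ |s| → A ≤ f n i s * s ^ 2)
    (hμ : μ ≤ 1 / 4) (hhk : h ≤ 2 * M * k) {n : ℕ} (hn : 0 < n)
    (ht : n * (μ * h ^ 2) ≤ (M * k) ^ 2 / (4 * k * P)) (i : ℤ) :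
    U n (i + 1) - U n i ≤
      n * (μ * h ^ 2) / k * Real.exp (4 * M * k / (n * (μ * h ^ 2))) * h := by
  have hk0 : 0 < k := by rw [hk]; positivity
  have hh := hs.h_pos
  have hμ0 := hs.mu_pos
  obtain ⟨n, rfl⟩ : ∃ m, n = m + 1 := ⟨n - 1, by omega⟩
  have h1 := hs.increment_le hM hA hP hk hU hfA hμ hhk n
    (le_trans (by gcongr; exact n.le_succ) ht) i (i + 1) (by omega)
  rw [add_sub_cancel_left, Int.cast_one, one_mul, modulus] at h1
  refine h1.trans ?_
  have h2 := Real.log_le_sub_one_of_pos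
    (by positivity : 0 < 1 + h * Real.exp (4 * M * k / ((n + 1 : ℕ) * (μ * h ^ 2))))
  have h3 := mul_le_mul_of_nonneg_left h2
    (by positivity : 0 ≤ (n + 1 : ℕ) * (μ * h ^ 2) / k)
  linarith

end DiscreteParabolic

namespace DiscreteParabolic

/-- Coefficients which are locally bounded, locally uniformly elliptic and locally Hölder continuous,
uniformly in time, and which do not decay too fast for large slopes. -/
structure Coefficient (a : ℝ → ℝ → ℝ → ℝ → ℝ) (A P α : ℝ) : Prop where
  bounds : ∀ R : ℝ, ∃ lam Lam : ℝ, 0 < lam ∧ lam ≤ Lam ∧ 1 ≤ Lam ∧ ∀ p q x t,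
    |p| ≤ R → |q| ≤ R → |x| ≤ R → lam ≤ a p q x t ∧ a p q x t ≤ Lam
  holder : ∀ R : ℝ, ∃ κ : ℝ, 0 < κ ∧ ∀ p q x t p' q' x' t' δ,
    |p| ≤ R → |q| ≤ R → |x| ≤ R → |p'| ≤ R → |q'| ≤ R → |x'| ≤ R →
    |p' - p| ≤ δ → |q' - q| ≤ δ → |x' - x| ≤ δ → |t' - t| ≤ δ →
    |a p' q' x' t' - a p q x t| ≤ κ * δ ^ α
  coercive : ∀ p q x t, P ≤ |p| → A ≤ a p q x t * p ^ 2
  exponent : α ∈ Set.Ioo (0 : ℝ) 1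

namespace Coefficient

variable {a : ℝ → ℝ → ℝ → ℝ → ℝ} {A P α : ℝ}

lemma pos (ha : Coefficient a A P α) (p q x t : ℝ) : 0 < a p q x t := by
  obtain ⟨lam, Lam, h0, -, -, h⟩ := ha.bounds (max |p| (max |q| |x|))
  exact h0.trans_le (h p q x t (by simp) (by simp) (by simp)).1

lemma continuous (ha : Coefficient a A P α) :
    Continuous fun z : ℝ × ℝ × ℝ × ℝ => a z.1 z.2.1 z.2.2.1 z.2.2.2 := by
  rw [continuous_iff_continuousAt]
  rintro ⟨p, q, x, t⟩
  obtain ⟨κ, hκ, H⟩ := ha.holder (max |p| (max |q| |x|) + 1)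
  have hp : |p| ≤ max |p| (max |q| |x|) := by simp
  have hq : |q| ≤ max |p| (max |q| |x|) := by simp
  have hx : |x| ≤ max |p| (max |q| |x|) := by simp
  rw [ContinuousAt, tendsto_iff_dist_tendsto_zero]
  have hlim : Filter.Tendsto (fun z : ℝ × ℝ × ℝ × ℝ => κ * dist z (p, q, x, t) ^ α)
      (nhds (p, q, x, t)) (nhds 0) := by
    have h1 : Continuous fun z : ℝ × ℝ × ℝ × ℝ => κ * dist z (p, q, x, t) ^ α :=
      continuous_const.mul ((continuous_id.dist continuous_const).rpow_const
        fun _ => Or.inr ha.exponent.1.le)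
    have h2 := h1.tendsto (p, q, x, t)
    simpa [Real.zero_rpow ha.exponent.1.ne'] using h2
  refine squeeze_zero' (Filter.Eventually.of_forall fun z => dist_nonneg) ?_ hlim
  filter_upwards [Metric.ball_mem_nhds (p, q, x, t) one_pos] with z hz
  obtain ⟨p', q', x', t'⟩ := z
  have hd := (Metric.mem_ball.1 hz).le
  rw [Prod.dist_eq, Prod.dist_eq, Prod.dist_eq] at hd ⊢
  simp only [Real.dist_eq, max_le_iff] at hd ⊢
  obtain ⟨d1, d2, d3, d4⟩ := hd
  have near : ∀ {y y' : ℝ}, |y' - y| ≤ 1 → |y'| ≤ |y| + 1 := fun {y y'} h => by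
    have := abs_sub_abs_le_abs_sub y' y
    linarith
  have n1 := near d1
  have n2 := near d2
  have n3 := near d3
  exact H p q x t p' q' x' t' _ (by linarith) (by linarith) (by linarith) (by linarith)
    (by linarith) (by linarith) (by simp) (by simp) (by simp) (by simp)

end Coefficient

lemma Coefficient.of_clamp {a : ℝ → ℝ → ℝ → ℝ → ℝ} {A P α T : ℝ} (hT : 0 < T)
    (hα : α ∈ Set.Ioo (0 : ℝ) 1)
    (hpos : ∀ p q x : ℝ, ∀ t ∈ Set.Icc (0 : ℝ) T, 0 < a p q x t)
    (hold : ∀ K : Set (ℝ × ℝ × ℝ × ℝ),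
      K ⊆ Set.univ ×ˢ Set.univ ×ˢ Set.univ ×ˢ Set.Icc 0 T → Bornology.IsBounded K →
      ∃ C : ℝ, 0 < C ∧ ∀ z ∈ K, ∀ z' ∈ K,
        |a z.1 z.2.1 z.2.2.1 z.2.2.2 - a z'.1 z'.2.1 z'.2.2.1 z'.2.2.2| ≤ C * dist z z' ^ α)
    (hco : ∀ p q x : ℝ, ∀ t ∈ Set.Icc (0 : ℝ) T, P ≤ |p| → A ≤ a p q x t * p ^ 2) :
    Coefficient (fun p q x t => a p q x (Set.projIcc 0 T hT.le t)) A P α := by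
  obtain ⟨K, hK⟩ : ∃ K : ℝ → Set (ℝ × ℝ × ℝ × ℝ), ∀ R, K R = Set.Icc (-R) R ×ˢ
    Set.Icc (-R) R ×ˢ Set.Icc (-R) R ×ˢ Set.Icc 0 T := ⟨_, fun _ => rfl⟩
  have hcomp : ∀ R, IsCompact (K R) := fun R => by
    rw [hK]
    exact isCompact_Icc.prod (isCompact_Icc.prod (isCompact_Icc.prod isCompact_Icc))
  have hsub : ∀ R, K R ⊆ Set.univ ×ˢ Set.univ ×ˢ Set.univ ×ˢ Set.Icc 0 T := fun R => by
    rw [hK]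
    exact Set.prod_mono (Set.subset_univ _) (Set.prod_mono (Set.subset_univ _)
      (Set.prod_mono (Set.subset_univ _) subset_rfl))
  have hmem : ∀ R p q x t, |p| ≤ R → |q| ≤ R → |x| ≤ R →
      (p, q, x, (Set.projIcc 0 T hT.le t : ℝ)) ∈ K R := fun R p q x t hp hq hx => by
    rw [hK]
    exact ⟨abs_le.1 hp, abs_le.1 hq, abs_le.1 hx, (Set.projIcc 0 T hT.le t).2⟩
  have hcont : ∀ R, ContinuousOn (fun z : ℝ × ℝ × ℝ × ℝ => a z.1 z.2.1 z.2.2.1 z.2.2.2) (K R) := by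
    intro R z hz
    obtain ⟨C, hC, H⟩ := hold (K R) (hsub R) (hcomp R).isBounded
    rw [ContinuousWithinAt, tendsto_iff_dist_tendsto_zero]
    have h1 : Continuous fun w : ℝ × ℝ × ℝ × ℝ => C * dist w z ^ α :=
      continuous_const.mul ((continuous_id.dist continuous_const).rpow_const
        fun _ => Or.inr hα.1.le)
    have h2 := (h1.tendsto z).mono_left (nhdsWithin_le_nhds (s := K R))
    simp only [dist_self, Real.zero_rpow hα.1.ne', mul_zero] at h2
    refine squeeze_zero' (Filter.Eventually.of_forall fun z => dist_nonneg) ?_ h2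
    filter_upwards [self_mem_nhdsWithin] with w hw
    exact H w hw z hz
  refine ⟨fun R => ?_, fun R => ?_, fun p q x t h => hco p q x _ (Set.projIcc 0 T hT.le t).2 h, hα⟩
  · rcases (K R).eq_empty_or_nonempty with he | hne
    · refine ⟨1, 1, one_pos, le_rfl, le_rfl, fun p q x t hp hq hx => ?_⟩
      have := hmem R p q x t hp hq hx
      rw [he] at this
      exact this.elim
    · obtain ⟨z₀, hz₀, hmin⟩ := (hcomp R).exists_isMinOn hne (hcont R)
      obtain ⟨z₁, hz₁, hmax⟩ := (hcomp R).exists_isMaxOn hne (hcont R)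
      have hp0 := hpos z₀.1 z₀.2.1 z₀.2.2.1 z₀.2.2.2 (hsub R hz₀).2.2.2
      refine ⟨_, max 1 _, hp0, le_max_of_le_right (hmin hz₁), le_max_left _ _,
        fun p q x t hp hq hx => ⟨hmin (hmem R p q x t hp hq hx),
          le_max_of_le_right (hmax (hmem R p q x t hp hq hx))⟩⟩
  · obtain ⟨C, hC, H⟩ := hold (K R) (hsub R) (hcomp R).isBounded
    refine ⟨C, hC, fun p q x t p' q' x' t' δ h1 h2 h3 h1' h2' h3' d1 d2 d3 d4 => ?_⟩
    refine (H _ (hmem R p' q' x' t' h1' h2' h3') _ (hmem R p q x t h1 h2 h3)).trans ?_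
    refine mul_le_mul_of_nonneg_left (Real.rpow_le_rpow dist_nonneg ?_ hα.1.le) hC.le
    simp only [Prod.dist_eq, Real.dist_eq, max_le_iff]
    refine ⟨d1, d2, d3, le_trans ?_ d4⟩
    exact Set.abs_projIcc_sub_projIcc hT.le

/-- The scheme for the coefficient `a` truncated at `N`, with step initial data. -/
noncomputable def approx (a : ℝ → ℝ → ℝ → ℝ → ℝ) (M N μ h : ℝ) : ℕ → ℤ → ℝ
  | 0, i => M * Real.sign i
  | n + 1, i => approx a M N μ h n i + μ * h *
      ∫ s in ((approx a M N μ h n i - approx a M N μ h n (i - 1)) / h)..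
        ((approx a M N μ h n (i + 1) - approx a M N μ h n i) / h),
        min (a s (approx a M N μ h n i) (i * h) (n * (μ * h ^ 2))) N

lemma approx_scheme {a : ℝ → ℝ → ℝ → ℝ → ℝ} {A P α M N μ h : ℝ} (ha : Coefficient a A P α)
    (hμ : 0 < μ) (hh : 0 < h) (hN : 0 ≤ N) (hμN : μ * N ≤ 1 / 8) :
    Scheme μ h N (fun n i s => min (a s (approx a M N μ h n i) (i * h) (n * (μ * h ^ 2))) N)
      (approx a M N μ h) := by
  refine ⟨hμ, hh, hμN, fun n i => ?_, fun n i s => le_min (ha.pos _ _ _ _).le hN,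
    fun n i s => min_le_right _ _, fun n i => by rw [approx]⟩
  refine Continuous.min ?_ continuous_const
  exact ha.continuous.comp (g := fun z : ℝ × ℝ × ℝ × ℝ => a z.1 z.2.1 z.2.2.1 z.2.2.2)
    (f := fun s => (s, approx a M N μ h n i, (i : ℝ) * h, n * (μ * h ^ 2))) (by fun_prop)

lemma abs_approx_zero_le {a : ℝ → ℝ → ℝ → ℝ → ℝ} {M N μ h : ℝ} (hM : 0 ≤ M) (i : ℤ) :
    |approx a M N μ h 0 i| ≤ M := by
  rw [approx, abs_mul, abs_of_nonneg hM]
  refine mul_le_of_le_one_right hM ?_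
  rcases Real.sign_apply_eq (i : ℝ) with e | e | e <;> simp [e]

lemma approx_zero_le_succ {a : ℝ → ℝ → ℝ → ℝ → ℝ} {M N μ h : ℝ} (hM : 0 ≤ M) (i : ℤ) :
    approx a M N μ h 0 i ≤ approx a M N μ h 0 (i + 1) := by
  rw [approx, approx]
  refine mul_le_mul_of_nonneg_left ?_ hM
  rcases lt_trichotomy i 0 with hi | hi | hi
  · rw [Real.sign_of_neg (by exact_mod_cast hi)]
    rcases Real.sign_apply_eq ((i + 1 : ℤ) : ℝ) with e | e | e <;> rw [e] <;> norm_num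
  · subst hi
    simp
  · rw [Real.sign_of_pos (by exact_mod_cast hi), Real.sign_of_pos (by exact_mod_cast (by omega))]

/-- Parameters for which the truncated scheme is stable and keeps the coercivity. -/
structure Admissible (A P M N μ h : ℝ) : Prop where
  mu_pos : 0 < μ
  h_pos : 0 < h
  h_le : h ≤ 1
  h_slope : h ≤ 2 * M * (8 * M / A)
  mu_le : μ ≤ 1 / 8
  trunc_nonneg : 0 ≤ N
  trunc_coercive : A / P ^ 2 ≤ N
  stable : μ * N ≤ 1 / 8

section

variable {a : ℝ → ℝ → ℝ → ℝ → ℝ} {A P α M N μ h : ℝ}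

lemma abs_approx_le (ha : Coefficient a A P α) (hM : 0 ≤ M) (hp : Admissible A P M N μ h) (n : ℕ)
    (i : ℤ) : |approx a M N μ h n i| ≤ M :=
  (approx_scheme ha hp.mu_pos hp.h_pos hp.trunc_nonneg hp.stable).abs_le_of_init
    (abs_approx_zero_le hM) n i

lemma approx_slope_le (ha : Coefficient a A P α) (hM : 0 < M) (hA : 0 < A) (hP : 0 < P)
    (hp : Admissible A P M N μ h) {k : ℝ} (hk : k = 8 * M / A) {n : ℕ} (hn : 0 < n)
    (ht : n * (μ * h ^ 2) ≤ (M * k) ^ 2 / (4 * k * P)) (i : ℤ) :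
    |approx a M N μ h n (i + 1) - approx a M N μ h n i| ≤
      n * (μ * h ^ 2) / k * Real.exp (4 * M * k / (n * (μ * h ^ 2))) * h := by
  have hs := approx_scheme (M := M) ha hp.mu_pos hp.h_pos hp.trunc_nonneg hp.stable
  rw [abs_of_nonneg (sub_nonneg.2 (hs.monotone (approx_zero_le_succ hM.le) n i))]
  refine hs.slope_le hM hA hP hk (abs_approx_le ha hM.le hp) (fun n i s hsP => ?_)
    (hp.mu_le.trans (by norm_num)) (by rw [hk]; exact hp.h_slope) hn ht i
  have hs2 : P ^ 2 ≤ s ^ 2 := by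
    rw [← sq_abs s]
    exact pow_le_pow_left₀ hP.le hsP 2
  rcases le_total (a s (approx a M N μ h n i) (i * h) (n * (μ * h ^ 2))) N with hle | hle
  · rw [min_eq_left hle]
    exact ha.coercive _ _ _ _ hsP
  · rw [min_eq_right hle]
    have h1 := (div_le_iff₀ (by positivity)).1 hp.trunc_coercive
    exact h1.trans (mul_le_mul_of_nonneg_left hs2 hp.trunc_nonneg)

end

/-- Interior estimates for the approximations, uniform in the discretization parameters. -/
lemma approx_estimates {a : ℝ → ℝ → ℝ → ℝ → ℝ} {A P α M k X t₀ : ℝ} (ha : Coefficient a A P α)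
    (hM : 0 < M) (hA : 0 < A) (hP : 0 < P) (hk : k = 8 * M / A) (ht₀ : 0 < t₀) (hX : 0 ≤ X) :
    ∃ C γ r Λ : ℝ, 0 < C ∧ 0 < γ ∧ 0 < r ∧ ∀ (N μ h : ℝ) (n₀ : ℕ) (i₀ : ℤ),
      Admissible A P M N μ h → Λ ≤ N → h ≤ r → t₀ ≤ n₀ * (μ * h ^ 2) →
      n₀ * (μ * h ^ 2) ≤ (M * k) ^ 2 / (4 * k * P) → |i₀ * h| ≤ X →
      |lap (approx a M N μ h n₀) i₀| ≤ C * h ^ 2 ∧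
      ∀ (ρ : ℝ) (n : ℕ) (i : ℤ), h ≤ ρ → ρ ≤ r → Cyl μ (ρ / h) n₀ i₀ n i →
        |approx a M N μ h n i - approx a M N μ h n₀ i₀| ≤ C * ρ ^ γ ∧
        |(approx a M N μ h n (i + 1) - approx a M N μ h n i) / h -
          (approx a M N μ h n₀ (i₀ + 1) - approx a M N μ h n₀ i₀) / h| ≤ C * ρ ^ γ ∧
        |lap (approx a M N μ h n) i - lap (approx a M N μ h n₀) i₀| ≤ C * h ^ 2 * ρ ^ γ := by
  have hk0 : 0 < k := by rw [hk]; positivity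
  obtain ⟨G, hG⟩ : ∃ G, G = (M * k) ^ 2 / (4 * k * P) / k * Real.exp (4 * M * k / (t₀ / 2)) :=
    ⟨_, rfl⟩
  have hG0 : 0 ≤ G := by rw [hG]; positivity
  obtain ⟨r, hr⟩ : ∃ r, r = min 1 (Real.sqrt (t₀ / 2)) := ⟨_, rfl⟩
  have hr0 : 0 < r := by
    rw [hr]
    exact lt_min one_pos (Real.sqrt_pos.2 (by linarith))
  have hr1 : r ≤ 1 := by rw [hr]; exact min_le_left _ _
  have hr2 : r ^ 2 ≤ t₀ / 2 := by
    have h1 : r ≤ Real.sqrt (t₀ / 2) := by rw [hr]; exact min_le_right _ _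
    calc r ^ 2 ≤ Real.sqrt (t₀ / 2) ^ 2 := pow_le_pow_left₀ hr0.le h1 2
      _ = t₀ / 2 := Real.sq_sqrt (by linarith)
  obtain ⟨lam, Lam, hlam, hlL, hLam, hbd⟩ := ha.bounds (G + M + X + 1)
  obtain ⟨κ, hκ, hhold⟩ := ha.holder (G + M + X + 1)
  obtain ⟨C, γ, hC, hγ, -, H⟩ := quasilinear_estimates hlam hlL hLam ha.exponent.1 ha.exponent.2
    hG0 hκ.le hr0 hr1
  refine ⟨C, γ, r / 64, Lam, hC, hγ, by positivity, ?_⟩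
  intro N μ h n₀ i₀ hp hN hhr htn htT hix
  have hh := hp.h_pos
  have hμ := hp.mu_pos
  have hs := approx_scheme (M := M) ha hp.mu_pos hp.h_pos hp.trunc_nonneg hp.stable
  have hUM := abs_approx_le ha hM.le hp
  obtain ⟨U, hU⟩ : ∃ U, U = approx a M N μ h := ⟨_, rfl⟩
  choose ξ hξ hstep using hs.exists_slope
  rw [← hU] at hs hUM hξ hstep ⊢
  have scale : ∀ y ρ : ℝ, μ * y ≤ (ρ / h) ^ 2 → y * (μ * h ^ 2) ≤ ρ ^ 2 := fun y ρ hy => by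
    rw [div_pow, le_div_iff₀ (by positivity)] at hy
    linarith
  have hslope : ∀ n i, n ≤ n₀ → μ * ((n₀ : ℝ) - n) ≤ (r / h) ^ 2 →
      |U n (i + 1) - U n i| ≤ G * h := by
    intro n i hn hc
    have h1 := scale _ _ hc
    have h2 : t₀ / 2 ≤ n * (μ * h ^ 2) := by linarith
    have hn0 : 0 < n := by
      rcases Nat.eq_zero_or_pos n with h0 | h0
      · rw [h0, Nat.cast_zero, zero_mul] at h2
        linarith
      · exact h0
    have hnT : n * (μ * h ^ 2) ≤ (M * k) ^ 2 / (4 * k * P) :=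
      le_trans (mul_le_mul_of_nonneg_right (by exact_mod_cast hn) (by positivity)) htT
    have h3 := approx_slope_le ha hM hA hP hp hk hn0 hnT i
    rw [← hU] at h3
    refine h3.trans ?_
    rw [hG]
    gcongr
  have hbox : ∀ n i, Cyl μ (r / h) n₀ i₀ n i → |ξ n i| ≤ G + M + X + 1 ∧
      |U n i| ≤ G + M + X + 1 ∧ |i * h| ≤ G + M + X + 1 := by
    intro n i hc
    have hq : ∀ j : ℤ, (U n (j + 1) - U n j) / h ∈ Set.Icc (-G) G := fun j => by
      rw [Set.mem_Icc, ← abs_le, abs_div, abs_of_pos hh, div_le_iff₀ hh]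
      exact hslope n j hc.1 hc.2.1
    refine ⟨?_, by linarith [hUM n i], ?_⟩
    · have h1 := hq (i - 1)
      rw [sub_add_cancel] at h1
      have h2 := Set.uIcc_subset_Icc h1 (hq i) (hξ n i)
      linarith [abs_le.2 h2]
    · have h1 := hc.2.2
      rw [le_div_iff₀ hh] at h1
      have h2 : |(i : ℝ) * h - i₀ * h| ≤ r := by
        rw [← sub_mul, abs_mul, abs_of_pos hh]
        exact h1
      have h3 := abs_sub_abs_le_abs_sub ((i : ℝ) * h) (i₀ * h)
      linarith
  obtain ⟨b, hb⟩ : ∃ b : ℕ → ℤ → ℝ, ∀ n i, b n i =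
    min (a (ξ n i) (U n i) (i * h) (n * (μ * h ^ 2))) N := ⟨_, fun _ _ => rfl⟩
  have hba : ∀ n i, Cyl μ (r / h) n₀ i₀ n i →
      b n i = a (ξ n i) (U n i) (i * h) (n * (μ * h ^ 2)) := by
    intro n i hc
    obtain ⟨h1, h2, h3⟩ := hbox n i hc
    rw [hb, min_eq_left ((hbd _ _ _ _ h1 h2 h3).2.trans hN)]
  have hreg : Regular μ lam Lam b (fun n i => U n i / h) (r / h) n₀ i₀ := by
    refine ⟨fun n i hc => ?_, fun n i _ _ _ => ?_, fun n i hc => ?_, ?_⟩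
    · obtain ⟨h1, h2, h3⟩ := hbox n i hc
      refine ⟨?_, ?_⟩
      · rw [hba n i hc]
        exact (hbd _ _ _ _ h1 h2 h3).1
      · rw [hb]
        exact (hs.coeff_bounds n i (ξ n i)).2
    · rw [hstep n i, hb, lap, lap]
      field_simp
    · obtain ⟨h1, h2, h3⟩ := hbox n i hc
      rw [hba n i hc]
      exact (hbd _ _ _ _ h1 h2 h3).2
    · rw [div_pow, div_le_iff₀ (by positivity)]
      linarith
  obtain ⟨hl, hE⟩ := H μ h b U ξ n₀ i₀ hμ (hp.mu_le.trans (by norm_num)) hh hhr hreg hslope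
    (fun n i _ => hξ n i) (fun n i n' i' δ hc hc' d1 d2 d3 d4 => by
      obtain ⟨h1, h2, h3⟩ := hbox n i hc
      obtain ⟨h1', h2', h3'⟩ := hbox n' i' hc'
      rw [hba n i hc, hba n' i' hc']
      refine hhold _ _ _ _ _ _ _ _ δ h1 h2 h3 h1' h2' h3' d1 d2 ?_ ?_
      · rw [← sub_mul, abs_mul, abs_of_pos hh, mul_comm]
        exact d3
      · rw [← sub_mul, abs_mul, abs_of_pos (by positivity : 0 < μ * h ^ 2), mul_comm]
        exact d4)
  exact ⟨hl, fun ρ n i h1 h2 hc => hE ρ n i h1 (by linarith) hc⟩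

end DiscreteParabolic

namespace DiscreteParabolic

open Filter Topology

/-- Nodes of a sequence of space-time grids, with mesh sizes `h m` and `τ m`, converging to `(x, t)`
from times at most `T`. -/
def gridFilter (F : Filter ℕ) (h τ : ℕ → ℝ) (T x t : ℝ) : Filter (ℕ × ℕ × ℤ) :=
  comap Prod.fst F ⊓ comap (fun q => ((q.2.2 : ℝ) * h q.1, (q.2.1 : ℝ) * τ q.1))
    (𝓝[Set.univ ×ˢ Set.Iic T] (x, t))

section

variable {F : Filter ℕ} {h τ : ℕ → ℝ} {T x t : ℝ}

lemma eventually_gridFilter {p : ℕ → ℕ → ℤ → Prop} :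
    (∀ᶠ q in gridFilter F h τ T x t, p q.1 q.2.1 q.2.2) ↔
      ∃ δ > 0, ∀ᶠ m in F, ∀ (n : ℕ) (i : ℤ), |i * h m - x| < δ → |n * τ m - t| < δ →
        n * τ m ≤ T → p m n i := by
  have hb := (F.basis_sets.comap (Prod.fst : ℕ × ℕ × ℤ → ℕ)).inf
    ((Metric.nhdsWithin_basis_ball (x := (x, t)) (s := Set.univ ×ˢ Set.Iic T)).comap
      (fun q : ℕ × ℕ × ℤ => ((q.2.2 : ℝ) * h q.1, (q.2.1 : ℝ) * τ q.1)))
  rw [gridFilter, hb.eventually_iff]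
  constructor
  · rintro ⟨⟨s, δ⟩, ⟨hs, hδ⟩, H⟩
    refine ⟨δ, hδ, ?_⟩
    filter_upwards [hs] with m hm n i h1 h2 h3
    refine H (x := (m, n, i)) ⟨hm, ?_, ?_⟩
    · rw [Metric.mem_ball, Prod.dist_eq]
      exact max_lt h1 h2
    · exact ⟨trivial, h3⟩
  · rintro ⟨δ, hδ, H⟩
    refine ⟨(_, δ), ⟨H, hδ⟩, ?_⟩
    rintro ⟨m, n, i⟩ ⟨hm, hball, hT⟩
    simp only [id] at hm
    rw [Metric.mem_ball, Prod.dist_eq] at hball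
    exact hm n i ((le_max_left _ _).trans_lt hball) ((le_max_right _ _).trans_lt hball) hT.2

lemma tendsto_gridFilter_fst : Tendsto Prod.fst (gridFilter F h τ T x t) F :=
  tendsto_comap.mono_left inf_le_left

lemma tendsto_gridFilter_pos :
    Tendsto (fun q : ℕ × ℕ × ℤ => ((q.2.2 : ℝ) * h q.1, (q.2.1 : ℝ) * τ q.1))
      (gridFilter F h τ T x t) (𝓝 (x, t)) :=
  (tendsto_comap.mono_left inf_le_right).mono_right nhdsWithin_le_nhds

lemma tendsto_floor_mul (hh : ∀ m, 0 < h m) (h0 : Tendsto h F (𝓝 0)) (x : ℝ) :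
    Tendsto (fun m => (⌊x / h m⌋ : ℝ) * h m) F (𝓝 x) := by
  rw [tendsto_iff_dist_tendsto_zero]
  refine squeeze_zero (fun _ => dist_nonneg) (fun m => ?_) h0
  have h1 := mul_le_mul_of_nonneg_right (Int.floor_le (x / h m)) (hh m).le
  have h2 := mul_le_mul_of_nonneg_right (Int.lt_floor_add_one (x / h m)).le (hh m).le
  rw [div_mul_cancel₀ _ (hh m).ne'] at h1 h2
  rw [Real.dist_eq, abs_sub_comm, abs_of_nonneg (by linarith)]
  linarith

lemma natFloor_mul_eq (ht : 0 ≤ t) {δ : ℝ} (hδ : 0 < δ) :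
    ((⌊t / δ⌋₊ : ℕ) : ℝ) = ((⌊t / δ⌋ : ℤ) : ℝ) :=
  natCast_floor_eq_intCast_floor (by positivity)

lemma natFloor_mul_le (ht : 0 ≤ t) {δ : ℝ} (hδ : 0 < δ) : (⌊t / δ⌋₊ : ℝ) * δ ≤ t := by
  have := mul_le_mul_of_nonneg_right (Nat.floor_le (by positivity : 0 ≤ t / δ)) hδ.le
  rwa [div_mul_cancel₀ _ hδ.ne'] at this

lemma tendsto_natFloor_mul (hτ : ∀ m, 0 < τ m) (h0 : Tendsto τ F (𝓝 0)) (ht : 0 ≤ t) :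
    Tendsto (fun m => (⌊t / τ m⌋₊ : ℝ) * τ m) F (𝓝 t) := by
  simp only [natFloor_mul_eq ht (hτ _)]
  exact tendsto_floor_mul hτ h0 t

lemma tendsto_node (hh : ∀ m, 0 < h m) (hτ : ∀ m, 0 < τ m) (hh0 : Tendsto h F (𝓝 0))
    (hτ0 : Tendsto τ F (𝓝 0)) (ht : 0 ≤ t) (htT : t ≤ T) :
    Tendsto (fun m => (m, ⌊t / τ m⌋₊, ⌊x / h m⌋)) F (gridFilter F h τ T x t) := by
  refine tendsto_inf.2 ⟨tendsto_comap_iff.2 tendsto_id, tendsto_comap_iff.2 ?_⟩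
  refine tendsto_nhdsWithin_iff.2 ⟨?_, Eventually.of_forall fun m => ⟨trivial, ?_⟩⟩
  · exact (tendsto_floor_mul hh hh0 x).prodMk_nhds (tendsto_natFloor_mul hτ hτ0 ht)
  · exact (natFloor_mul_le ht (hτ m)).trans htT

lemma gridFilter_neBot [F.NeBot] (hh : ∀ m, 0 < h m) (hτ : ∀ m, 0 < τ m) (hh0 : Tendsto h F (𝓝 0))
    (hτ0 : Tendsto τ F (𝓝 0)) (ht : 0 ≤ t) (htT : t ≤ T) : (gridFilter F h τ T x t).NeBot :=
  (tendsto_node (x := x) hh hτ hh0 hτ0 ht htT).neBot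

lemma tendsto_shift (hh : ∀ m, 0 < h m) (hh0 : Tendsto h F (𝓝 0)) {f : ℕ → ℕ → ℤ → ℝ} {c : ℝ}
    (hf : Tendsto (fun q : ℕ × ℕ × ℤ => f q.1 q.2.1 q.2.2) (gridFilter F h τ T x t) (𝓝 c)) :
    Tendsto (fun q : ℕ × ℕ × ℤ => f q.1 q.2.1 (q.2.2 + 1)) (gridFilter F h τ T x t) (𝓝 c) := by
  rw [Metric.tendsto_nhds] at hf ⊢
  intro ε hε
  obtain ⟨δ, hδ, H⟩ := (eventually_gridFilter
    (p := fun m n i => dist (f m n i) c < ε)).1 (hf ε hε)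
  refine (eventually_gridFilter (p := fun m n i => dist (f m n (i + 1)) c < ε)).2
    ⟨δ / 2, by positivity, ?_⟩
  filter_upwards [H, hh0.eventually (gt_mem_nhds (by positivity : 0 < δ / 2))]
    with m hm hmh n i h1 h2 h3
  refine hm n (i + 1) ?_ (by linarith) h3
  have h4 := abs_add_le ((i : ℝ) * h m - x) (h m)
  rw [abs_of_pos (hh m)] at h4
  push_cast
  rw [show ((i : ℝ) + 1) * h m - x = i * h m - x + h m by ring]
  linarith

/-- Equicontinuity of grid functions near `(x, t)`, at scales above the mesh size. -/
def EquiHolder (F : Filter ℕ) (h τ : ℕ → ℝ) (T x t : ℝ) (f : ℕ → ℕ → ℤ → ℝ) : Prop :=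
  ∃ C γ r δ : ℝ, 0 < γ ∧ 0 < r ∧ 0 < δ ∧ ∀ᶠ m in F, ∀ (n : ℕ) (i : ℤ),
    |i * h m - x| < δ → |n * τ m - t| < δ → n * τ m ≤ T → |f m n i| ≤ C ∧
      ∀ (ρ : ℝ) (n' : ℕ) (i' : ℤ), h m ≤ ρ → ρ ≤ r → n' ≤ n → (n - n') * τ m ≤ ρ ^ 2 →
        |i' * h m - i * h m| ≤ ρ → |f m n' i' - f m n i| ≤ C * ρ ^ γ

lemma EquiHolder.oscillation {f : ℕ → ℕ → ℤ → ℝ} (hf : EquiHolder F h τ T x t f)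
    (hh0 : Tendsto h F (𝓝 0)) {ε : ℝ} (hε : 0 < ε) :
    ∃ δ > 0, ∀ᶠ m in F, ∀ (n n' : ℕ) (i i' : ℤ), |i * h m - x| < δ → |n * τ m - t| < δ →
      n * τ m ≤ T → |i' * h m - x| < δ → |n' * τ m - t| < δ → n' * τ m ≤ T →
      |f m n' i' - f m n i| ≤ ε := by
  obtain ⟨C, γ, r, δ₀, hγ, hr, hδ₀, H⟩ := hf
  have hlim : Tendsto (fun ρ : ℝ => C * ρ ^ γ) (𝓝[>] 0) (𝓝 0) := by
    have h1 := ((Real.continuous_rpow_const hγ.le).tendsto 0).const_mul C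
    rw [Real.zero_rpow hγ.ne', mul_zero] at h1
    exact h1.mono_left nhdsWithin_le_nhds
  obtain ⟨ρ, h1, h2, h3⟩ := ((hlim.eventually (gt_mem_nhds hε)).and
    ((eventually_mem_nhdsWithin (a := (0 : ℝ)) (s := Set.Ioi 0)).and
      (mem_nhdsWithin_of_mem_nhds (gt_mem_nhds hr)))).exists
  have hρ : 0 < ρ := h2
  refine ⟨min δ₀ (min (ρ ^ 2 / 2) (ρ / 2)), by positivity, ?_⟩
  filter_upwards [H, hh0.eventually (gt_mem_nhds hρ)] with m hm hmρ n n' i i' a1 a2 a3 b1 b2 b3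
  simp only [lt_min_iff] at a1 a2 b1 b2
  have hx : |(i' : ℝ) * h m - i * h m| ≤ ρ := by
    have := abs_sub_le ((i' : ℝ) * h m) x (i * h m)
    rw [abs_sub_comm x] at this
    linarith
  have ht : |(n' : ℝ) * τ m - n * τ m| ≤ ρ ^ 2 := by
    have := abs_sub_le ((n' : ℝ) * τ m) t (n * τ m)
    rw [abs_sub_comm t] at this
    linarith
  rcases le_total n' n with hn | hn
  · refine ((hm n i a1.1 a2.1 a3).2 ρ n' i' hmρ.le (le_of_lt h3) hn ?_ hx).trans h1.le
    linarith [neg_abs_le ((n' : ℝ) * τ m - n * τ m)]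
  · rw [abs_sub_comm]
    refine ((hm n' i' b1.1 b2.1 b3).2 ρ n i hmρ.le (le_of_lt h3) hn ?_
      (by rwa [abs_sub_comm])).trans h1.le
    linarith [le_abs_self ((n' : ℝ) * τ m - n * τ m)]

end

lemma EquiHolder.exists_limit {F : Ultrafilter ℕ} {h τ : ℕ → ℝ} {T x t : ℝ} {f : ℕ → ℕ → ℤ → ℝ}
    (hf : EquiHolder F h τ T x t f) (hh : ∀ m, 0 < h m) (hτ : ∀ m, 0 < τ m)
    (hh0 : Tendsto h F (𝓝 0)) (hτ0 : Tendsto τ F (𝓝 0)) (ht : 0 ≤ t) (htT : t ≤ T) :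
    ∃ c, Tendsto (fun q : ℕ × ℕ × ℤ => f q.1 q.2.1 q.2.2) (gridFilter F h τ T x t) (𝓝 c) := by
  have hnode := tendsto_node (x := x) hh hτ hh0 hτ0 ht htT
  obtain ⟨c, hc⟩ : ∃ c, Tendsto (fun m => f m ⌊t / τ m⌋₊ ⌊x / h m⌋) F (𝓝 c) := by
    obtain ⟨C, γ, r, δ, -, -, hδ, H⟩ := hf
    have h1 : ∀ᶠ q in gridFilter F h τ T x t, |f q.1 q.2.1 q.2.2| ≤ C :=
      (eventually_gridFilter (p := fun m n i => |f m n i| ≤ C)).2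
        ⟨δ, hδ, H.mono fun m hm n i a1 a2 a3 => (hm n i a1 a2 a3).1⟩
    have h2 := hnode.eventually h1
    obtain ⟨c, -, hc⟩ := (isCompact_Icc (a := -C) (b := C)).ultrafilter_le_nhds
      (F.map fun m => f m ⌊t / τ m⌋₊ ⌊x / h m⌋)
      (by
        rw [le_principal_iff]
        exact h2.mono fun m hm => abs_le.1 hm)
    exact ⟨c, hc⟩
  refine ⟨c, Metric.tendsto_nhds.2 fun ε hε => ?_⟩
  obtain ⟨δ, hδ, H⟩ := hf.oscillation hh0 (half_pos hε)
  refine (eventually_gridFilter (p := fun m n i => dist (f m n i) c < ε)).2 ⟨δ, hδ, ?_⟩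
  have h1 := hnode.eventually ((eventually_gridFilter (p := fun m n i => |i * h m - x| < δ ∧
    |n * τ m - t| < δ ∧ n * τ m ≤ T)).2 ⟨δ, hδ, Eventually.of_forall
      fun m n i a1 a2 a3 => ⟨a1, a2, a3⟩⟩)
  filter_upwards [H, h1, (Metric.tendsto_nhds.1 hc) (ε / 2) (half_pos hε)]
    with m hm ⟨b1, b2, b3⟩ hmc n i a1 a2 a3
  have h2 := hm _ n _ i b1 b2 b3 a1 a2 a3
  have h3 := dist_triangle (f m n i) (f m ⌊t / τ m⌋₊ ⌊x / h m⌋) c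
  rw [Real.dist_eq (f m n i) (f m _ _)] at h3
  linarith

section

variable {F : Filter ℕ} [F.NeBot] {h τ : ℕ → ℝ} {T : ℝ} {f g : ℕ → ℕ → ℤ → ℝ} {u : ℝ → ℝ → ℝ}

lemma continuousOn_of_tendsto (hh : ∀ m, 0 < h m) (hτ : ∀ m, 0 < τ m)
    (hh0 : Tendsto h F (𝓝 0)) (hτ0 : Tendsto τ F (𝓝 0))
    (hu : ∀ x, ∀ t ∈ Set.Ioc 0 T, Tendsto (fun q : ℕ × ℕ × ℤ => f q.1 q.2.1 q.2.2)
      (gridFilter F h τ T x t) (𝓝 (u x t))) :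
    ContinuousOn (fun z : ℝ × ℝ => u z.1 z.2) (Set.univ ×ˢ Set.Ioc 0 T) := by
  rintro ⟨x, t⟩ ⟨-, ht⟩
  refine Metric.tendsto_nhds.2 fun ε hε => ?_
  obtain ⟨δ, hδ, H⟩ := (eventually_gridFilter (p := fun m n i => dist (f m n i) (u x t) < ε / 2)).1
    (Metric.tendsto_nhds.1 (hu x t ht) (ε / 2) (half_pos hε))
  filter_upwards [self_mem_nhdsWithin,
    mem_nhdsWithin_of_mem_nhds (Metric.ball_mem_nhds (x, t) (half_pos hδ))]
  rintro ⟨y, s⟩ ⟨-, hs⟩ hb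
  rw [Metric.mem_ball, Prod.dist_eq, max_lt_iff, Real.dist_eq, Real.dist_eq] at hb
  have hne := gridFilter_neBot (x := y) hh hτ hh0 hτ0 hs.1.le hs.2
  have h1 : ∀ᶠ q in gridFilter F h τ T y s, dist (f q.1 q.2.1 q.2.2) (u x t) ≤ ε / 2 := by
    refine (eventually_gridFilter (p := fun m n i => dist (f m n i) (u x t) ≤ ε / 2)).2
      ⟨δ / 2, half_pos hδ, H.mono fun m hm n i a1 a2 a3 => (hm n i ?_ ?_ a3).le⟩
    · have := abs_sub_le ((i : ℝ) * h m) y x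
      linarith
    · have := abs_sub_le ((n : ℝ) * τ m) s t
      linarith
  have h2 := le_of_tendsto ((hu y s hs).dist tendsto_const_nhds) h1
  simp only
  linarith

lemma abs_telescope_le {φ : ℕ → ℝ} {c e : ℝ} (d : ℕ)
    (H : ∀ l < d, |φ (l + 1) - φ l - c| ≤ e) : |φ d - φ 0 - c * d| ≤ e * d := by
  induction d with
  | zero => simp
  | succ d ih =>
    have h1 := ih fun l hl => H l (by omega)
    have h2 := H d (by omega)
    have h3 := abs_add_le (φ d - φ 0 - c * d) (φ (d + 1) - φ d - c)
    push_cast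
    rw [show φ (d + 1) - φ 0 - c * ((d : ℝ) + 1) = φ d - φ 0 - c * d + (φ (d + 1) - φ d - c) by ring]
    linarith

/-- The difference quotient bound which identifies limits of difference quotients. -/
lemma abs_sub_sub_mul_le_of_tendsto {φ ψ y z : ℕ → ℝ} {a b y₀ z₀ c ε : ℝ}
    (hφ : Tendsto φ F (𝓝 a)) (hψ : Tendsto ψ F (𝓝 b)) (hy : Tendsto y F (𝓝 y₀))
    (hz : Tendsto z F (𝓝 z₀))
    (H : ∀ᶠ m in F, |ψ m - φ m - c * (z m - y m)| ≤ ε * |z m - y m|) :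
    |b - a - c * (z₀ - y₀)| ≤ ε * |z₀ - y₀| :=
  le_of_tendsto_of_tendsto (((hψ.sub hφ).sub ((hz.sub hy).const_mul c)).abs)
    ((hz.sub hy).abs.const_mul ε) H

lemma abs_space_increment_le {φ γ : ℤ → ℝ} {η x δ c ε : ℝ} (hη : 0 < η)
    (hφ : ∀ i, φ (i + 1) - φ i = η * γ i)
    (hγ : ∀ i : ℤ, |i * η - x| < δ → |γ i - c| ≤ ε) {i j : ℤ} (hij : i ≤ j)
    (hi : |i * η - x| < δ) (hj : |j * η - x| < δ) :
    |φ j - φ i - c * (j * η - i * η)| ≤ ε * |j * η - i * η| := by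
  obtain ⟨d, rfl⟩ : ∃ d : ℕ, j = i + d := ⟨(j - i).toNat, by omega⟩
  have h1 := abs_telescope_le (φ := fun l : ℕ => φ (i + l)) (c := c * η) (e := ε * η) d
    fun l hl => by
      have hl' : (l : ℝ) ≤ d := by exact_mod_cast hl.le
      have h2 := mul_le_mul_of_nonneg_right hl' hη.le
      have h0 : 0 ≤ (l : ℝ) * η := by positivity
      rw [abs_lt] at hi hj
      push_cast at hj
      have h3 := hγ (i + l) (by
        push_cast
        rw [abs_lt]
        constructor <;> linarith)
      push_cast
      rw [← add_assoc, hφ, show η * γ (i + l) - c * η = (γ (i + l) - c) * η by ring, abs_mul,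
        abs_of_pos hη]
      exact mul_le_mul_of_nonneg_right h3 hη.le
  simp only [Nat.cast_zero, add_zero] at h1
  push_cast
  rw [show ((i : ℝ) + d) * η - i * η = d * η by ring,
    abs_of_nonneg (by positivity : 0 ≤ (d : ℝ) * η),
    show c * ((d : ℝ) * η) = c * η * d by ring]
  linarith

lemma hasDerivAt_of_tendsto (hh : ∀ m, 0 < h m) (hτ : ∀ m, 0 < τ m)
    (hh0 : Tendsto h F (𝓝 0)) (hτ0 : Tendsto τ F (𝓝 0)) {x t v : ℝ} (ht : t ∈ Set.Ioc 0 T)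
    (hu : ∀ y, Tendsto (fun q : ℕ × ℕ × ℤ => f q.1 q.2.1 q.2.2)
      (gridFilter F h τ T y t) (𝓝 (u y t)))
    (hg : Tendsto (fun q : ℕ × ℕ × ℤ => g q.1 q.2.1 q.2.2) (gridFilter F h τ T x t) (𝓝 v))
    (hfg : ∀ m n i, f m n (i + 1) - f m n i = h m * g m n i) :
    HasDerivAt (fun y => u y t) v x := by
  rw [hasDerivAt_iff_isLittleO, Asymptotics.isLittleO_iff]
  intro ε hε
  obtain ⟨δ, hδ, H⟩ := (eventually_gridFilter (p := fun m n i => dist (g m n i) v < ε)).1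
    (Metric.tendsto_nhds.1 hg ε hε)
  filter_upwards [Metric.ball_mem_nhds x hδ] with y hy
  rw [Metric.mem_ball, Real.dist_eq] at hy
  rw [smul_eq_mul, Real.norm_eq_abs, Real.norm_eq_abs, mul_comm _ v]
  have ev : ∀ z : ℝ, |z - x| < δ → ∀ᶠ m in F, |⌊z / h m⌋ * h m - x| < δ := fun z hz =>
    ((tendsto_floor_mul hh hh0 z).sub_const x).abs.eventually (gt_mem_nhds hz)
  have evt : ∀ᶠ m in F, |⌊t / τ m⌋₊ * τ m - t| < δ :=
    ((tendsto_natFloor_mul hτ hτ0 ht.1.le).sub_const t).abs.eventually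
      (gt_mem_nhds (by simpa using hδ))
  refine abs_sub_sub_mul_le_of_tendsto (F := F)
    ((hu x).comp (tendsto_node hh hτ hh0 hτ0 ht.1.le ht.2))
    ((hu y).comp (tendsto_node hh hτ hh0 hτ0 ht.1.le ht.2))
    (tendsto_floor_mul hh hh0 x) (tendsto_floor_mul hh hh0 y) ?_
  filter_upwards [H, ev x (by simpa using hδ), ev y hy, evt] with m hm mx my mt
  have key : ∀ {i j : ℤ}, i ≤ j → |i * h m - x| < δ → |j * h m - x| < δ → _ :=
    fun {i j} => abs_space_increment_le (φ := f m ⌊t / τ m⌋₊) (hh m) (hfg m _)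
      (fun i hi => (hm _ i hi mt ((natFloor_mul_le ht.1.le (hτ m)).trans ht.2)).le)
  simp only [Function.comp]
  rcases le_total ⌊x / h m⌋ ⌊y / h m⌋ with hle | hle
  · exact key hle mx my
  · have h1 := key hle my mx
    rw [← abs_neg, abs_sub_comm (_ * _)] at h1
    refine le_trans (le_of_eq ?_) h1
    congr 1
    ring

lemma hasDerivWithinAt_of_tendsto (hh : ∀ m, 0 < h m) (hτ : ∀ m, 0 < τ m)
    (hh0 : Tendsto h F (𝓝 0)) (hτ0 : Tendsto τ F (𝓝 0)) {x t v : ℝ} (ht : t ∈ Set.Ioc 0 T)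
    (hu : ∀ s ∈ Set.Ioc 0 T, Tendsto (fun q : ℕ × ℕ × ℤ => f q.1 q.2.1 q.2.2)
      (gridFilter F h τ T x s) (𝓝 (u x s)))
    (hg : Tendsto (fun q : ℕ × ℕ × ℤ => g q.1 q.2.1 q.2.2) (gridFilter F h τ T x t) (𝓝 v))
    (hfg : ∀ m n i, f m (n + 1) i - f m n i = τ m * g m n i) :
    HasDerivWithinAt (fun s => u x s) v (Set.Ioc 0 T) t := by
  rw [hasDerivWithinAt_iff_isLittleO, Asymptotics.isLittleO_iff]
  intro ε hε
  obtain ⟨δ, hδ, H⟩ := (eventually_gridFilter (p := fun m n i => dist (g m n i) v < ε)).1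
    (Metric.tendsto_nhds.1 hg ε hε)
  filter_upwards [self_mem_nhdsWithin, mem_nhdsWithin_of_mem_nhds (Metric.ball_mem_nhds t hδ)]
    with s hs hst
  rw [Metric.mem_ball, Real.dist_eq] at hst
  rw [smul_eq_mul, Real.norm_eq_abs, Real.norm_eq_abs, mul_comm _ v]
  have ev : ∀ r ∈ Set.Ioc 0 T, |r - t| < δ → ∀ᶠ m in F, |⌊r / τ m⌋₊ * τ m - t| < δ :=
    fun r hr hrt => ((tendsto_natFloor_mul hτ hτ0 hr.1.le).sub_const t).abs.eventually
      (gt_mem_nhds hrt)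
  have evx : ∀ᶠ m in F, |⌊x / h m⌋ * h m - x| < δ :=
    ((tendsto_floor_mul hh hh0 x).sub_const x).abs.eventually (gt_mem_nhds (by simpa using hδ))
  refine abs_sub_sub_mul_le_of_tendsto (F := F)
    ((hu t ht).comp (tendsto_node hh hτ hh0 hτ0 ht.1.le ht.2))
    ((hu s hs).comp (tendsto_node hh hτ hh0 hτ0 hs.1.le hs.2))
    (tendsto_natFloor_mul hτ hτ0 ht.1.le) (tendsto_natFloor_mul hτ hτ0 hs.1.le) ?_
  filter_upwards [H, ev t ht (by simpa using hδ), ev s hs hst, evx] with m hm mt ms mx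
  have hTt := (natFloor_mul_le ht.1.le (hτ m)).trans ht.2
  have hTs := (natFloor_mul_le hs.1.le (hτ m)).trans hs.2
  have key : ∀ {n n' : ℕ}, n ≤ n' → |n * τ m - t| < δ → |n' * τ m - t| < δ → n' * τ m ≤ T →
      |f m n' ⌊x / h m⌋ - f m n ⌊x / h m⌋ - v * (n' * τ m - n * τ m)| ≤
        ε * |n' * τ m - n * τ m| := by
    intro n n' hn h1 h2 h3
    obtain ⟨d, rfl⟩ : ∃ d, n' = n + d := ⟨n' - n, by omega⟩
    have h4 := abs_telescope_le (φ := fun l : ℕ => f m (n + l) ⌊x / h m⌋) (c := v * τ m)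
      (e := ε * τ m) d fun l hl => by
        have hl' : (l : ℝ) ≤ d := by exact_mod_cast hl.le
        have h5 := mul_le_mul_of_nonneg_right hl' (hτ m).le
        have h0 : 0 ≤ (l : ℝ) * τ m := mul_nonneg l.cast_nonneg (hτ m).le
        rw [abs_lt] at h1 h2
        push_cast at h2 h3
        have h6 := hm (n + l) _ mx (by
          push_cast
          rw [abs_lt]
          constructor <;> linarith) (by push_cast; linarith)
        rw [← add_assoc, hfg, show τ m * g m (n + l) ⌊x / h m⌋ - v * τ m =
          (g m (n + l) ⌊x / h m⌋ - v) * τ m by ring, abs_mul, abs_of_pos (hτ m)]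
        exact mul_le_mul_of_nonneg_right h6.le (hτ m).le
    simp only [add_zero] at h4
    push_cast
    rw [show ((n : ℝ) + d) * τ m - n * τ m = d * τ m by ring,
      abs_of_nonneg (mul_nonneg d.cast_nonneg (hτ m).le : 0 ≤ (d : ℝ) * τ m),
      show v * ((d : ℝ) * τ m) = v * τ m * d by ring]
    linarith
  simp only [Function.comp]
  rcases le_total ⌊t / τ m⌋₊ ⌊s / τ m⌋₊ with hle | hle
  · exact key hle mt ms hTs
  · have h1 := key hle ms mt hTt
    rw [← abs_neg, abs_sub_comm (_ * _)] at h1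
    refine le_trans (le_of_eq ?_) h1
    congr 1
    ring

end

/-- The initial data are attained at a linear rate away from the jump. -/
lemma approx_near_init {a : ℝ → ℝ → ℝ → ℝ → ℝ} {A P α M x : ℝ} (ha : Coefficient a A P α)
    (hM : 0 < M) (hx : x ≠ 0) :
    ∃ K L : ℝ, ∀ (N μ h : ℝ) (n : ℕ) (i : ℤ), Admissible A P M N μ h →
      |approx a M N μ h n i - M * Real.sign x| ≤ K * (i * h - x) ^ 2 + L * (n * (μ * h ^ 2)) := by
  obtain ⟨r, hr⟩ : ∃ r, r = |x| / 2 := ⟨_, rfl⟩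
  have hr0 : 0 < r := by
    rw [hr]
    exact half_pos (abs_pos.2 hx)
  obtain ⟨K, hK⟩ : ∃ K, K = 2 * M / r ^ 2 := ⟨_, rfl⟩
  have hK0 : 0 < K := by rw [hK]; positivity
  have hKr : 2 * M ≤ K * r ^ 2 := by
    rw [hK, div_mul_cancel₀ _ (by positivity)]
  obtain ⟨lam, Lam, -, -, hLam, hbd⟩ := ha.bounds (2 * K * (r + 1) + M + (|x| + r))
  refine ⟨K, 2 * K * Lam, fun N μ h n i hp => ?_⟩
  have hh := hp.h_pos
  have hs := approx_scheme (M := M) ha hp.mu_pos hp.h_pos hp.trunc_nonneg hp.stable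
  have hUM := abs_approx_le ha hM.le hp
  have hf : ∀ (n : ℕ) (i : ℤ) (s : ℝ), |i * h - x| ≤ r → |s| ≤ 2 * K * (r + h) →
      min (a s (approx a M N μ h n i) (i * h) (n * (μ * h ^ 2))) N ≤ Lam := by
    intro n i s h1 h2
    have h3 : 2 * K * (r + h) ≤ 2 * K * (r + 1) :=
      mul_le_mul_of_nonneg_left (by linarith [hp.h_le]) (by linarith)
    have h4 : 0 ≤ 2 * K * (r + 1) := by positivity
    have h5 := abs_sub_abs_le_abs_sub ((i : ℝ) * h) x
    have h6 := abs_nonneg x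
    exact (min_le_left _ _).trans (hbd _ _ _ _ (by linarith) (by linarith [hUM n i])
      (by linarith)).2
  have hLam0 : 0 ≤ Lam := by linarith
  have hb := abs_le.1 (hUM n i)
  have near : ∀ i : ℤ, |i * h - x| < r → 0 < x * i := by
    intro i hi
    rw [hr] at hi
    have h2 : 0 < x * (i * h) := by
      rcases lt_or_gt_of_ne hx with h0 | h0
      · rw [abs_of_neg h0, abs_lt] at hi
        exact mul_pos_of_neg_of_neg h0 (by linarith)
      · rw [abs_of_pos h0, abs_lt] at hi
        exact mul_pos h0 (by linarith)
    rw [← mul_assoc] at h2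
    exact pos_of_mul_pos_left h2 hh.le
  rcases lt_or_gt_of_ne hx with h0 | h0
  · have h1 := hs.neg.barrier (M := M) (K := K) (L := 2 * K * Lam) (x := x) (r := r) (B := Lam)
      (fun n i => neg_le_neg (abs_le.1 (hUM n i)).2) hK0.le hr0.le hKr rfl hLam0
      (fun n i s g1 g2 => hf n i (-s) g1 (by rwa [abs_neg]))
      (fun i hi => by
        rw [approx, Real.sign_of_neg (neg_of_mul_pos_right (near i hi) h0.le)]
        linarith) n i
    rw [Real.sign_of_neg h0, abs_of_nonneg (by linarith)]
    linarith
  · have h1 := hs.barrier (M := M) (K := K) (L := 2 * K * Lam) (x := x) (r := r) (B := Lam)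
      (fun n i => (abs_le.1 (hUM n i)).1) hK0.le hr0.le hKr rfl hLam0 hf
      (fun i hi => by
        rw [approx, Real.sign_of_pos (pos_of_mul_pos_right (near i hi) h0.le)]
        linarith) n i
    rw [Real.sign_of_pos h0, abs_sub_comm, abs_of_nonneg (by linarith)]
    linarith

section

variable {F : Filter ℕ} {a : ℝ → ℝ → ℝ → ℝ → ℝ} {A P α M k T x t : ℝ} {N μ h : ℕ → ℝ}

lemma approx_equiHolder (ha : Coefficient a A P α) (hM : 0 < M) (hA : 0 < A) (hP : 0 < P)
    (hk : k = 8 * M / A) (hp : ∀ m, Admissible A P M (N m) (μ m) (h m))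
    (hN : Tendsto N F atTop) (hh0 : Tendsto h F (𝓝 0)) (ht : 0 < t)
    (hT : T ≤ (M * k) ^ 2 / (4 * k * P)) :
    EquiHolder F h (fun m => μ m * h m ^ 2) T x t (fun m => approx a M (N m) (μ m) (h m)) ∧
    EquiHolder F h (fun m => μ m * h m ^ 2) T x t (fun m n i =>
      (approx a M (N m) (μ m) (h m) n (i + 1) - approx a M (N m) (μ m) (h m) n i) / h m) ∧
    EquiHolder F h (fun m => μ m * h m ^ 2) T x t (fun m n i =>
      lap (approx a M (N m) (μ m) (h m) n) i / h m ^ 2) := by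
  have hk0 : 0 < k := by rw [hk]; positivity
  obtain ⟨C, γ, r, Λ, hC, hγ, hr, H⟩ := approx_estimates (k := k) (X := |x| + 1) (t₀ := t / 2) ha
    hM hA hP hk (half_pos ht) (by positivity)
  obtain ⟨G, hG⟩ : ∃ G, G = (M * k) ^ 2 / (4 * k * P) / k * Real.exp (4 * M * k / (t / 2)) :=
    ⟨_, rfl⟩
  have hG0 : 0 ≤ G := by rw [hG]; positivity
  have hδ : 0 < min 1 (t / 2) := by positivity
  have ev : ∀ᶠ m in F, ∀ (n : ℕ) (i : ℤ), |i * h m - x| < min 1 (t / 2) →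
      |n * (μ m * h m ^ 2) - t| < min 1 (t / 2) → n * (μ m * h m ^ 2) ≤ T →
      |(approx a M (N m) (μ m) (h m) n (i + 1) - approx a M (N m) (μ m) (h m) n i) / h m| ≤ G ∧
      |lap (approx a M (N m) (μ m) (h m) n) i| ≤ C * h m ^ 2 ∧
      ∀ (ρ : ℝ) (n' : ℕ) (i' : ℤ), h m ≤ ρ → ρ ≤ r → n' ≤ n →
        (n - n') * (μ m * h m ^ 2) ≤ ρ ^ 2 → |i' * h m - i * h m| ≤ ρ →
        |approx a M (N m) (μ m) (h m) n' i' - approx a M (N m) (μ m) (h m) n i| ≤ C * ρ ^ γ ∧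
        |(approx a M (N m) (μ m) (h m) n' (i' + 1) - approx a M (N m) (μ m) (h m) n' i') / h m -
          (approx a M (N m) (μ m) (h m) n (i + 1) - approx a M (N m) (μ m) (h m) n i) / h m| ≤
            C * ρ ^ γ ∧
        |lap (approx a M (N m) (μ m) (h m) n') i' - lap (approx a M (N m) (μ m) (h m) n) i| ≤
          C * h m ^ 2 * ρ ^ γ := by
    filter_upwards [hN.eventually_ge_atTop Λ, hh0.eventually (gt_mem_nhds hr)]
      with m hmN hmr n i h1 h2 h3
    have hh := (hp m).h_pos
    have hμ := (hp m).mu_pos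
    rw [lt_min_iff] at h1 h2
    have h2' := abs_lt.1 h2.2
    have htn : t / 2 ≤ n * (μ m * h m ^ 2) := by linarith
    have hn0 : 0 < n := by
      rcases Nat.eq_zero_or_pos n with e | e
      · rw [e, Nat.cast_zero, zero_mul] at htn
        linarith
      · exact e
    have hxi : |i * h m| ≤ |x| + 1 := by
      have := abs_sub_abs_le_abs_sub ((i : ℝ) * h m) x
      linarith
    obtain ⟨hl, hE⟩ := H (N m) (μ m) (h m) n i (hp m) hmN hmr.le htn (h3.trans hT) hxi
    refine ⟨?_, hl, fun ρ n' i' g1 g2 g3 g4 g5 => hE ρ n' i' g1 g2 ⟨g3, ?_, ?_⟩⟩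
    · rw [abs_div, abs_of_pos hh, div_le_iff₀ hh]
      refine (approx_slope_le ha hM hA hP (hp m) hk hn0 (h3.trans hT) i).trans ?_
      have h4 := h3.trans hT
      rw [hG]
      gcongr
    · rw [div_pow, le_div_iff₀ (by positivity)]
      linarith
    · rw [le_div_iff₀ hh]
      rwa [← sub_mul, abs_mul, abs_of_pos hh] at g5
  refine ⟨⟨C + M, γ, r, _, hγ, hr, hδ, ?_⟩, ⟨C + G, γ, r, _, hγ, hr, hδ, ?_⟩,
    ⟨C, γ, r, _, hγ, hr, hδ, ?_⟩⟩
  · filter_upwards [ev] with m hm n i h1 h2 h3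
    obtain ⟨-, -, hE⟩ := hm n i h1 h2 h3
    refine ⟨by linarith [abs_approx_le ha hM.le (hp m) n i], fun ρ n' i' g1 g2 g3 g4 g5 => ?_⟩
    have hρ : 0 ≤ ρ := (hp m).h_pos.le.trans g1
    exact (hE ρ n' i' g1 g2 g3 g4 g5).1.trans
      (mul_le_mul_of_nonneg_right (by linarith) (by positivity))
  · filter_upwards [ev] with m hm n i h1 h2 h3
    obtain ⟨hs, -, hE⟩ := hm n i h1 h2 h3
    refine ⟨by linarith, fun ρ n' i' g1 g2 g3 g4 g5 => ?_⟩
    have hρ : 0 ≤ ρ := (hp m).h_pos.le.trans g1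
    exact (hE ρ n' i' g1 g2 g3 g4 g5).2.1.trans
      (mul_le_mul_of_nonneg_right (by linarith) (by positivity))
  · filter_upwards [ev] with m hm n i h1 h2 h3
    obtain ⟨-, hl, hE⟩ := hm n i h1 h2 h3
    have hh : 0 < h m ^ 2 := pow_pos (hp m).h_pos 2
    refine ⟨?_, fun ρ n' i' g1 g2 g3 g4 g5 => ?_⟩
    · rwa [abs_div, abs_of_pos hh, div_le_iff₀ hh]
    · rw [← sub_div, abs_div, abs_of_pos hh, div_le_iff₀ hh]
      linarith [(hE ρ n' i' g1 g2 g3 g4 g5).2.2]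

end

lemma exists_admissible {A P M : ℝ} (hM : 0 < M) (hA : 0 < A) :
    ∃ N μ h : ℕ → ℝ, (∀ m, Admissible A P M (N m) (μ m) (h m)) ∧ Tendsto N atTop atTop ∧
      Tendsto h atTop (𝓝 0) := by
  obtain ⟨c, hc⟩ : ∃ c, c = min 1 (2 * M * (8 * M / A)) := ⟨_, rfl⟩
  have hc0 : 0 < c := by rw [hc]; positivity
  have hc1 : c ≤ 1 := by rw [hc]; exact min_le_left _ _
  have hc2 : c ≤ 2 * M * (8 * M / A) := by rw [hc]; exact min_le_right _ _
  obtain ⟨D, hD⟩ : ∃ D, D = max 1 (A / P ^ 2) := ⟨_, rfl⟩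
  have hD1 : 1 ≤ D := by rw [hD]; exact le_max_left _ _
  have hD2 : A / P ^ 2 ≤ D := by rw [hD]; exact le_max_right _ _
  refine ⟨fun m => m + D, fun m => 1 / (8 * (m + D)), fun m => c / (m + 1), fun m => ?_,
    tendsto_atTop_add_const_right _ _ tendsto_natCast_atTop_atTop, ?_⟩
  · have hm : (0 : ℝ) ≤ m := m.cast_nonneg
    have hle : c / ((m : ℝ) + 1) ≤ c := div_le_self hc0.le (by linarith)
    refine ⟨by positivity, by positivity, hle.trans hc1, hle.trans hc2, ?_, by positivity,
      by linarith, le_of_eq ?_⟩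
    · exact one_div_le_one_div_of_le (by norm_num) (by linarith)
    · have : (m : ℝ) + D ≠ 0 := by positivity
      field_simp
  · have h1 := (tendsto_one_div_add_atTop_nhds_zero_nat (𝕜 := ℝ)).const_mul c
    rw [mul_zero] at h1
    exact h1.congr fun m => by ring

lemma abs_sub_le_of_mem_uIcc {y z ξ : ℝ} (hξ : ξ ∈ Set.uIcc y z) : |ξ - z| ≤ |z - y| := by
  rw [Set.uIcc_comm] at hξ
  rw [abs_sub_comm z y]
  exact Set.abs_sub_left_of_mem_uIcc hξ

lemma exists_solution {a : ℝ → ℝ → ℝ → ℝ → ℝ} {A P α M k T : ℝ} (ha : Coefficient a A P α)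
    (hM : 0 < M) (hA : 0 < A) (hP : 0 < P) (hk : k = 8 * M / A)
    (hT : T ≤ (M * k) ^ 2 / (4 * k * P)) :
    ∃ u v w : ℝ → ℝ → ℝ,
      (∀ x, ∀ t ∈ Set.Ioc 0 T,
        HasDerivWithinAt (fun s => u x s) (a (v x t) (u x t) x t * w x t) (Set.Ioc 0 T) t) ∧
      (∀ x, ∀ t ∈ Set.Ioc 0 T, HasDerivAt (fun y => u y t) (v x t) x) ∧
      (∀ x, ∀ t ∈ Set.Ioc 0 T, HasDerivAt (fun y => v y t) (w x t) x) ∧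
      ContinuousOn (fun z : ℝ × ℝ => u z.1 z.2) (Set.univ ×ˢ Set.Ioc 0 T) ∧
      ContinuousOn (fun z : ℝ × ℝ => v z.1 z.2) (Set.univ ×ˢ Set.Ioc 0 T) ∧
      ContinuousOn (fun z : ℝ × ℝ => w z.1 z.2) (Set.univ ×ˢ Set.Ioc 0 T) ∧
      (∀ x, ∀ t ∈ Set.Ioc 0 T, |u x t| ≤ M) ∧
      (∀ x, ∀ t ∈ Set.Ioc 0 T, |v x t| ≤ t / k * Real.exp (4 * M * k / t)) ∧
      (∀ x, x ≠ 0 → ∃ L, ∀ t ∈ Set.Ioc 0 T, |u x t - M * Real.sign x| ≤ L * t) := by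
  have hk0 : 0 < k := by rw [hk]; positivity
  obtain ⟨N, μ, h, hp, hN, hh0⟩ := exists_admissible (A := A) (P := P) hM hA
  have hF : (hyperfilter ℕ : Filter ℕ) ≤ atTop := Nat.hyperfilter_le_atTop
  obtain ⟨F, hFe⟩ : ∃ F, F = hyperfilter ℕ := ⟨_, rfl⟩
  rw [← hFe] at hF
  replace hN := hN.mono_left hF
  replace hh0 := hh0.mono_left hF
  have hh : ∀ m, 0 < h m := fun m => (hp m).h_pos
  obtain ⟨τ, hτe⟩ : ∃ τ : ℕ → ℝ, τ = fun m => μ m * h m ^ 2 := ⟨_, rfl⟩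
  have hτ : ∀ m, 0 < τ m := fun m => by
    rw [hτe]
    exact mul_pos (hp m).mu_pos (pow_pos (hh m) 2)
  have hτ0 : Tendsto τ F (𝓝 0) := by
    refine squeeze_zero (fun m => (hτ m).le) (fun m => ?_) hh0
    have h1 : μ m * h m ≤ 1 * 1 := mul_le_mul ((hp m).mu_le.trans (by norm_num)) (hp m).h_le
      (hh m).le zero_le_one
    have h2 := mul_le_mul_of_nonneg_right h1 (hh m).le
    rw [hτe]
    linarith
  obtain ⟨U, hU⟩ : ∃ U : ℕ → ℕ → ℤ → ℝ, ∀ m, U m = approx a M (N m) (μ m) (h m) :=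
    ⟨_, fun _ => rfl⟩
  obtain ⟨p, hpe⟩ : ∃ p : ℕ → ℕ → ℤ → ℝ, ∀ m n i, p m n i = (U m n (i + 1) - U m n i) / h m :=
    ⟨_, fun _ _ _ => rfl⟩
  obtain ⟨W, hW⟩ : ∃ W : ℕ → ℕ → ℤ → ℝ, ∀ m n i, W m n i = lap (U m n) i / h m ^ 2 :=
    ⟨_, fun _ _ _ => rfl⟩
  have hs := fun m => approx_scheme (M := M) ha (hp m).mu_pos (hh m) (hp m).trunc_nonneg
    (hp m).stable
  choose ξ hξ hstep using fun m => (hs m).exists_slope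
  simp only [← hU] at hξ hstep
  have lims : ∀ x t, ∃ c d e : ℝ, t ∈ Set.Ioc 0 T →
      Tendsto (fun q : ℕ × ℕ × ℤ => U q.1 q.2.1 q.2.2) (gridFilter F h τ T x t) (𝓝 c) ∧
      Tendsto (fun q : ℕ × ℕ × ℤ => p q.1 q.2.1 q.2.2) (gridFilter F h τ T x t) (𝓝 d) ∧
      Tendsto (fun q : ℕ × ℕ × ℤ => W q.1 q.2.1 q.2.2) (gridFilter F h τ T x t) (𝓝 e) := by
    intro x t
    by_cases ht : t ∈ Set.Ioc 0 T
    · obtain ⟨h1, h2, h3⟩ := approx_equiHolder (x := x) (t := t) ha hM hA hP hk hp hN hh0 ht.1 hT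
      simp only [← hU, ← hpe, ← hW, ← hτe] at h1 h2 h3
      obtain ⟨c, hc⟩ := h1.exists_limit hh hτ hh0 hτ0 ht.1.le ht.2
      obtain ⟨d, hd⟩ := h2.exists_limit hh hτ hh0 hτ0 ht.1.le ht.2
      obtain ⟨e, he⟩ := h3.exists_limit hh hτ hh0 hτ0 ht.1.le ht.2
      exact ⟨c, d, e, fun _ => ⟨hc, hd, he⟩⟩
    · exact ⟨0, 0, 0, fun h => absurd h ht⟩
  choose u v w huvw using lims
  have hu := fun x t ht => (huvw x t ht).1
  have hv := fun x t ht => (huvw x t ht).2.1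
  have hw := fun x t ht => (huvw x t ht).2.2
  refine ⟨u, v, w, fun x t ht => ?_, fun x t ht => ?_, fun x t ht => ?_,
    continuousOn_of_tendsto hh hτ hh0 hτ0 hu, continuousOn_of_tendsto hh hτ hh0 hτ0 hv,
    continuousOn_of_tendsto hh hτ hh0 hτ0 hw, fun x t ht => ?_, fun x t ht => ?_,
    fun x hx => ?_⟩
  · have hpos := tendsto_gridFilter_pos (F := (F : Filter ℕ)) (h := h) (τ := τ) (T := T) (x := x)
      (t := t)
    have hfst := tendsto_gridFilter_fst (F := (F : Filter ℕ)) (h := h) (τ := τ) (T := T) (x := x)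
      (t := t)
    have hξp : ∀ m n i, |ξ m n i - p m n i| ≤ h m * |W m n i| := by
      intro m n i
      have h1 := abs_sub_le_of_mem_uIcc (hξ m n i)
      rw [hpe]
      refine h1.trans (le_of_eq ?_)
      rw [hW, lap, ← abs_of_pos (hh m), ← abs_mul, abs_of_pos (hh m)]
      congr 1
      have := (hh m).ne'
      field_simp
      ring
    have hξlim : Tendsto (fun q : ℕ × ℕ × ℤ => ξ q.1 q.2.1 q.2.2) (gridFilter F h τ T x t)
        (𝓝 (v x t)) := by
      have h1 : Tendsto (fun q : ℕ × ℕ × ℤ => h q.1 * |W q.1 q.2.1 q.2.2|)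
          (gridFilter F h τ T x t) (𝓝 0) := by
        simpa using (hh0.comp hfst).mul (hw x t ht).abs
      have h2 : Tendsto (fun q : ℕ × ℕ × ℤ => ξ q.1 q.2.1 q.2.2 - p q.1 q.2.1 q.2.2)
          (gridFilter F h τ T x t) (𝓝 0) :=
        squeeze_zero_norm (fun q => hξp q.1 q.2.1 q.2.2) h1
      simpa using h2.add (hv x t ht)
    have hlim : Tendsto (fun q : ℕ × ℕ × ℤ => a (ξ q.1 q.2.1 q.2.2) (U q.1 q.2.1 q.2.2)
        (q.2.2 * h q.1) (q.2.1 * τ q.1)) (gridFilter F h τ T x t)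
        (𝓝 (a (v x t) (u x t) x t)) :=
      (ha.continuous.tendsto (v x t, u x t, x, t)).comp
        (hξlim.prodMk_nhds ((hu x t ht).prodMk_nhds hpos))
    have hmin : Tendsto (fun q : ℕ × ℕ × ℤ => min (a (ξ q.1 q.2.1 q.2.2) (U q.1 q.2.1 q.2.2)
        (q.2.2 * h q.1) (q.2.1 * τ q.1)) (N q.1)) (gridFilter F h τ T x t)
        (𝓝 (a (v x t) (u x t) x t)) := by
      refine hlim.congr' ?_
      filter_upwards [hlim.eventually (gt_mem_nhds (lt_add_one _)),
        (hN.comp hfst).eventually_ge_atTop (a (v x t) (u x t) x t + 1)] with q h1 h2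
      exact (min_eq_left (h1.le.trans h2)).symm
    refine hasDerivWithinAt_of_tendsto (f := U) (g := fun m n i =>
      min (a (ξ m n i) (U m n i) (i * h m) (n * τ m)) (N m) * W m n i) hh hτ hh0 hτ0 ht
      (fun s hs => hu x s hs) (hmin.mul (hw x t ht)) fun m n i => ?_
    rw [hstep, hW, hτe]
    have := (hh m).ne'
    field_simp
    ring
  · refine hasDerivAt_of_tendsto (f := U) (g := p) hh hτ hh0 hτ0 ht (fun y => hu y t ht)
      (hv x t ht) fun m n i => ?_
    rw [hpe, mul_div_cancel₀ _ (hh m).ne']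
  · refine hasDerivAt_of_tendsto (f := p) (g := fun m n i => W m n (i + 1)) hh hτ hh0 hτ0 ht
      (fun y => hv y t ht) (tendsto_shift hh hh0 (hw x t ht)) fun m n i => ?_
    rw [hpe, hpe, hW, lap, add_sub_cancel_right]
    have := (hh m).ne'
    field_simp
    ring
  · have := gridFilter_neBot (x := x) hh hτ hh0 hτ0 ht.1.le ht.2
    refine le_of_tendsto (hu x t ht).abs (Eventually.of_forall fun q => ?_)
    rw [hU]
    exact abs_approx_le ha hM.le (hp _) _ _
  · have := gridFilter_neBot (x := x) hh hτ hh0 hτ0 ht.1.le ht.2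
    have hpos : Tendsto (fun q : ℕ × ℕ × ℤ => (q.2.1 : ℝ) * τ q.1) (gridFilter F h τ T x t)
        (𝓝 t) := (continuous_snd.tendsto (x, t)).comp tendsto_gridFilter_pos
    have hlim := (hpos.div_const k).mul
      ((Real.continuous_exp.tendsto _).comp (tendsto_const_nhds (x := 4 * M * k) |>.div hpos ht.1.ne'))
    refine le_of_tendsto_of_tendsto (hv x t ht).abs hlim ?_
    refine (eventually_gridFilter (p := fun m n i => |p m n i| ≤
      n * τ m / k * Real.exp (4 * M * k / (n * τ m)))).2 ⟨t, ht.1, Eventually.of_forall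
        fun m n i _ h2 h3 => ?_⟩
    have hn : 0 < n := by
      rcases Nat.eq_zero_or_pos n with e | e
      · rw [e, Nat.cast_zero, zero_mul, zero_sub, abs_neg, abs_of_pos ht.1] at h2
        exact absurd h2 (lt_irrefl _)
      · exact e
    rw [hpe, abs_div, abs_of_pos (hh m), div_le_iff₀ (hh m), hU]
    rw [hτe] at h3 ⊢
    exact approx_slope_le ha hM hA hP (hp m) hk hn (h3.trans hT) i
  · obtain ⟨K, L, H⟩ := approx_near_init ha hM hx
    refine ⟨L, fun t ht => ?_⟩
    have := gridFilter_neBot (x := x) hh hτ hh0 hτ0 ht.1.le ht.2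
    have hpos := tendsto_gridFilter_pos (F := (F : Filter ℕ)) (h := h) (τ := τ) (T := T) (x := x)
      (t := t)
    have hlim : Tendsto (fun q : ℕ × ℕ × ℤ => K * (q.2.2 * h q.1 - x) ^ 2 + L * (q.2.1 * τ q.1))
        (gridFilter F h τ T x t) (𝓝 (L * t)) := by
      have hc : Continuous fun z : ℝ × ℝ => K * (z.1 - x) ^ 2 + L * z.2 := by fun_prop
      simpa [Function.comp_def] using (hc.tendsto (x, t)).comp hpos
    refine le_of_tendsto_of_tendsto ((hu x t ht).sub_const _).abs hlim
      (Eventually.of_forall fun q => ?_)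
    simp only
    rw [hU, hτe]
    exact H _ _ _ _ _ (hp _)

end DiscreteParabolic

open DiscreteParabolic in
/-- Existence of an entire solution of `u_t = a(u_x,u,x,t) u_{xx}`
with the step function `M·σ` as initial data, together with the short-time
gradient estimate. -/
theorem existence_entire_step_function :
    ∀ M A P : ℝ, 0 < M → 0 < A → 0 < P →
    ∃ T' C₁ C₂ : ℝ, 0 < T' ∧ 0 < C₁ ∧ 0 < C₂ ∧
      ∀ (T : ℝ), 0 < T →
      ∀ (a : ℝ → ℝ → ℝ → ℝ → ℝ),
      (∀ p q x : ℝ, ∀ t ∈ Set.Icc (0:ℝ) T, 0 < a p q x t) →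
      (∃ α : ℝ, α ∈ Set.Ioo (0:ℝ) 1 ∧
        ∀ K : Set (ℝ × ℝ × ℝ × ℝ),
          K ⊆ Set.univ ×ˢ Set.univ ×ˢ Set.univ ×ˢ Set.Icc 0 T →
          Bornology.IsBounded K →
          ∃ C : ℝ, 0 < C ∧ ∀ z ∈ K, ∀ z' ∈ K,
            |a z.1 z.2.1 z.2.2.1 z.2.2.2 - a z'.1 z'.2.1 z'.2.2.1 z'.2.2.2|
              ≤ C * dist z z' ^ α) →
      (∀ p q x : ℝ, ∀ t ∈ Set.Icc (0:ℝ) T, P ≤ |p| → A ≤ a p q x t * p ^ 2) →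
      ∃ u ut ux uxx : ℝ → ℝ → ℝ,
        (∀ x : ℝ, ∀ t ∈ Set.Ioc (0:ℝ) (min T T'),
          HasDerivWithinAt (fun s => u x s) (ut x t) (Set.Ioc 0 (min T T')) t) ∧
        (∀ x : ℝ, ∀ t ∈ Set.Ioc (0:ℝ) (min T T'),
          HasDerivAt (fun y => u y t) (ux x t) x) ∧
        (∀ x : ℝ, ∀ t ∈ Set.Ioc (0:ℝ) (min T T'),
          HasDerivAt (fun y => ux y t) (uxx x t) x) ∧
        ContinuousOn (fun z : ℝ × ℝ => ut z.1 z.2) (Set.univ ×ˢ Set.Ioc 0 (min T T')) ∧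
        ContinuousOn (fun z : ℝ × ℝ => ux z.1 z.2) (Set.univ ×ˢ Set.Ioc 0 (min T T')) ∧
        ContinuousOn (fun z : ℝ × ℝ => uxx z.1 z.2) (Set.univ ×ˢ Set.Ioc 0 (min T T')) ∧
        (∀ x : ℝ, ∀ t ∈ Set.Ioc (0:ℝ) (min T T'),
          ut x t = a (ux x t) (u x t) x t * uxx x t) ∧
        (∀ x : ℝ, ∀ t ∈ Set.Ioc (0:ℝ) (min T T'), |u x t| ≤ M) ∧
        (∀ x : ℝ, ∀ t ∈ Set.Ioc (0:ℝ) (min T T'),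
          |ux x t| ≤ C₁ * Real.sqrt t * (1 + t) * Real.exp (C₂ / t)) ∧
        (∀ x : ℝ, x ≠ 0 →
          Filter.Tendsto (fun t => u x t) (nhdsWithin 0 (Set.Ioi 0))
            (nhds (M * Real.sign x))) := by
  intro M A P hM hA hP
  obtain ⟨k, hk⟩ : ∃ k, k = 8 * M / A := ⟨_, rfl⟩
  have hk0 : 0 < k := by rw [hk]; positivity
  refine ⟨(M * k) ^ 2 / (4 * k * P), 1 / k, 4 * M * k, by positivity, by positivity,
    by positivity, ?_⟩
  rintro T hT a hpos ⟨α, hα, hold⟩ hco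
  have ha := Coefficient.of_clamp hT hα hpos hold hco
  obtain ⟨T₀, hT₀⟩ : ∃ T₀, T₀ = min T ((M * k) ^ 2 / (4 * k * P)) := ⟨_, rfl⟩
  have hT₀0 : 0 < T₀ := by rw [hT₀]; exact lt_min hT (by positivity)
  obtain ⟨u, v, w, h1, h2, h3, hcu, hcv, hcw, h4, h5, h6⟩ := exists_solution (T := T₀) ha hM hA hP
    hk (by rw [hT₀]; exact min_le_right _ _)
  rw [← hT₀]
  have hclamp : ∀ t ∈ Set.Ioc 0 T₀, (Set.projIcc 0 T hT.le t : ℝ) = t := by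
    intro t ht
    rw [Set.projIcc_of_mem hT.le ⟨ht.1.le, ht.2.trans (by rw [hT₀]; exact min_le_left _ _)⟩]
  refine ⟨u, fun x t => a (v x t) (u x t) x (Set.projIcc 0 T hT.le t) * w x t, v, w, h1, h2, h3,
    ?_, hcv, hcw, fun x t ht => by simp only [hclamp t ht], h4, fun x t ht => ?_, fun x hx => ?_⟩
  · refine ContinuousOn.mul ?_ hcw
    exact ha.continuous.comp_continuousOn (hcv.prodMk (hcu.prodMk continuousOn_id))
  · refine (h5 x t ht).trans (mul_le_mul_of_nonneg_right ?_ (Real.exp_pos _).le)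
    have hs := Real.sqrt_nonneg t
    have e := Real.mul_self_sqrt ht.1.le
    have hle : t ≤ Real.sqrt t * (1 + t) := by
      rcases le_total (Real.sqrt t) 1 with g | g
      · have g1 := mul_le_mul_of_nonneg_left g hs
        have g2 := mul_nonneg hs ht.1.le
        linarith
      · have g1 := mul_le_mul_of_nonneg_right g ht.1.le
        linarith
    have g3 := mul_le_mul_of_nonneg_left hle (one_div_pos.2 hk0).le
    rw [mul_assoc]
    refine le_trans (le_of_eq ?_) g3
    ring
  · obtain ⟨L, hL⟩ := h6 x hx
    rw [tendsto_iff_dist_tendsto_zero]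
    have hlim : Filter.Tendsto (fun t : ℝ => L * t) (nhdsWithin 0 (Set.Ioi 0)) (nhds 0) := by
      have hc : Continuous fun t : ℝ => L * t := by fun_prop
      simpa using (hc.tendsto 0).mono_left (nhdsWithin_le_nhds (s := Set.Ioi 0))
    refine squeeze_zero' (Filter.Eventually.of_forall fun _ => dist_nonneg) ?_ hlim
    filter_upwards [Ioc_mem_nhdsGT hT₀0] with t ht
    exact hL t ht
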